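/- Fix an integer n ≥ 7 and ε > 0. Then there exist δ = δ(ε,n) > 0 and p_0 such that for every prime p ≥ p_0, every positive integer N with N^n > p^{1/3+ε}, all intervals I_1, …, I_n ⊂ F_p not containing 0, each of length N, all complex coefficients α_1(x_1), …, α_n(x_n) with |α_i(x_i)| ≤ 1, and every a ∈ F_p with a ≠ 0, one has |∑_{x_1∈I_1} … ∑_{x_n∈I_n} α_1(x_1)⋯α_n(x_n) e_p(a x_1^{-1}⋯x_n^{-1})| < p^{−δ}·N^n. -/

import Mathlib

open Finset

/-- The interval `{a+1, a+2, …, a+N}` in `ZMod p`. -/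
def interval (p : ℕ) (a : ZMod p) (N : ℕ) : Finset (ZMod p) :=
  (Finset.Icc 1 N).image (fun i : ℕ => a + (i : ZMod p))

/-- `e_p(z) = exp(2πi z/p)` for `z ∈ ZMod p`. -/
noncomputable def ep (p : ℕ) (z : ZMod p) : ℂ :=
  Complex.exp (2 * (Real.pi : ℂ) * Complex.I * (z.val : ℂ) / (p : ℂ))

namespace MultilinearKloosterman

/-- The divisor bound `τ(n) ≪ n ^ κ`. -/
theorem exists_card_divisors_le (κ : ℝ) (hκ : 0 < κ) :
    ∃ C : ℝ, 1 ≤ C ∧ ∀ n : ℕ, n ≠ 0 → (#n.divisors : ℝ) ≤ C * (n : ℝ) ^ κ := by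
  set c : ℝ := κ * Real.log 2 with hc
  have hc0 : 0 < c := mul_pos hκ (Real.log_pos (by norm_num))
  set M : ℝ := max 1 (1 / c) with hM
  have hM1 : 1 ≤ M := le_max_left _ _
  set B : ℕ := ⌈(2 : ℝ) ^ (1 / κ)⌉₊ with hB
  have small (q e : ℕ) (hq : 2 ≤ q) : (e + 1 : ℝ) ≤ M * ((q : ℝ) ^ e) ^ κ := by
    have h1 : (1 + e * c : ℝ) ≤ ((q : ℝ) ^ e) ^ κ := by
      calc (1 + e * c : ℝ) ≤ Real.exp (e * c) := by linarith [Real.add_one_le_exp (e * c : ℝ)]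
        _ = ((2 : ℝ) ^ e) ^ κ := by
          rw [← Real.rpow_natCast, ← Real.rpow_mul (by norm_num),
            Real.rpow_def_of_pos (by norm_num)]
          congr 1; rw [hc]; ring
        _ ≤ ((q : ℝ) ^ e) ^ κ := by
          gcongr
          exact_mod_cast hq
    have h2 : (e + 1 : ℝ) ≤ M * (1 + e * c) := by
      have h3 : 1 ≤ M * c := by
        calc (1 : ℝ) = 1 / c * c := by field_simp
          _ ≤ M * c := by gcongr; exact le_max_right _ _
      have he : (0 : ℝ) ≤ e := by positivity
      nlinarith
    exact h2.trans (by gcongr)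
  have large (q e : ℕ) (hq : B ≤ q) (hq0 : 2 ≤ q) : (e + 1 : ℝ) ≤ ((q : ℝ) ^ e) ^ κ := by
    have h1 : (2 : ℝ) ≤ (q : ℝ) ^ κ := by
      have : (2 : ℝ) ^ (1 / κ) ≤ q := (Nat.le_ceil _).trans (by exact_mod_cast hq)
      calc (2 : ℝ) = ((2 : ℝ) ^ (1 / κ)) ^ κ := by
            rw [← Real.rpow_mul (by norm_num)]; simp [hκ.ne']
        _ ≤ (q : ℝ) ^ κ := by gcongr
    calc (e + 1 : ℝ) ≤ 2 ^ e := by exact_mod_cast Nat.lt_two_pow_self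
      _ ≤ ((q : ℝ) ^ κ) ^ e := by gcongr
      _ = ((q : ℝ) ^ e) ^ κ := by
        rw [← Real.rpow_natCast, ← Real.rpow_natCast, ← Real.rpow_mul (by positivity),
          ← Real.rpow_mul (by positivity), mul_comm]
  refine ⟨M ^ B, one_le_pow₀ hM1, fun n hn => ?_⟩
  have hn' : (n : ℝ) ^ κ = ∏ q ∈ n.primeFactors, ((q : ℝ) ^ n.factorization q) ^ κ := by
    rw [Real.finsetProd_rpow _ _ (fun _ _ => by positivity)]
    congr 1
    conv_lhs => rw [← Nat.prod_factorization_pow_eq_self hn]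
    rw [Finsupp.prod, Nat.support_factorization]
    push_cast
    rfl
  rw [Nat.card_divisors hn, hn']
  push_cast
  have hK : ∏ q ∈ n.primeFactors, (if q < B then M else 1) ≤ M ^ B := by
    rw [prod_ite, prod_const, prod_const_one, mul_one]
    refine pow_le_pow_right₀ hM1 ?_
    calc #{q ∈ n.primeFactors | q < B} ≤ #(range B) :=
          card_le_card fun q hq => by simp at hq ⊢; exact hq.2
      _ = B := card_range B
  calc ∏ q ∈ n.primeFactors, ((n.factorization q : ℝ) + 1)
      ≤ ∏ q ∈ n.primeFactors, ((if q < B then M else 1) *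
          ((q : ℝ) ^ n.factorization q) ^ κ) := by
        refine prod_le_prod (fun _ _ => by positivity) fun q hq => ?_
        have hq2 := (Nat.prime_of_mem_primeFactors hq).two_le
        split_ifs with h
        · exact small q _ hq2
        · rw [one_mul]; exact large q _ (not_lt.mp h) hq2
    _ ≤ _ := by
        rw [prod_mul_distrib]
        gcongr

/-- Shearer's inequality for a family of coordinate sets `{e | s e = i ∨ t e = i}` covering each
coordinate exactly twice. -/
theorem card_sq_le_prod_card_image {E ι α : Type*} [DecidableEq E] [Fintype E]
    [DecidableEq ι] [Fintype ι] [DecidableEq α] (z : α) (s t : E → ι) (hst : ∀ e, s e ≠ t e)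
    (F : Finset E) : ∀ H : Finset (E → α), (∀ h ∈ H, ∀ k ∈ H, ∀ e ∉ F, h e = k e) →
    #H ^ 2 ≤ ∏ i, #(H.image fun h e => if s e = i ∨ t e = i then h e else z) := by
  induction F using Finset.induction_on with
  | empty =>
    intro H hH
    rcases H.eq_empty_or_nonempty with rfl | hne
    · simp
    have h1 : #H ≤ 1 := card_le_one.mpr fun h hh k hk => funext fun e => hH h hh k hk e (by simp)
    calc #H ^ 2 ≤ 1 ^ 2 := by gcongr
      _ = 1 := by simp
      _ ≤ _ := Finset.one_le_prod' fun i _ => card_pos.mpr (hne.image _)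
  | insert e F he ih =>
    intro H hH
    set π : ι → (E → α) → (E → α) := fun i h e => if s e = i ∨ t e = i then h e else z with hπ
    set V : Finset α := H.image fun h => h e with hV
    set G : α → Finset (E → α) := fun v => {h ∈ H | h e = v} with hG
    have hGsub v : G v ⊆ H := filter_subset _ _
    have hcard : #H = ∑ v ∈ V, #(G v) :=
      card_eq_sum_card_fiberwise fun h hh => mem_image_of_mem _ hh
    have hGle v : #(G v) ^ 2 ≤ ∏ i, #((G v).image (π i)) := by
      refine ih (G v) fun h hh k hk e' he' => ?_
      simp only [hG, mem_filter] at hh hk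
      by_cases h' : e' = e
      · subst h'; rw [hh.2, hk.2]
      · exact hH h hh.1 k hk.1 e' (by simp [h', he'])
    have hsum (i : ι) (hi : s e = i ∨ t e = i) :
        ∑ v ∈ V, #((G v).image (π i)) ≤ #(H.image (π i)) := by
      rw [← card_biUnion]
      · refine card_le_card ?_
        intro x hx
        simp only [mem_biUnion] at hx
        obtain ⟨v, _, hx⟩ := hx
        exact image_subset_image (hGsub v) hx
      · intro v _ w _ hvw
        rw [Function.onFun, disjoint_left]
        intro x hx hy
        simp only [mem_image, hG, mem_filter] at hx hy
        obtain ⟨h, ⟨_, h1⟩, h2⟩ := hx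
        obtain ⟨k, ⟨_, k1⟩, k2⟩ := hy
        apply hvw
        rw [← h1, ← k1]
        have h3 := congrFun (h2.trans k2.symm) e
        simpa [hπ, hi] using h3
    set Q : ℕ := ∏ i ∈ (univ.erase (s e)).erase (t e), #(H.image (π i)) with hQ
    have hsplit (f : ι → ℕ) : ∏ i, f i =
        f (s e) * (f (t e) * ∏ i ∈ (univ.erase (s e)).erase (t e), f i) := by
      have h1 : t e ∈ univ.erase (s e) := mem_erase.mpr ⟨(hst e).symm, mem_univ _⟩
      rw [mul_prod_erase (univ.erase (s e)) f h1, mul_prod_erase univ f (mem_univ (s e))]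
    have hb v : #(G v) ^ 2 ≤ (Q * #((G v).image (π (s e)))) * #((G v).image (π (t e))) := by
      have h1 := hGle v
      rw [hsplit] at h1
      have h2 : ∏ i ∈ (univ.erase (s e)).erase (t e), #((G v).image (π i)) ≤ Q :=
        prod_le_prod' fun i _ => card_le_card (image_subset_image (hGsub v))
      calc _ ≤ _ := h1
        _ ≤ #((G v).image (π (s e))) * (#((G v).image (π (t e))) * Q) := by gcongr
        _ = _ := by ring
    have hfin : #H ^ 2 ≤ (Q * #(H.image (π (s e)))) * #(H.image (π (t e))) := by
      rw [hcard]
      refine (sum_sq_le_sum_mul_sum_of_sq_le_mul V (fun _ _ => Nat.zero_le _)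
        (fun _ _ => Nat.zero_le _) fun v _ => hb v).trans ?_
      rw [← mul_sum]
      exact Nat.mul_le_mul (Nat.mul_le_mul_left _ (hsum _ (Or.inl rfl))) (hsum _ (Or.inr rfl))
    change #H ^ 2 ≤ ∏ i, #(H.image (π i))
    rw [hsplit]
    refine hfin.trans_eq ?_
    ring

open Polynomial in
/-- The numerator of `∑ i, m i / (X + x i)`. -/
noncomputable def numer {ι : Type*} [Fintype ι] [DecidableEq ι] (m : ι → ℤ) (x : ι → ℕ) : ℤ[X] :=
  ∑ i, C (m i) * ∏ j ∈ univ.erase i, (X + C (x j : ℤ))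

open Polynomial in
/-- `P(N X)` has coefficients bounded by `B N ^ w`. -/
def WeightLE (N B w : ℕ) (P : ℤ[X]) : Prop :=
  ∀ k, |P.coeff k| * (N : ℤ) ^ k ≤ B * (N : ℤ) ^ w

namespace WeightLE

open Polynomial

variable {N B B' w : ℕ} {P Q : ℤ[X]}

lemma add (hP : WeightLE N B w P) (hQ : WeightLE N B' w Q) : WeightLE N (B + B') w (P + Q) := by
  intro k
  rw [coeff_add]
  have h1 := hP k
  have h2 := hQ k
  have h3 : |P.coeff k + Q.coeff k| * (N : ℤ) ^ k ≤
      (|P.coeff k| + |Q.coeff k|) * (N : ℤ) ^ k := by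
    gcongr; exact abs_add_le _ _
  push_cast
  linarith

lemma mono (hP : WeightLE N B w P) (h : B ≤ B') : WeightLE N B' w P := by
  intro k
  exact (hP k).trans (by gcongr)

lemma sum {α : Type*} (s : Finset α) (F : α → ℤ[X]) (b : α → ℕ)
    (h : ∀ i ∈ s, WeightLE N (b i) w (F i)) : WeightLE N (∑ i ∈ s, b i) w (∑ i ∈ s, F i) := by
  classical
  induction s using Finset.induction_on with
  | empty => intro k; simp
  | insert a s ha ih =>
    rw [sum_insert ha, sum_insert ha]
    exact (h a (by simp)).add (ih fun i hi => h i (by simp [hi]))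

lemma C_mul (m : ℤ) (hP : WeightLE N B w P) : WeightLE N (m.natAbs * B) w (C m * P) := by
  intro k
  rw [coeff_C_mul, abs_mul]
  push_cast
  rw [mul_assoc, mul_assoc]
  exact mul_le_mul_of_nonneg_left (hP k) (by positivity)

lemma X_mul (hP : WeightLE N B w P) : WeightLE N B (w + 1) (X * P) := by
  intro k
  cases k with
  | zero => simp; positivity
  | succ k =>
    rw [coeff_X_mul, pow_succ, pow_succ, ← mul_assoc, ← mul_assoc]
    exact mul_le_mul_of_nonneg_right (hP k) (by positivity)

lemma X_add_C_mul {y : ℕ} (hy : y ≤ N) (hP : WeightLE N B w P) :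
    WeightLE N (2 * B) (w + 1) ((X + C (y : ℤ)) * P) := by
  rw [add_mul, two_mul]
  refine hP.X_mul.add ?_
  intro k
  rw [coeff_C_mul, abs_mul, Nat.abs_cast, pow_succ]
  calc (y : ℤ) * |P.coeff k| * N ^ k = y * (|P.coeff k| * N ^ k) := by ring
    _ ≤ N * (B * N ^ w) :=
      mul_le_mul (by exact_mod_cast hy) (hP k) (by positivity) (by positivity)
    _ = _ := by ring

lemma prod {α : Type*} (s : Finset α) (x : α → ℕ) (hx : ∀ i ∈ s, x i ≤ N) :
    WeightLE N (2 ^ #s) #s (∏ i ∈ s, (X + C (x i : ℤ))) := by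
  classical
  induction s using Finset.induction_on with
  | empty =>
    intro k
    simp only [prod_empty, coeff_one, card_empty]
    split_ifs with h
    · subst h; simp
    · simp
  | insert a s ha ih =>
    rw [prod_insert ha, card_insert_of_notMem ha, pow_succ']
    exact (ih fun i hi => hx i (by simp [hi])).X_add_C_mul (hx a (by simp))

end WeightLE

section numer

open Polynomial

lemma natDegree_prod_X_add_C {α : Type*} (x : α → ℕ) (s : Finset α) :
    (∏ j ∈ s, (X + C (x j : ℤ))).natDegree = #s := by
  rw [natDegree_prod_of_monic _ _ fun i _ => monic_X_add_C _]
  simp only [natDegree_X_add_C, sum_const, smul_eq_mul, mul_one]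

variable {ι : Type*} [Fintype ι] [DecidableEq ι] (m : ι → ℤ) (x : ι → ℕ)

lemma weightLE_numer {N b : ℕ} (hm : ∀ i, (m i).natAbs ≤ b) (hx : ∀ i, x i ≤ N) :
    WeightLE N (Fintype.card ι * (b * 2 ^ (Fintype.card ι - 1))) (Fintype.card ι - 1)
      (numer m x) := by
  have := WeightLE.sum (N := N) (w := Fintype.card ι - 1) univ
    (fun i => C (m i) * ∏ j ∈ univ.erase i, (X + C (x j : ℤ)))
    (fun _ => b * 2 ^ (Fintype.card ι - 1)) (fun i _ => by
      have h1 := WeightLE.prod (N := N) (univ.erase i) x (fun j _ => hx j)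
      rw [card_erase_of_mem (mem_univ i), card_univ] at h1
      exact (h1.C_mul (m i)).mono (by gcongr; exact hm i))
  simpa [numer] using this

lemma natDegree_numer_lt (hm : ∑ i, m i = 0) (hι : 2 ≤ Fintype.card ι) :
    (numer m x).natDegree + 2 ≤ Fintype.card ι := by
  have h1 : (numer m x).natDegree ≤ Fintype.card ι - 2 := by
    rw [natDegree_le_iff_coeff_eq_zero]
    intro k hk
    rw [numer, finsetSum_coeff]
    have hdeg (i : ι) : (∏ j ∈ univ.erase i, (X + C (x j : ℤ))).natDegree
        = Fintype.card ι - 1 := by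
      rw [natDegree_prod_X_add_C, card_erase_of_mem (mem_univ i), card_univ]
    have hmon (i : ι) : (∏ j ∈ univ.erase i, (X + C (x j : ℤ))).Monic :=
      monic_prod_of_monic _ _ fun i _ => monic_X_add_C _
    rcases eq_or_ne k (Fintype.card ι - 1) with rfl | hk'
    · rw [← hm]
      refine sum_congr rfl fun i _ => ?_
      have := (hmon i).coeff_natDegree
      rw [hdeg] at this
      rw [coeff_C_mul, this, mul_one]
    · refine sum_eq_zero fun i _ => ?_
      rw [coeff_C_mul, coeff_eq_zero_of_natDegree_lt, mul_zero]
      rw [hdeg]; omega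
  omega

lemma eval_numer_neg (i : ι) :
    (numer m x).eval (-(x i : ℤ)) = m i * ∏ j ∈ univ.erase i, ((x j : ℤ) - x i) := by
  rw [numer, eval_finsetSum, sum_eq_single i]
  · simp [eval_prod, neg_add_eq_sub]
  · intro k _ hk
    rw [eval_mul, eval_prod, prod_eq_zero (i := i) (by simp [hk.symm]) (by simp), mul_zero]
  · simp

lemma eval_numer_neg_ne_zero (hm : ∀ i, m i ≠ 0) (hx : Function.Injective x) (i : ι) :
    (numer m x).eval (-(x i : ℤ)) ≠ 0 := by
  rw [eval_numer_neg]
  refine mul_ne_zero (hm i) (prod_ne_zero_iff.mpr fun j hj => ?_)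
  rw [sub_ne_zero]
  intro h
  exact (mem_erase.mp hj).1 (hx (by exact_mod_cast h))

lemma natAbs_eval_numer_neg_le {N b : ℕ} (hm : ∀ i, (m i).natAbs ≤ b) (hx : ∀ i, x i ≤ N) (i : ι) :
    ((numer m x).eval (-(x i : ℤ))).natAbs ≤ b * N ^ (Fintype.card ι - 1) := by
  rw [eval_numer_neg, Int.natAbs_mul, ← Int.natAbsHom_apply (∏ _ ∈ _, _), map_prod]
  refine Nat.mul_le_mul (hm i) ?_
  rw [← card_univ, ← card_erase_of_mem (mem_univ i)]
  refine prod_le_pow_card _ _ _ fun j _ => ?_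
  change ((x j : ℤ) - x i).natAbs ≤ N
  have := hx i; have := hx j
  omega

lemma map_eval_numer {K : Type*} [Field K] (a : K) (ha : ∀ i, a + x i ≠ 0) :
    ((numer m x).map (Int.castRingHom K)).eval a =
      (∏ i, (a + x i)) * ∑ i, (m i : K) * (a + x i)⁻¹ := by
  rw [numer, Polynomial.map_sum, eval_finsetSum, mul_sum]
  refine sum_congr rfl fun i _ => ?_
  rw [← mul_prod_erase univ _ (mem_univ i)]
  simp [Polynomial.map_prod, eval_prod, Polynomial.map_mul]
  field_simp [ha i]

end numer

lemma dvd_mul_prod_gcd {α : Type*} (a : ℕ) (z : α → ℕ) (s : Finset α) :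
    ∀ c : ℕ, a ∣ c * ∏ j ∈ s, z j → a ∣ c * ∏ j ∈ s, a.gcd (z j) := by
  classical
  induction s using Finset.induction_on with
  | empty => intro c h; simpa using h
  | insert b s hb ih =>
    intro c h
    rw [prod_insert hb, ← mul_assoc]
    apply ih
    rw [prod_insert hb] at h
    have h2 : a ∣ Nat.gcd ((c * ∏ j ∈ s, z j) * a) ((c * ∏ j ∈ s, z j) * z b) :=
      Nat.dvd_gcd (dvd_mul_left _ _) (by convert h using 1; ring)
    rw [Nat.gcd_mul_left] at h2
    convert h2 using 1
    ring

open Polynomial in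
lemma card_filter_natAbs_eval_eq_le (g : ℤ[X]) (hg : 1 ≤ g.natDegree) (s : Finset ℕ) (d : ℕ) :
    #(s.filter fun v : ℕ => (g.eval (-(v : ℤ))).natAbs = d) ≤ 2 * g.natDegree := by
  have key (c : ℤ) : #(s.filter fun v : ℕ => g.eval (-(v : ℤ)) = c) ≤ g.natDegree := by
    have h0 : g - C c ≠ 0 := by
      intro h
      rw [sub_eq_zero] at h
      rw [h, natDegree_C] at hg
      omega
    calc #(s.filter fun v : ℕ => g.eval (-(v : ℤ)) = c) ≤ #(g - C c).roots.toFinset := by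
          refine card_le_card_of_injOn (fun v : ℕ => -(v : ℤ)) ?_ ?_
          · intro v hv
            have hv' := (mem_filter.mp hv).2
            rw [mem_coe, Multiset.mem_toFinset, mem_roots h0, IsRoot, eval_sub, eval_C,
              hv', sub_self]
          · intro v _ w _ h
            simpa using h
      _ ≤ Multiset.card (g - C c).roots := Multiset.toFinset_card_le _
      _ ≤ (g - C c).natDegree := card_roots' _
      _ = g.natDegree := natDegree_sub_C
  calc #(s.filter fun v : ℕ => (g.eval (-(v : ℤ))).natAbs = d)
      ≤ #((s.filter fun v : ℕ => g.eval (-(v : ℤ)) = d) ∪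
          (s.filter fun v : ℕ => g.eval (-(v : ℤ)) = -d)) := by
        refine card_le_card fun v hv => ?_
        simp only [mem_filter, mem_union] at hv ⊢
        rcases Int.natAbs_eq_iff.mp hv.2 with h | h
        · exact Or.inl ⟨hv.1, h⟩
        · exact Or.inr ⟨hv.1, h⟩
    _ ≤ _ := card_union_le _ _
    _ ≤ g.natDegree + g.natDegree := add_le_add (key _) (key _)
    _ = _ := by ring

open Polynomial in
/-- If a nonconstant `g` divides all the numerators, then there are `≪ N ^ (r / 2 + o(1))`
of them. -/
theorem card_sq_le_of_forall_dvd_numer {ι : Type*} [Fintype ι] [DecidableEq ι] {m : ι → ℤ}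
    {N b D : ℕ} (hm : ∀ i, (m i).natAbs ≤ b) (hm0 : ∀ i, m i ≠ 0)
    (hD : ∀ n : ℕ, n ≠ 0 → n ≤ b * N ^ (Fintype.card ι - 1) → #n.divisors ≤ D)
    (g : ℤ[X]) (hg : 1 ≤ g.natDegree) (S : Finset (ι → ℕ))
    (hS : ∀ x ∈ S, (∀ i, x i ∈ Icc 1 N) ∧ Function.Injective x ∧ g ∣ numer m x) :
    #S ^ 2 ≤ N ^ Fintype.card ι *
      (D ^ (Fintype.card ι * Fintype.card {e : ι × ι // e.1 ≠ e.2}) *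
        (2 * g.natDegree * D) ^ (2 * Fintype.card ι)) := by
  set r := Fintype.card ι with hr
  set E := {e : ι × ι // e.1 ≠ e.2} with hE
  set y : ℕ → ℤ := fun v => g.eval (-(v : ℤ)) with hy
  have hdvd : ∀ x ∈ S, ∀ i, y (x i) ∣ m i * ∏ j ∈ univ.erase i, ((x j : ℤ) - x i) := by
    intro x hx i
    rw [← eval_numer_neg]
    exact Polynomial.eval_dvd (hS x hx).2.2
  have hyne : ∀ x ∈ S, ∀ i, y (x i) ≠ 0 ∧ (y (x i)).natAbs ≤ b * N ^ (r - 1) := by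
    intro x hx i
    have h1 := eval_numer_neg_ne_zero m x hm0 (hS x hx).2.1 i
    have h2 : y (x i) ∣ (numer m x).eval (-(x i : ℤ)) := Polynomial.eval_dvd (hS x hx).2.2
    refine ⟨ne_zero_of_dvd_ne_zero h1 h2, ?_⟩
    refine (Nat.le_of_dvd (Int.natAbs_pos.mpr h1) (Int.natAbs_dvd_natAbs.mpr h2)).trans ?_
    exact natAbs_eval_numer_neg_le m x hm (fun j => (mem_Icc.mp ((hS x hx).1 j)).2) i
  set h : (ι → ℕ) → E → ℕ := fun x e => Int.gcd (y (x e.1.1)) ((x e.1.2 : ℤ) - x e.1.1) with hh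
  have hsymm (x : ι → ℕ) (e : E) : (h x e : ℤ) ∣ y (x e.1.1) ∧ (h x e : ℤ) ∣ y (x e.1.2) := by
    have h1 : (h x e : ℤ) ∣ y (x e.1.1) := Int.gcd_dvd_left _ _
    have h2 : (h x e : ℤ) ∣ (x e.1.2 : ℤ) - x e.1.1 := Int.gcd_dvd_right _ _
    have h3 : (-(x e.1.1 : ℤ)) - (-(x e.1.2 : ℤ)) ∣ y (x e.1.1) - y (x e.1.2) :=
      sub_dvd_eval_sub _ _ _
    refine ⟨h1, ?_⟩
    have h4 := h2.trans (by convert h3 using 1; ring : _ ∣ y (x e.1.1) - y (x e.1.2))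
    exact (dvd_iff_dvd_of_dvd_sub h4).mp h1
  have hrow : ∀ i, #((S.image h).image
      fun k e => if e.1.1 = i ∨ e.1.2 = i then k e else 1) ≤ N * D ^ Fintype.card E := by
    intro i
    set V := {v ∈ Icc 1 N | y v ≠ 0 ∧ (y v).natAbs ≤ b * N ^ (r - 1)} with hV
    calc _ ≤ #(V.biUnion fun v => Fintype.piFinset fun _ : E => (y v).natAbs.divisors) := by
          refine card_le_card fun k hk => ?_
          simp only [mem_image, exists_exists_and_eq_and] at hk
          obtain ⟨x, hx, rfl⟩ := hk
          rw [mem_biUnion]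
          refine ⟨x i, mem_filter.mpr ⟨(hS x hx).1 i, hyne x hx i⟩, ?_⟩
          rw [Fintype.mem_piFinset]
          intro e
          rw [Nat.mem_divisors]
          refine ⟨?_, Int.natAbs_ne_zero.mpr (hyne x hx i).1⟩
          split_ifs with hei
          · rw [← Int.natCast_dvd]
            rcases hei with rfl | rfl
            exacts [(hsymm x e).1, (hsymm x e).2]
          · exact one_dvd _
      _ ≤ ∑ v ∈ V, #(Fintype.piFinset fun _ : E => (y v).natAbs.divisors) := card_biUnion_le
      _ ≤ ∑ v ∈ V, D ^ Fintype.card E := by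
          refine sum_le_sum fun v hv => ?_
          rw [Fintype.card_piFinset, prod_const, card_univ]
          have := (mem_filter.mp hv).2
          gcongr
          exact hD _ (Int.natAbs_ne_zero.mpr this.1) this.2
      _ ≤ N * D ^ Fintype.card E := by
          rw [sum_const, smul_eq_mul]
          gcongr
          exact (card_filter_le _ _).trans (by simp)
  have hH : #(S.image h) ^ 2 ≤ N ^ r * D ^ (r * Fintype.card E) := by
    have h1 := card_sq_le_prod_card_image (E := E) (α := ℕ) 1 (fun e => e.1.1) (fun e => e.1.2)
      (fun e => e.2) univ (S.image h) (fun _ _ _ _ e he => absurd (mem_univ e) he)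
    refine h1.trans ?_
    calc _ ≤ ∏ _i : ι, N * D ^ Fintype.card E := prod_le_prod' fun i _ => hrow i
      _ = _ := by rw [prod_const, card_univ, mul_pow, ← pow_mul, mul_comm r]
  have hfib : #S ≤ (2 * g.natDegree * D) ^ r * #(S.image h) := by
    refine card_le_mul_card_image S _ fun k hk => ?_
    set w : ι → ℕ := fun i => (m i).natAbs *
      ∏ j ∈ univ.erase i, (if hij : i ≠ j then k ⟨(i, j), hij⟩ else 1) with hw
    have hwx : ∀ x ∈ S, h x = k → ∀ i, w i ≠ 0 ∧ w i ≤ b * N ^ (r - 1) ∧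
        (y (x i)).natAbs ∣ w i := by
      intro x hx hxk i
      subst hxk
      have hwi : w i = (m i).natAbs *
          ∏ j ∈ univ.erase i, (y (x i)).natAbs.gcd ((x j : ℤ) - x i).natAbs := by
        simp only [hw]
        congr 1
        refine prod_congr rfl fun j hj => ?_
        rw [dif_pos (mem_erase.mp hj).1.symm]
        rfl
      rw [hwi]
      have hz : ∀ j ∈ univ.erase i, ((x j : ℤ) - x i).natAbs ≠ 0 := by
        intro j hj
        rw [Int.natAbs_ne_zero, sub_ne_zero]
        intro h
        exact (mem_erase.mp hj).1 ((hS x hx).2.1 (by exact_mod_cast h))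
      refine ⟨?_, ?_, ?_⟩
      · refine mul_ne_zero (Int.natAbs_ne_zero.mpr (hm0 i)) (prod_ne_zero_iff.mpr fun j hj => ?_)
        exact (Nat.gcd_pos_of_pos_right _ (Nat.pos_of_ne_zero (hz j hj))).ne'
      · refine Nat.mul_le_mul (hm i) ?_
        rw [hr, ← card_univ, ← card_erase_of_mem (mem_univ i)]
        refine prod_le_pow_card _ _ _ fun j hj => ?_
        refine (Nat.gcd_le_right _ (Nat.pos_of_ne_zero (hz j hj))).trans ?_
        have h1 := mem_Icc.mp ((hS x hx).1 i)
        have h2 := mem_Icc.mp ((hS x hx).1 j)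
        omega
      · apply dvd_mul_prod_gcd
        have h1 := Int.natAbs_dvd_natAbs.mpr (hdvd x hx i)
        rwa [Int.natAbs_mul, ← Int.natAbsHom_apply (∏ _ ∈ _, _), map_prod] at h1
    rcases (S.filter fun x => h x = k).eq_empty_or_nonempty with he | ⟨x0, hx0⟩
    · simp [he]
    have hw0 := hwx x0 (mem_filter.mp hx0).1 (mem_filter.mp hx0).2
    calc #{x ∈ S | h x = k} ≤ #(Fintype.piFinset fun i =>
          (w i).divisors.biUnion fun d => {v ∈ Icc 1 N | (y v).natAbs = d}) := by
          refine card_le_card fun x hx => ?_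
          obtain ⟨hx, hxk⟩ := mem_filter.mp hx
          rw [Fintype.mem_piFinset]
          intro i
          obtain ⟨h1, h2, h3⟩ := hwx x hx hxk i
          rw [mem_biUnion]
          exact ⟨_, Nat.mem_divisors.mpr ⟨h3, h1⟩, mem_filter.mpr ⟨(hS x hx).1 i, rfl⟩⟩
      _ = ∏ i, #((w i).divisors.biUnion fun d => {v ∈ Icc 1 N | (y v).natAbs = d}) :=
          Fintype.card_piFinset _
      _ ≤ ∏ _i : ι, (2 * g.natDegree * D) := by
          refine prod_le_prod' fun i _ => ?_
          calc _ ≤ ∑ d ∈ (w i).divisors, #{v ∈ Icc 1 N | (y v).natAbs = d} := card_biUnion_le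
            _ ≤ ∑ d ∈ (w i).divisors, 2 * g.natDegree :=
                sum_le_sum fun d _ => card_filter_natAbs_eval_eq_le g hg _ d
            _ = #(w i).divisors * (2 * g.natDegree) := by rw [sum_const, smul_eq_mul]
            _ ≤ D * (2 * g.natDegree) := by
                gcongr
                exact hD _ (hw0 i).1 (hw0 i).2.1
            _ = _ := by ring
      _ = _ := by rw [prod_const, card_univ]
  calc #S ^ 2 ≤ ((2 * g.natDegree * D) ^ r * #(S.image h)) ^ 2 := by gcongr
    _ = #(S.image h) ^ 2 * (2 * g.natDegree * D) ^ (2 * r) := by ring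
    _ ≤ (N ^ r * D ^ (r * Fintype.card E)) * (2 * g.natDegree * D) ^ (2 * r) := by gcongr
    _ = _ := by ring

open Polynomial in
/-- The coefficient matrix of `F 0, …, F (k - 1)`, all of degree less than `k`. -/
noncomputable def coeffMatrix {k : ℕ} (F : Fin k → ℤ[X]) : Matrix (Fin k) (Fin k) ℤ :=
  Matrix.of fun i j => (F i).coeff j

open Polynomial in
lemma abs_det_coeffMatrix_le {k N B : ℕ} (F : Fin k → ℤ[X]) (w : Fin k → ℕ)
    (hF : ∀ i, WeightLE N B (w i) (F i)) :
    |(coeffMatrix F).det| * (N : ℤ) ^ (∑ i : Fin k, (i : ℕ)) ≤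
      k.factorial * (B : ℤ) ^ k * (N : ℤ) ^ (∑ i, w i) := by
  rw [Matrix.det_apply]
  calc |∑ σ : Equiv.Perm (Fin k), Equiv.Perm.sign σ • ∏ i, coeffMatrix F (σ i) i| *
        (N : ℤ) ^ (∑ i : Fin k, (i : ℕ))
      ≤ (∑ σ : Equiv.Perm (Fin k), |Equiv.Perm.sign σ • ∏ i, coeffMatrix F (σ i) i|) *
        (N : ℤ) ^ (∑ i : Fin k, (i : ℕ)) := by
        gcongr
        exact abs_sum_le_sum_abs _ _
    _ ≤ (∑ _σ : Equiv.Perm (Fin k), (B : ℤ) ^ k * (N : ℤ) ^ (∑ i, w i)) := by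
        rw [sum_mul]
        refine sum_le_sum fun σ _ => ?_
        have h1 : |Equiv.Perm.sign σ • ∏ i, coeffMatrix F (σ i) i| =
            ∏ i, |coeffMatrix F (σ i) i| := by
          rw [← abs_prod]
          rcases Int.units_eq_one_or (Equiv.Perm.sign σ) with h | h <;> simp [h]
        rw [h1, ← prod_pow_eq_pow_sum, ← prod_mul_distrib]
        calc ∏ i, (|coeffMatrix F (σ i) i| * (N : ℤ) ^ (i : ℕ))
            ≤ ∏ i, ((B : ℤ) * (N : ℤ) ^ (w (σ i))) :=
              prod_le_prod (fun _ _ => by positivity) fun i _ => hF (σ i) i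
          _ = _ := by
              rw [prod_mul_distrib, prod_const, card_univ, Fintype.card_fin,
                prod_pow_eq_pow_sum, Equiv.sum_comp σ w]
    _ = _ := by
        rw [sum_const, card_univ, Fintype.card_perm, Fintype.card_fin, nsmul_eq_mul]
        ring

open Polynomial in
lemma dvd_det_coeffMatrix {p : ℕ} [Fact p.Prime] {k : ℕ} (hk : 0 < k) (F : Fin k → ℤ[X])
    (hdeg : ∀ i, (F i).natDegree < k) (a : ZMod p)
    (ha : ∀ i, ((F i).map (Int.castRingHom (ZMod p))).eval a = 0) :
    (p : ℤ) ∣ (coeffMatrix F).det := by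
  rw [← ZMod.intCast_zmod_eq_zero_iff_dvd]
  have : (Int.castRingHom (ZMod p)) (coeffMatrix F).det = 0 := by
    rw [RingHom.map_det, ← Matrix.exists_mulVec_eq_zero_iff]
    refine ⟨fun j => a ^ (j : ℕ), fun h => ?_, ?_⟩
    · have := congrFun h ⟨0, hk⟩
      simp at this
    · ext i
      have h1 := ha i
      rw [eval_eq_sum_range' (n := k) (by exact (natDegree_map_le).trans_lt (hdeg i))] at h1
      rw [Finset.sum_range] at h1
      simpa [Matrix.mulVec, dotProduct, coeffMatrix] using h1
  simpa using this

open Polynomial in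
/-- Small integer polynomials with a common root modulo `p` are linearly dependent. -/
theorem exists_relation_of_eval_eq_zero {p : ℕ} [Fact p.Prime] {k N B : ℕ} (hk : 0 < k)
    (hN : 0 < N) (F : Fin k → ℤ[X]) (w : Fin k → ℕ) (hdeg : ∀ i, (F i).natDegree < k)
    (hF : ∀ i, WeightLE N B (w i) (F i)) (a : ZMod p)
    (ha : ∀ i, ((F i).map (Int.castRingHom (ZMod p))).eval a = 0)
    (hp : k.factorial * B ^ k * N ^ (∑ i, w i) < p * N ^ (∑ i : Fin k, (i : ℕ))) :
    ∃ t : Fin k → ℤ, t ≠ 0 ∧ ∑ i, C (t i) * F i = 0 := by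
  have hdet : (coeffMatrix F).det = 0 := by
    refine Int.eq_zero_of_abs_lt_dvd (dvd_det_coeffMatrix hk F hdeg a ha) ?_
    have h1 := abs_det_coeffMatrix_le F w hF
    have h2 : (k.factorial * (B : ℤ) ^ k * (N : ℤ) ^ (∑ i, w i)) <
      p * (N : ℤ) ^ (∑ i : Fin k, (i : ℕ)) := by exact_mod_cast hp
    exact lt_of_mul_lt_mul_right (h1.trans_lt h2) (by positivity)
  obtain ⟨t, ht, h⟩ := Matrix.exists_vecMul_eq_zero_iff.mpr hdet
  refine ⟨t, ht, ?_⟩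
  ext j
  rw [finsetSum_coeff, coeff_zero]
  by_cases hj : j < k
  · have := congrFun h ⟨j, hj⟩
    simpa [Matrix.vecMul, dotProduct, coeffMatrix] using this
  · refine sum_eq_zero fun i _ => ?_
    rw [coeff_C_mul, coeff_eq_zero_of_natDegree_lt ((hdeg i).trans_le (not_lt.mp hj)), mul_zero]

open Polynomial in
lemma exists_dvd_of_aeval_eq_zero (ζ : ℂ) (P₀ : ℤ[X]) (h0 : P₀ ≠ 0) (hζ : aeval ζ P₀ = 0) :
    ∃ g : ℤ[X], 1 ≤ g.natDegree ∧ ∀ P : ℤ[X], aeval ζ P = 0 → g ∣ P := by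
  have hmap (P : ℤ[X]) : aeval ζ (P.map (Int.castRingHom ℚ)) = aeval ζ P := by
    rw [show Int.castRingHom ℚ = algebraMap ℤ ℚ from rfl, aeval_map_algebraMap]
  have halg : IsAlgebraic ℚ ζ :=
    ⟨P₀.map (Int.castRingHom ℚ), (Polynomial.map_ne_zero_iff (RingHom.injective_int _)).mpr h0,
      by rw [hmap, hζ]⟩
  have hint : IsIntegral ℚ ζ := halg.isIntegral
  set f := minpoly ℚ ζ with hf
  obtain ⟨b, hb, hb'⟩ := IsLocalization.integerNormalization_spec (nonZeroDivisors ℤ) f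
  set q := IsLocalization.integerNormalization (nonZeroDivisors ℤ) f with hq
  have hb0 : b ≠ 0 := nonZeroDivisors.ne_zero hb
  have hq0 : q ≠ 0 := by
    rw [hq, Ne, IsFractionRing.integerNormalization_eq_zero_iff]
    exact minpoly.ne_zero hint
  have hqf : q.map (Int.castRingHom ℚ) = C (b : ℚ) * f := by
    have : q.map (Int.castRingHom ℚ) = b • f := hb'
    rw [this, zsmul_eq_mul]
    simp
  have hcont : q.map (Int.castRingHom ℚ) =
      C (q.content : ℚ) * q.primPart.map (Int.castRingHom ℚ) := by
    conv_lhs => rw [q.eq_C_content_mul_primPart]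
    simp
  have hc0 : (q.content : ℚ) ≠ 0 := by
    exact_mod_cast content_eq_zero_iff.not.mpr hq0
  have hgf : q.primPart.map (Int.castRingHom ℚ) = C ((q.content : ℚ)⁻¹ * b) * f := by
    rw [C_mul, mul_assoc, ← hqf, hcont, ← mul_assoc, ← C_mul, inv_mul_cancel₀ hc0, C_1, one_mul]
  have hu : ((q.content : ℚ)⁻¹ * b) ≠ 0 := mul_ne_zero (inv_ne_zero hc0) (by exact_mod_cast hb0)
  refine ⟨q.primPart, ?_, fun P hP => ?_⟩
  · rw [← natDegree_map_eq_of_injective (RingHom.injective_int (Int.castRingHom ℚ)), hgf,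
      natDegree_C_mul hu]
    exact minpoly.natDegree_pos hint
  · rw [IsPrimitive.Int.dvd_iff_map_cast_dvd_map_cast _ _ q.isPrimitive_primPart, hgf]
    rw [IsUnit.mul_left_dvd (isUnit_C.mpr hu.isUnit)]
    exact minpoly.dvd ℚ ζ (by rw [hmap, hP])

open Polynomial in
/-- The shifts of `g` and `f` whose coefficients are the columns of the Sylvester matrix. -/
noncomputable def sylvesterRows (f g : ℤ[X]) (d : ℕ) (j : Fin (d + d)) : ℤ[X] :=
  j.addCases (fun i => X ^ (i : ℕ) * g) (fun i => X ^ (i : ℕ) * f)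

open Polynomial in
lemma WeightLE.X_pow_mul {N B w : ℕ} {P : ℤ[X]} (hP : WeightLE N B w P) (i : ℕ) :
    WeightLE N B (w + i) (X ^ i * P) := by
  induction i with
  | zero => simpa using hP
  | succ i ih => rw [pow_succ', mul_assoc, ← add_assoc]; exact ih.X_mul

open Polynomial in
lemma coeffMatrix_sylvesterRows (f g : ℤ[X]) (d : ℕ) (hf : f.natDegree ≤ d)
    (hg : g.natDegree ≤ d) : coeffMatrix (sylvesterRows f g d) = (sylvester f g d d).transpose := by
  have key (h : ℤ[X]) (hh : h.natDegree ≤ d) (i j : ℕ) : (X ^ j * h).coeff i =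
      if i ∈ Set.Icc j (j + d) then h.coeff (i - j) else 0 := by
    rw [coeff_X_pow_mul']
    simp only [Set.mem_Icc]
    by_cases h1 : j ≤ i
    · by_cases h2 : i ≤ j + d
      · simp [h1, h2]
      · rw [if_pos h1, if_neg (by tauto), coeff_eq_zero_of_natDegree_lt (by omega)]
    · simp [h1]
  ext j i
  rw [Matrix.transpose_apply]
  simp only [coeffMatrix, sylvesterRows, sylvester, Matrix.of_apply]
  induction j using Fin.addCases with
  | left j => simp only [Fin.addCases_left]; exact key g hg i j
  | right j => simp only [Fin.addCases_right]; exact key f hf i j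

open Polynomial in
lemma det_coeffMatrix_sylvesterRows (f g : ℤ[X]) (d : ℕ) (hf : f.natDegree ≤ d)
    (hg : g.natDegree ≤ d) : (coeffMatrix (sylvesterRows f g d)).det = resultant f g d d := by
  rw [coeffMatrix_sylvesterRows f g d hf hg, Matrix.det_transpose, resultant]

open Polynomial in
lemma abs_resultant_le {N B w d : ℕ} (f g : ℤ[X]) (hf : f.natDegree ≤ d) (hg : g.natDegree ≤ d)
    (hfw : WeightLE N B w f) (hgw : WeightLE N B w g) :
    |resultant f g d d| * (N : ℤ) ^ (∑ i ∈ range (2 * d), i) ≤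
      (2 * d).factorial * (B : ℤ) ^ (2 * d) * (N : ℤ) ^ (2 * ∑ i ∈ range d, (w + i)) := by
  rw [← det_coeffMatrix_sylvesterRows f g d hf hg]
  set v : Fin (d + d) → ℕ := fun j => j.addCases (fun i => w + i) (fun i => w + i) with hv
  have h1 := abs_det_coeffMatrix_le (N := N) (B := B) (sylvesterRows f g d) v (fun j => by
      induction j using Fin.addCases with
      | left j => simp only [sylvesterRows, hv, Fin.addCases_left]; exact hgw.X_pow_mul j
      | right j => simp only [sylvesterRows, hv, Fin.addCases_right]; exact hfw.X_pow_mul j)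
  have h2 : ∑ j, v j = 2 * ∑ i ∈ range d, (w + i) := by
    rw [Fin.sum_univ_add, Finset.sum_range, two_mul]
    simp only [hv, Fin.addCases_left, Fin.addCases_right]
  rw [h2, ← Finset.sum_range (fun i => i)] at h1
  rwa [two_mul d]

open Polynomial in
lemma dvd_resultant {p : ℕ} [Fact p.Prime] {d : ℕ} (hd : 0 < d) (f g : ℤ[X])
    (hf : f.natDegree ≤ d) (hg : g.natDegree ≤ d) (a : ZMod p)
    (hfa : (f.map (Int.castRingHom (ZMod p))).eval a = 0)
    (hga : (g.map (Int.castRingHom (ZMod p))).eval a = 0) :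
    (p : ℤ) ∣ resultant f g d d := by
  rw [← det_coeffMatrix_sylvesterRows f g d hf hg]
  have hdeg (h : ℤ[X]) (hh : h.natDegree ≤ d) (j : Fin d) :
      (X ^ (j : ℕ) * h).natDegree < d + d := by
    refine natDegree_mul_le.trans_lt ?_
    rw [natDegree_X_pow]
    omega
  refine dvd_det_coeffMatrix (by omega) _ (fun j => ?_) a fun j => ?_
  · induction j using Fin.addCases with
    | left j => simp only [sylvesterRows, Fin.addCases_left]; exact hdeg g hg j
    | right j => simp only [sylvesterRows, Fin.addCases_right]; exact hdeg f hf j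
  · induction j using Fin.addCases with
    | left j => simp only [sylvesterRows, Fin.addCases_left]; simp [hga]
    | right j => simp only [sylvesterRows, Fin.addCases_right]; simp [hfa]

open Polynomial in
lemma resultant_ne_zero_of_isCoprime {d : ℕ} (f g : ℤ[X]) (hf : f.natDegree = d)
    (hf0 : f ≠ 0) (hg : g.natDegree ≤ d)
    (h : IsCoprime (f.map (Int.castRingHom ℚ)) (g.map (Int.castRingHom ℚ))) :
    resultant f g d d ≠ 0 := by
  have hi : Function.Injective (Int.castRingHom ℚ) := RingHom.injective_int _
  have h1 := resultant_ne_zero _ _ h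
  rw [natDegree_map_eq_of_injective hi, natDegree_map_eq_of_injective hi] at h1
  obtain ⟨k, hk⟩ := Nat.exists_eq_add_of_le hg
  have h2 := resultant_add_right_deg (f.map (Int.castRingHom ℚ)) (g.map (Int.castRingHom ℚ))
    d g.natDegree k (natDegree_map_le)
  rw [← hk, resultant_map_map] at h2
  intro h0
  rw [h0, map_zero] at h2
  rw [hf] at h1
  have h3 : (f.map (Int.castRingHom ℚ)).coeff d ≠ 0 := by
    rw [coeff_map, ← hf]
    simpa using hf0
  exact mul_ne_zero (pow_ne_zero k h3) h1 h2.symm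

open Polynomial in
/-- Two small integer polynomials with a common root modulo a large prime are not coprime. -/
lemma not_isCoprime_of_eval_eq_zero {p : ℕ} [Fact p.Prime] {N B w d : ℕ} (hN : 0 < N) (hd : 0 < d)
    (f g : ℤ[X]) (hf : f.natDegree = d) (hg : g.natDegree ≤ d)
    (hfw : WeightLE N B w f) (hgw : WeightLE N B w g) (a : ZMod p)
    (hfa : (f.map (Int.castRingHom (ZMod p))).eval a = 0)
    (hga : (g.map (Int.castRingHom (ZMod p))).eval a = 0)
    (hp : (2 * d).factorial * B ^ (2 * d) * N ^ (2 * ∑ i ∈ range d, (w + i)) <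
      p * N ^ (∑ i ∈ range (2 * d), i)) :
    ¬ IsCoprime (f.map (Int.castRingHom ℚ)) (g.map (Int.castRingHom ℚ)) := by
  intro h
  have hf0 : f ≠ 0 := by rintro rfl; simp at hf; omega
  refine resultant_ne_zero_of_isCoprime f g hf hf0 hg h ?_
  refine Int.eq_zero_of_abs_lt_dvd (dvd_resultant hd f g hf.le hg a hfa hga) ?_
  have h1 := abs_resultant_le f g hf.le hg hfw hgw
  exact lt_of_mul_lt_mul_right (h1.trans_lt (by exact_mod_cast hp)) (by positivity)

open Polynomial in
/-- The count when all numerators share a factor with a fixed polynomial. -/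
theorem card_sq_le_of_forall_not_isCoprime {ι : Type*} [Fintype ι] [DecidableEq ι] {m : ι → ℤ}
    {N b D d : ℕ} (hm : ∀ i, (m i).natAbs ≤ b) (hm0 : ∀ i, m i ≠ 0)
    (hD : ∀ n : ℕ, n ≠ 0 → n ≤ b * N ^ (Fintype.card ι - 1) → #n.divisors ≤ D)
    (f : ℤ[X]) (hf0 : f ≠ 0) (hf : f.natDegree ≤ d) (S : Finset (ι → ℕ))
    (hS : ∀ x ∈ S, (∀ i, x i ∈ Icc 1 N) ∧ Function.Injective x ∧
      ¬ IsCoprime (f.map (Int.castRingHom ℚ)) ((numer m x).map (Int.castRingHom ℚ))) :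
    #S ^ 2 ≤ d ^ 2 * (N ^ Fintype.card ι *
      (D ^ (Fintype.card ι * Fintype.card {e : ι × ι // e.1 ≠ e.2}) *
        (2 * d * D) ^ (2 * Fintype.card ι))) := by
  classical
  set T := N ^ Fintype.card ι *
      (D ^ (Fintype.card ι * Fintype.card {e : ι × ι // e.1 ≠ e.2}) *
        (2 * d * D) ^ (2 * Fintype.card ι)) with hT
  have hmap (ζ : ℂ) (P : ℤ[X]) : aeval ζ (P.map (Int.castRingHom ℚ)) = aeval ζ P := by
    rw [show Int.castRingHom ℚ = algebraMap ℤ ℚ from rfl, aeval_map_algebraMap]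
  set Z : Finset ℂ := (f.aroots ℂ).toFinset with hZ
  have hZc : #Z ≤ d := by
    refine (Multiset.toFinset_card_le _).trans (le_trans ?_ hf)
    exact (card_roots' _).trans natDegree_map_le
  have hmemZ (ζ : ℂ) : ζ ∈ Z ↔ aeval ζ f = 0 := by
    rw [hZ, Multiset.mem_toFinset, mem_aroots]
    tauto
  have hone : ∀ ζ ∈ Z, #{x ∈ S | aeval ζ (numer m x) = 0} ≤ Nat.sqrt T := by
    intro ζ hζ
    obtain ⟨g, hg1, hg⟩ := exists_dvd_of_aeval_eq_zero ζ f hf0 ((hmemZ ζ).mp hζ)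
    have hgd : g.natDegree ≤ d :=
      (natDegree_le_of_dvd (hg f ((hmemZ ζ).mp hζ)) hf0).trans hf
    rw [Nat.le_sqrt, ← sq]
    refine (card_sq_le_of_forall_dvd_numer hm hm0 hD g hg1 _ fun x hx => ?_).trans ?_
    · obtain ⟨hx, hx0⟩ := mem_filter.mp hx
      exact ⟨(hS x hx).1, (hS x hx).2.1, hg _ hx0⟩
    · rw [hT]; gcongr
  have hsum : #S ≤ d * Nat.sqrt T := by
    calc #S ≤ #(Z.biUnion fun ζ => {x ∈ S | aeval ζ (numer m x) = 0}) := by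
          refine card_le_card fun x hx => ?_
          have h1 := (hS x hx).2.2
          rw [isCoprime_iff_aeval_ne_zero_of_isAlgClosed ℚ ℂ] at h1
          push Not at h1
          obtain ⟨ζ, h2, h3⟩ := h1
          rw [hmap] at h2 h3
          exact mem_biUnion.mpr ⟨ζ, (hmemZ ζ).mpr h2, mem_filter.mpr ⟨hx, h3⟩⟩
      _ ≤ ∑ ζ ∈ Z, #{x ∈ S | aeval ζ (numer m x) = 0} := card_biUnion_le
      _ ≤ ∑ ζ ∈ Z, Nat.sqrt T := sum_le_sum hone
      _ = #Z * Nat.sqrt T := by rw [sum_const, smul_eq_mul]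
      _ ≤ d * Nat.sqrt T := by gcongr
  calc #S ^ 2 ≤ (d * Nat.sqrt T) ^ 2 := by gcongr
    _ = d ^ 2 * (Nat.sqrt T) ^ 2 := by ring
    _ ≤ d ^ 2 * T := by gcongr; exact Nat.sqrt_le' T

/-- `x` is an injective solution of `∑ i, m i / (a + x i) = 0` in `[1, N]`. -/
def IsSol {ι : Type*} [Fintype ι] (p : ℕ) (a : ZMod p) (N : ℕ) (m : ι → ℤ) (x : ι → ℕ) : Prop :=
  (∀ i, x i ∈ Icc 1 N) ∧ Function.Injective x ∧ ∑ i, (m i : ZMod p) * (a + x i)⁻¹ = 0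

lemma IsSol.le {ι : Type*} [Fintype ι] {p : ℕ} {a : ZMod p} {N : ℕ} {m : ι → ℤ} {x : ι → ℕ}
    (h : IsSol p a N m x) (i : ι) : x i ≤ N := (mem_Icc.mp (h.1 i)).2

lemma IsSol.numer_ne_zero {ι : Type*} [Fintype ι] [DecidableEq ι] [Nonempty ι] {p : ℕ}
    {a : ZMod p} {N : ℕ} {m : ι → ℤ} {x : ι → ℕ} (h : IsSol p a N m x) (hm0 : ∀ i, m i ≠ 0) :
    numer m x ≠ 0 := by
  intro h0
  have := eval_numer_neg_ne_zero m x hm0 h.2.1 (Classical.arbitrary ι)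
  simp [h0] at this

section

open Polynomial

variable {ι : Type*} [Fintype ι] [DecidableEq ι] {p : ℕ} {a : ZMod p} {N : ℕ} {m : ι → ℤ}
  {x : ι → ℕ}

lemma IsSol.weightLE (h : IsSol p a N m x) (hm : ∀ i, (m i).natAbs ≤ 6)
    (hι : Fintype.card ι ≤ 6) : WeightLE N 1152 (Fintype.card ι - 1) (numer m x) := by
  refine (weightLE_numer m x hm h.le).mono ?_
  calc Fintype.card ι * (6 * 2 ^ (Fintype.card ι - 1)) ≤ 6 * (6 * 2 ^ (6 - 1)) := by
        gcongr; norm_num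
    _ = 1152 := by norm_num

variable [Fact p.Prime]

lemma IsSol.eval_numer (ha : ∀ v ∈ Icc 1 N, a + (v : ZMod p) ≠ 0) (h : IsSol p a N m x) :
    ((numer m x).map (Int.castRingHom (ZMod p))).eval a = 0 := by
  rw [map_eval_numer m x a fun i => ha _ (h.1 i), h.2.2, mul_zero]

/-- A nonzero polynomial of small weight vanishing at `a` modulo `p` is not constant. -/
lemma natDegree_pos_of_eval_eq_zero {B w : ℕ} (f : ℤ[X]) (hf0 : f ≠ 0)
    (hf : WeightLE N B w f) (hfa : (f.map (Int.castRingHom (ZMod p))).eval a = 0)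
    (hp : B * N ^ w < p) : 0 < f.natDegree := by
  by_contra h0
  obtain ⟨c, rfl⟩ := natDegree_eq_zero.mp (by omega : f.natDegree = 0)
  have hc : c ≠ 0 := by rintro rfl; simp at hf0
  have h1 := hf 0
  simp only [coeff_C_zero, pow_zero, mul_one] at h1
  have h2 : (p : ℤ) ∣ c := by
    rw [← ZMod.intCast_zmod_eq_zero_iff_dvd]
    simpa using hfa
  exact hc (Int.eq_zero_of_abs_lt_dvd h2 (h1.trans_lt (by exact_mod_cast hp)))

end

lemma one_le_of_card_divisors_le {N b D r : ℕ} (hN : 0 < N) (hb : 0 < b)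
    (hD : ∀ n : ℕ, n ≠ 0 → n ≤ b * N ^ r → #n.divisors ≤ D) : 1 ≤ D := by
  have := hD 1 one_ne_zero (Nat.one_le_iff_ne_zero.mpr (by positivity))
  simpa using this

lemma count_bound {ι : Type*} [Fintype ι] [DecidableEq ι] {N D d : ℕ} (hι : Fintype.card ι ≤ 6)
    (hd : d ≤ 4) (hD : 1 ≤ D) :
    d ^ 2 * (N ^ Fintype.card ι *
      (D ^ (Fintype.card ι * Fintype.card {e : ι × ι // e.1 ≠ e.2}) *
        (2 * d * D) ^ (2 * Fintype.card ι))) ≤ 2 ^ 40 * D ^ 228 * N ^ Fintype.card ι := by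
  have hE : Fintype.card {e : ι × ι // e.1 ≠ e.2} ≤ 36 := by
    refine (Fintype.card_subtype_le _).trans ?_
    rw [Fintype.card_prod]
    nlinarith
  have h1 : D ^ (Fintype.card ι * Fintype.card {e : ι × ι // e.1 ≠ e.2}) ≤ D ^ (6 * 36) := by
    apply Nat.pow_le_pow_right hD
    gcongr
  have h2 : (2 * d * D) ^ (2 * Fintype.card ι) ≤ (8 * D) ^ (2 * 6) := by
    calc (2 * d * D) ^ (2 * Fintype.card ι) ≤ (8 * D) ^ (2 * Fintype.card ι) := by
          gcongr; omega
      _ ≤ _ := by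
          apply Nat.pow_le_pow_right (by omega)
          gcongr
  calc _ ≤ 4 ^ 2 * (N ^ Fintype.card ι * (D ^ (6 * 36) * (8 * D) ^ (2 * 6))) := by gcongr
    _ = _ := by ring

/-- The nondegenerate count with at most five terms. -/
theorem card_sq_le_of_card_le_five {ι : Type*} [Fintype ι] [DecidableEq ι] {p : ℕ} [Fact p.Prime]
    {a : ZMod p} {N D : ℕ} {m : ι → ℤ} (hN : 0 < N) (ha : ∀ v ∈ Icc 1 N, a + (v : ZMod p) ≠ 0)
    (hι : Fintype.card ι ≤ 5) (hm : ∀ i, (m i).natAbs ≤ 6) (hm0 : ∀ i, m i ≠ 0)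
    (hmsum : ∑ i, m i = 0) (hD : ∀ n : ℕ, n ≠ 0 → n ≤ 6 * N ^ 5 → #n.divisors ≤ D)
    (hp : 10 ^ 40 * N ^ 20 < p) (S : Finset (ι → ℕ)) (hS : ∀ x ∈ S, IsSol p a N m x) :
    #S ^ 2 ≤ 2 ^ 40 * D ^ 228 * N ^ Fintype.card ι := by
  have hD1 := one_le_of_card_divisors_le hN (by norm_num) hD
  rcases isEmpty_or_nonempty ι with hι0 | hι0
  · have : #S ≤ 1 := card_le_one.mpr fun x _ y _ => Subsingleton.elim _ _
    calc #S ^ 2 ≤ 1 ^ 2 := by gcongr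
      _ ≤ _ := by rw [one_pow]; exact Nat.one_le_iff_ne_zero.mpr (by positivity)
  have hι2 : 2 ≤ Fintype.card ι := by
    by_contra h
    have h1 : Fintype.card ι = 1 := by have := Fintype.card_pos (α := ι); omega
    obtain ⟨i, hi⟩ := Fintype.card_eq_one_iff.mp h1
    refine hm0 i ?_
    rw [← hmsum, sum_eq_single i (fun j _ hj => absurd (hi j) hj) (by simp)]
  rcases S.eq_empty_or_nonempty with rfl | hne
  · simp
  obtain ⟨x₀, hx₀, hmax⟩ := exists_max_image S (fun x => (numer m x).natDegree) hne
  have hw (x) (hx : x ∈ S) := (hS x hx).weightLE hm (by omega)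
  have hpow (k : ℕ) (hk : k ≤ 20) : N ^ k ≤ N ^ 20 := Nat.pow_le_pow_right hN hk
  have hdpos : 0 < (numer m x₀).natDegree := by
    refine natDegree_pos_of_eval_eq_zero _ ((hS x₀ hx₀).numer_ne_zero hm0) (hw x₀ hx₀)
      ((hS x₀ hx₀).eval_numer ha) ?_
    have := hpow (Fintype.card ι - 1) (by omega)
    omega
  have hd3 : (numer m x₀).natDegree ≤ 3 := by
    have := natDegree_numer_lt m x₀ hmsum hι2
    omega
  refine (card_sq_le_of_forall_not_isCoprime hm hm0 (fun n h0 h1 => hD n h0 (h1.trans ?_))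
    (numer m x₀) ((hS x₀ hx₀).numer_ne_zero hm0) le_rfl S fun x hx =>
    ⟨(hS x hx).1, (hS x hx).2.1, not_isCoprime_of_eval_eq_zero hN hdpos _ _ rfl (hmax x hx)
      (hw x₀ hx₀) (hw x hx) a ((hS x₀ hx₀).eval_numer ha) ((hS x hx).eval_numer ha) ?_⟩).trans
    (count_bound (by omega) (by omega) hD1)
  · gcongr
    omega
  · generalize (numer m x₀).natDegree = d at hdpos hd3
    have hr : Fintype.card ι - 1 ≤ 4 := by omega
    generalize Fintype.card ι - 1 = w at hr
    have h1 : 2 * ∑ i ∈ range d, (w + i) ≤ 20 + ∑ i ∈ range (2 * d), i := by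
      interval_cases d <;> simp [sum_range_succ] <;> omega
    have h2 : (2 * d).factorial * 1152 ^ (2 * d) ≤ 10 ^ 40 := by
      interval_cases d <;> norm_num [Nat.factorial]
    calc (2 * d).factorial * 1152 ^ (2 * d) * N ^ (2 * ∑ i ∈ range d, (w + i))
        ≤ 10 ^ 40 * N ^ (20 + ∑ i ∈ range (2 * d), i) := by
          gcongr
      _ = 10 ^ 40 * N ^ 20 * N ^ (∑ i ∈ range (2 * d), i) := by rw [pow_add]; ring
      _ < p * N ^ (∑ i ∈ range (2 * d), i) := by
          gcongr

open Polynomial in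
/-- A linear relation between shifts of three small polynomials with a common root modulo `p`. -/
lemma exists_three_term_relation {p : ℕ} [Fact p.Prime] {N B α β γ d w : ℕ} (hN : 0 < N)
    (f g h : ℤ[X]) (hf : f.natDegree ≤ d) (hg : g.natDegree ≤ d) (hh : h.natDegree ≤ d)
    (hfw : WeightLE N B w f) (hgw : WeightLE N B w g) (hhw : WeightLE N B w h) (a : ZMod p)
    (hfa : (f.map (Int.castRingHom (ZMod p))).eval a = 0)
    (hga : (g.map (Int.castRingHom (ZMod p))).eval a = 0)
    (hha : (h.map (Int.castRingHom (ZMod p))).eval a = 0)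
    (hα : d + α ≤ α + β + γ) (hβ : d + β ≤ α + β + γ) (hγ : d + γ ≤ α + β + γ)
    (hk : 0 < α + β + γ)
    (hp : (α + β + γ).factorial * B ^ (α + β + γ) * N ^ (∑ i ∈ range α, (w + i) +
      ∑ i ∈ range β, (w + i) + ∑ i ∈ range γ, (w + i)) <
        p * N ^ (∑ i ∈ range (α + β + γ), i)) :
    ∃ A B C : ℤ[X], (A ≠ 0 ∨ B ≠ 0 ∨ C ≠ 0) ∧ A.degree < α ∧ B.degree < β ∧ C.degree < γ ∧
      A * f + B * g + C * h = 0 := by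
  set F : Fin (α + β + γ) → ℤ[X] := fun j => j.addCases
    (fun j => j.addCases (fun i => X ^ (i : ℕ) * f) (fun i => X ^ (i : ℕ) * g))
    (fun i => X ^ (i : ℕ) * h) with hF
  set v : Fin (α + β + γ) → ℕ := fun j => j.addCases
    (fun j => j.addCases (fun i => w + i) (fun i => w + i)) (fun i => w + i) with hv
  have hF1 (i : Fin α) : F ((i.castAdd β).castAdd γ) = X ^ (i : ℕ) * f := by
    simp only [hF, Fin.addCases_left]
  have hF2 (i : Fin β) : F ((i.natAdd α).castAdd γ) = X ^ (i : ℕ) * g := by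
    simp only [hF, Fin.addCases_left, Fin.addCases_right]
  have hF3 (i : Fin γ) : F (i.natAdd (α + β)) = X ^ (i : ℕ) * h := by
    simp only [hF, Fin.addCases_right]
  have hv1 (i : Fin α) : v ((i.castAdd β).castAdd γ) = w + i := by
    simp only [hv, Fin.addCases_left]
  have hv2 (i : Fin β) : v ((i.natAdd α).castAdd γ) = w + i := by
    simp only [hv, Fin.addCases_left, Fin.addCases_right]
  have hv3 (i : Fin γ) : v (i.natAdd (α + β)) = w + i := by
    simp only [hv, Fin.addCases_right]
  have hdeg {δ : ℕ} (q : ℤ[X]) (hq : q.natDegree ≤ d) (hδ : d + δ ≤ α + β + γ) (i : Fin δ) :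
      (X ^ (i : ℕ) * q).natDegree < α + β + γ := by
    refine natDegree_mul_le.trans_lt ?_
    rw [natDegree_X_pow]
    omega
  have hsum : ∑ j, v j = ∑ i ∈ range α, (w + i) + ∑ i ∈ range β, (w + i) +
      ∑ i ∈ range γ, (w + i) := by
    rw [Fin.sum_univ_add, Fin.sum_univ_add, Finset.sum_range, Finset.sum_range, Finset.sum_range]
    simp only [hv1, hv2, hv3]
  obtain ⟨t, ht, hrel⟩ := exists_relation_of_eval_eq_zero (B := B) hk hN F v
    (fun j => by
      induction j using Fin.addCases with
      | left j =>
        induction j using Fin.addCases with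
        | left j => rw [hF1]; exact hdeg f hf hα j
        | right j => rw [hF2]; exact hdeg g hg hβ j
      | right j => rw [hF3]; exact hdeg h hh hγ j)
    (fun j => by
      induction j using Fin.addCases with
      | left j =>
        induction j using Fin.addCases with
        | left j => rw [hF1, hv1]; exact hfw.X_pow_mul j
        | right j => rw [hF2, hv2]; exact hgw.X_pow_mul j
      | right j => rw [hF3, hv3]; exact hhw.X_pow_mul j) a
    (fun j => by
      induction j using Fin.addCases with
      | left j =>
        induction j using Fin.addCases with
        | left j => rw [hF1]; simp [hfa]
        | right j => rw [hF2]; simp [hga]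
      | right j => rw [hF3]; simp [hha])
    (by rw [hsum, ← Finset.sum_range (fun i => i)]; exact hp)
  have hcoeff {δ : ℕ} (c : Fin δ → ℤ) (i : Fin δ) (h0 : ∑ i, C (c i) * X ^ (i : ℕ) = 0) :
      c i = 0 := by
    have h1 := congrArg (fun q => q.coeff i) h0
    simp only [finsetSum_coeff, coeff_C_mul_X_pow, coeff_zero] at h1
    rw [sum_eq_single i] at h1
    · simpa using h1
    · intro j _ hj
      rw [if_neg]
      exact fun h => hj (Fin.ext h.symm)
    · simp
  refine ⟨∑ i, C (t ((Fin.castAdd β i).castAdd γ)) * X ^ (i : ℕ),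
    ∑ i, C (t ((Fin.natAdd α i).castAdd γ)) * X ^ (i : ℕ),
    ∑ i, C (t (Fin.natAdd (α + β) i)) * X ^ (i : ℕ), ?_, degree_sum_fin_lt _,
    degree_sum_fin_lt _, degree_sum_fin_lt _, ?_⟩
  · by_contra! h0
    refine ht (funext fun j => ?_)
    induction j using Fin.addCases with
    | left j =>
      induction j using Fin.addCases with
      | left j => exact hcoeff (fun i => t ((Fin.castAdd β i).castAdd γ)) j h0.1
      | right j => exact hcoeff (fun i => t ((Fin.natAdd α i).castAdd γ)) j h0.2.1
    | right j => exact hcoeff (fun i => t (Fin.natAdd (α + β) i)) j h0.2.2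
  · rw [Fin.sum_univ_add, Fin.sum_univ_add] at hrel
    rw [← hrel, sum_mul, sum_mul, sum_mul]
    simp only [hF1, hF2, hF3, mul_assoc]

open Polynomial in
lemma eq_zero_of_mul_add_mul_eq_zero {f g u v : ℤ[X]}
    (hfg : IsCoprime (f.map (Int.castRingHom ℚ)) (g.map (Int.castRingHom ℚ)))
    (hv : v.degree < f.degree) (h : u * f + v * g = 0) : u = 0 ∧ v = 0 := by
  have hi : Function.Injective (Int.castRingHom ℚ) := RingHom.injective_int _
  have hv0 : v = 0 := by
    by_contra hv0
    have h1 : f.map (Int.castRingHom ℚ) ∣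
        v.map (Int.castRingHom ℚ) * g.map (Int.castRingHom ℚ) := by
      refine ⟨-u.map (Int.castRingHom ℚ), ?_⟩
      have := congrArg (Polynomial.map (Int.castRingHom ℚ)) h
      simp only [Polynomial.map_add, Polynomial.map_mul, Polynomial.map_zero] at this
      linear_combination this
    have h2 := degree_le_of_dvd (hfg.dvd_of_dvd_mul_right h1)
      ((Polynomial.map_ne_zero_iff hi).mpr hv0)
    rw [degree_map_eq_of_injective hi, degree_map_eq_of_injective hi] at h2
    exact absurd hv (not_lt.mpr h2)
  refine ⟨?_, hv0⟩
  rw [hv0, zero_mul, add_zero] at h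
  refine (mul_eq_zero.mp h).resolve_right ?_
  rintro rfl
  simp at hv

open Polynomial in
/-- Three quartic numerators with a common root modulo a large prime are linearly dependent,
if the first two are coprime. -/
theorem exists_span_of_isCoprime {p : ℕ} [Fact p.Prime] {N : ℕ} (hN : 0 < N)
    (f g h : ℤ[X]) (hf : f.natDegree = 4) (hg : g.natDegree ≤ 4) (hh : h.natDegree ≤ 4)
    (hfw : WeightLE N 1152 5 f) (hgw : WeightLE N 1152 5 g) (hhw : WeightLE N 1152 5 h)
    (a : ZMod p)
    (hfa : (f.map (Int.castRingHom (ZMod p))).eval a = 0)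
    (hga : (g.map (Int.castRingHom (ZMod p))).eval a = 0)
    (hha : (h.map (Int.castRingHom (ZMod p))).eval a = 0)
    (hfg : IsCoprime (f.map (Int.castRingHom ℚ)) (g.map (Int.castRingHom ℚ)))
    (hp : 10 ^ 40 * N ^ 20 < p) :
    ∃ c u v : ℤ, c ≠ 0 ∧ C c * h = C u * f + C v * g := by
  have hf4 : f.degree = 4 := by
    rw [degree_eq_natDegree (by rintro rfl; simp at hf), hf]; rfl
  have hrel (α β γ : ℕ) (hk : 0 < α + β + γ) (h7 : α + β + γ ≤ 7) (hα : 4 + α ≤ α + β + γ)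
      (hβ : 4 + β ≤ α + β + γ) (hγ : 4 + γ ≤ α + β + γ)
      (hs : ∑ i ∈ range α, (5 + i) + ∑ i ∈ range β, (5 + i) + ∑ i ∈ range γ, (5 + i) ≤
        20 + ∑ i ∈ range (α + β + γ), i) :=
    exists_three_term_relation hN f g h hf.le hg hh hfw hgw hhw a hfa hga hha hα hβ hγ hk (by
      have h2 : (α + β + γ).factorial * 1152 ^ (α + β + γ) ≤ 10 ^ 40 := by
        interval_cases α + β + γ <;> norm_num [Nat.factorial]
      calc (α + β + γ).factorial * 1152 ^ (α + β + γ) * N ^ (∑ i ∈ range α, (5 + i) +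
              ∑ i ∈ range β, (5 + i) + ∑ i ∈ range γ, (5 + i))
          ≤ 10 ^ 40 * N ^ (20 + ∑ i ∈ range (α + β + γ), i) := by gcongr
        _ = 10 ^ 40 * N ^ 20 * N ^ (∑ i ∈ range (α + β + γ), i) := by rw [pow_add]; ring
        _ < p * N ^ (∑ i ∈ range (α + β + γ), i) := by gcongr)
  have hlt {q : ℤ[X]} {k : ℕ} (hq : q.degree < k) (hk : k ≤ 4) : q.degree < f.degree := by
    rw [hf4]
    exact hq.trans_le (by exact_mod_cast hk)
  obtain ⟨u, v, c', hne, hu, hv, hc', h1⟩ := hrel 3 3 1 (by simp) (by simp) (by simp) (by simp)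
    (by simp) (by simp [sum_range_succ])
  obtain ⟨c, rfl⟩ : ∃ c : ℤ, c' = C c :=
    ⟨_, eq_C_of_degree_le_zero (Order.lt_succ_iff.mp hc')⟩
  have hc : c ≠ 0 := by
    rintro rfl
    obtain ⟨rfl, rfl⟩ := eq_zero_of_mul_add_mul_eq_zero hfg (hlt hv (by simp)) (by simpa using h1)
    simp at hne
  have hCc : (C c : ℤ[X]) ≠ 0 := by simpa using hc
  have hdC (q : ℤ[X]) : (C c * q).degree = q.degree := by
    rw [degree_mul, degree_C hc, zero_add]
  have key {A B D : ℤ[X]} (h2 : A * f + B * g + D * h = 0) (hne : A ≠ 0 ∨ B ≠ 0 ∨ D ≠ 0)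
      (hB : B.degree < f.degree) (hD : (D * v).degree < f.degree) :
      D ≠ 0 ∧ C c * A = D * u ∧ C c * B = D * v := by
    have h3 : (C c * A - D * u) * f + (C c * B - D * v) * g = 0 := by
      linear_combination C c * h2 - D * h1
    obtain ⟨h4, h5⟩ := eq_zero_of_mul_add_mul_eq_zero hfg
      ((degree_sub_le _ _).trans_lt (max_lt (by rwa [hdC]) hD)) h3
    refine ⟨?_, sub_eq_zero.mp h4, sub_eq_zero.mp h5⟩
    rintro rfl
    simp only [zero_mul, sub_zero, mul_eq_zero, hCc, false_or] at h4 h5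
    simp [h4, h5] at hne
  have hle {A D q : ℤ[X]} {k : ℕ} (hA : A.degree < k) (hD : D ≠ 0) (h : C c * A = D * q) :
      q.degree < k := by
    refine lt_of_le_of_lt ?_ hA
    rw [← hdC A, h, mul_comm]
    exact degree_le_mul_left _ hD
  have hmul {D q : ℤ[X]} {k l : ℕ} (hD : D.degree < (k + 1 : ℕ)) (hq : q.degree < (l + 1 : ℕ))
      (hkl : k + l < 4) : (D * q).degree < f.degree := by
    have h1 : D.degree ≤ k := Order.lt_succ_iff.mp (by exact_mod_cast hD)
    have h2 : q.degree ≤ l := Order.lt_succ_iff.mp (by exact_mod_cast hq)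
    rw [hf4]
    refine ((degree_mul_le _ _).trans (add_le_add h1 h2)).trans_lt ?_
    exact_mod_cast hkl
  obtain ⟨A, B, D, hne2, hA, hB, hD, h2⟩ := hrel 2 2 2 (by simp) (by simp) (by simp) (by simp)
    (by simp) (by simp [sum_range_succ])
  obtain ⟨hD0, hAu, hBv⟩ := key h2 hne2 (hlt hB (by simp)) (hmul hD hv (by simp))
  have hu2 := hle hA hD0 hAu
  have hv2 := hle hB hD0 hBv
  obtain ⟨A, B, D, hne3, hA, hB, hD, h3⟩ := hrel 3 1 3 (by simp) (by simp) (by simp) (by simp)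
    (by simp) (by simp [sum_range_succ])
  obtain ⟨hD0, hAu, hBv⟩ := key h3 hne3 (hlt hB (by simp)) (hmul hD hv2 (by simp))
  have hv1 := hle hB hD0 hBv
  obtain ⟨A, B, D, hne4, hA, hB, hD, h4⟩ := hrel 1 3 3 (by simp) (by simp) (by simp) (by simp)
    (by simp) (by simp [sum_range_succ])
  obtain ⟨hD0, hAu, hBv⟩ := key h4 hne4 (hlt hB (by simp)) (hmul hD hv2 (by simp))
  have hu1 := hle hA hD0 hAu
  obtain ⟨u', rfl⟩ : ∃ u', u = C u' := ⟨_, eq_C_of_degree_le_zero (Order.lt_succ_iff.mp hu1)⟩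
  obtain ⟨v', rfl⟩ : ∃ v', v = C v' := ⟨_, eq_C_of_degree_le_zero (Order.lt_succ_iff.mp hv1)⟩
  refine ⟨c, -u', -v', hc, ?_⟩
  simp only [C_neg]
  linear_combination h1

open Polynomial in
lemma isCoprime_of_resultant_ne_zero {d : ℕ} (f g : ℤ[X]) (hf : f.natDegree = d) (hf0 : f ≠ 0)
    (hg : g.natDegree ≤ d) (h : resultant f g d d ≠ 0) :
    IsCoprime (f.map (Int.castRingHom ℚ)) (g.map (Int.castRingHom ℚ)) := by
  have hi : Function.Injective (Int.castRingHom ℚ) := RingHom.injective_int _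
  by_contra hco
  have h1 : resultant (f.map (Int.castRingHom ℚ)) (g.map (Int.castRingHom ℚ)) = 0 := by
    rw [resultant_eq_zero_iff]
    exact ⟨Or.inl ((Polynomial.map_ne_zero_iff hi).mpr hf0), hco⟩
  rw [natDegree_map_eq_of_injective hi, natDegree_map_eq_of_injective hi] at h1
  obtain ⟨k, hk⟩ := Nat.exists_eq_add_of_le hg
  have h2 := resultant_add_right_deg (f.map (Int.castRingHom ℚ)) (g.map (Int.castRingHom ℚ))
    d g.natDegree k (natDegree_map_le)
  rw [← hk, resultant_map_map, ← hf, h1, mul_zero, hf] at h2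
  exact h ((map_eq_zero_iff _ hi).mp h2)

open Polynomial in
/-- The small polynomials of degree at most four with a given root modulo a large prime,
one pair of which is coprime, form a set of size `O(N ^ 2)`. -/
theorem card_le_of_isCoprime {p : ℕ} [Fact p.Prime] {N : ℕ} (hN : 0 < N) (T : Finset ℤ[X])
    (a : ZMod p) (hdeg : ∀ f ∈ T, f.natDegree ≤ 4) (hw : ∀ f ∈ T, WeightLE N 1152 5 f)
    (ha : ∀ f ∈ T, (f.map (Int.castRingHom (ZMod p))).eval a = 0)
    (hp : 10 ^ 40 * N ^ 20 < p) (f : ℤ[X]) (hf : f ∈ T) (hf4 : f.natDegree = 4)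
    (hco : ∃ g ∈ T, IsCoprime (f.map (Int.castRingHom ℚ)) (g.map (Int.castRingHom ℚ))) :
    #T ≤ 10 ^ 4 * N ^ 2 := by
  have hf0 : f ≠ 0 := by rintro rfl; simp at hf4
  obtain ⟨g, hg, hmax⟩ := exists_max_image T (fun g => |resultant f g 4 4|) ⟨f, hf⟩
  set r := resultant f g 4 4 with hr
  have hr0 : r ≠ 0 := by
    obtain ⟨g', hg', hco⟩ := hco
    have h1 := abs_pos.mpr (resultant_ne_zero_of_isCoprime f g' hf4 hf0 (hdeg g' hg') hco)
    exact abs_pos.mp (h1.trans_le (hmax g' hg'))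
  have hfg := isCoprime_of_resultant_ne_zero f g hf4 hf0 (hdeg g hg) hr0
  have hspan (h : ℤ[X]) : ∃ c u v : ℤ, h ∈ T → c ≠ 0 ∧ C c * h = C u * f + C v * g := by
    by_cases hh : h ∈ T
    · obtain ⟨c, u, v, h1⟩ := exists_span_of_isCoprime hN f g h hf4 (hdeg g hg) (hdeg h hh)
        (hw f hf) (hw g hg) (hw h hh) a (ha f hf) (ha g hg) (ha h hh) hfg hp
      exact ⟨c, u, v, fun _ => h1⟩
    · exact ⟨0, 0, 0, fun h => absurd h hh⟩
  choose c u v huv using hspan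
  have hres (e x y : ℤ) (h : ℤ[X]) (hh : C e * h = C x * f + C y * g) :
      e ^ 4 * resultant f h 4 4 = y ^ 4 * r := by
    rw [hr, ← resultant_C_mul_right, ← resultant_C_mul_right, hh, add_comm, mul_comm (C x),
      resultant_add_mul_right _ _ _ _ _ (by simp) hf4.le]
  set t : ℤ[X] → ℚ := fun h => v h / c h with ht
  have htle (h : ℤ[X]) (hh : h ∈ T) : |t h| ≤ 1 := by
    obtain ⟨h1, h2⟩ := huv h hh
    have h3 := hres _ _ _ _ h2
    have h4 : |v h| ≤ |c h| := by
      by_contra! h5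
      have h6 : |c h| ^ 4 < |v h| ^ 4 := by gcongr
      have h7 := congrArg abs h3
      rw [abs_mul, abs_mul, abs_pow, abs_pow] at h7
      have h8 : |c h| ^ 4 * |resultant f h 4 4| ≤ |c h| ^ 4 * |r| := by
        exact mul_le_mul_of_nonneg_left (hmax h hh) (by positivity)
      have h9 := mul_lt_mul_of_pos_right h6 (abs_pos.mpr hr0)
      linarith
    rw [ht, abs_div, div_le_one (by simpa using h1)]
    exact_mod_cast h4
  have hrle : |r| ≤ 10 ^ 30 * N ^ 24 := by
    have h1 := abs_resultant_le f g hf4.le (hdeg g hg) (hw f hf) (hw g hg)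
    have h2 : (N : ℤ) ^ 28 * |r| ≤ N ^ 28 * (10 ^ 30 * N ^ 24) := by
      simp only [sum_range_succ, range_zero, sum_empty] at h1
      norm_num [Nat.factorial] at h1
      calc (N : ℤ) ^ 28 * |r| = |r| * N ^ 28 := mul_comm _ _
        _ ≤ _ := h1
        _ ≤ 10 ^ 30 * N ^ 52 := by gcongr; norm_num
        _ = _ := by ring
    exact le_of_mul_le_mul_left h2 (by positivity)
  have hinj1 (h k : ℤ[X]) (hh : h ∈ T) (hk : k ∈ T) (hlt : |N * t h - N * t k| < 1) :
      t h = t k := by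
    by_contra hne
    obtain ⟨h1, h2⟩ := huv h hh
    obtain ⟨k1, k2⟩ := huv k hk
    have h3 := hres (c h * c k) (c k * u h - c h * u k) (c k * v h - c h * v k) (h - k) (by
      simp only [C_mul, C_sub]
      linear_combination C (c k) * h2 - C (c h) * k2)
    have h4 : (p : ℤ) ∣ resultant f (h - k) 4 4 :=
      dvd_resultant (by simp) f (h - k) hf4.le
        ((natDegree_sub_le _ _).trans (max_le (hdeg h hh) (hdeg k hk))) a (ha f hf) (by
          rw [Polynomial.map_sub, eval_sub, ha h hh, ha k hk, sub_zero])
    have hch : (c h : ℚ) ≠ 0 := by exact_mod_cast h1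
    have hck : (c k : ℚ) ≠ 0 := by exact_mod_cast k1
    have h5 : ((resultant f (h - k) 4 4 : ℤ) : ℚ) = (t h - t k) ^ 4 * r := by
      have h3' : ((c h : ℚ) * c k) ^ 4 * ((resultant f (h - k) 4 4 : ℤ) : ℚ) =
        (c k * v h - c h * v k) ^ 4 * r := by exact_mod_cast h3
      simp only [ht]
      field_simp
      linear_combination h3'
    have h6 : resultant f (h - k) 4 4 ≠ 0 := by
      intro h0
      rw [h0, Int.cast_zero] at h5
      exact mul_ne_zero (pow_ne_zero 4 (sub_ne_zero.mpr hne)) (Int.cast_ne_zero.mpr hr0) h5.symm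
    have h7 : (p : ℤ) ≤ |resultant f (h - k) 4 4| := by
      by_contra! h8
      exact h6 (Int.eq_zero_of_abs_lt_dvd h4 h8)
    have h8 : (p : ℚ) ≤ (t h - t k) ^ 4 * |(r : ℚ)| := by
      have : (p : ℚ) ≤ |((resultant f (h - k) 4 4 : ℤ) : ℚ)| := by exact_mod_cast h7
      rwa [h5, abs_mul, abs_of_nonneg (by positivity : 0 ≤ (t h - t k) ^ 4)] at this
    have hrle' : |(r : ℚ)| ≤ 10 ^ 30 * N ^ 24 := by exact_mod_cast hrle
    have h9 : (N * t h - N * t k) ^ 4 ≤ 1 := by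
      rw [show (N * t h - N * t k) ^ 4 = |N * t h - N * t k| ^ 4 from
        (Even.pow_abs (by decide) _).symm]
      exact pow_le_one₀ (abs_nonneg _) hlt.le
    have hpq : (10 : ℚ) ^ 40 * N ^ 20 < p := by exact_mod_cast hp
    have hNq : (0 : ℚ) < N := by exact_mod_cast hN
    have h10 : (p : ℚ) ≤ 10 ^ 30 * N ^ 20 := by
      calc (p : ℚ) ≤ (t h - t k) ^ 4 * (10 ^ 30 * N ^ 24) :=
            h8.trans (mul_le_mul_of_nonneg_left hrle' (by positivity))
        _ = (N * t h - N * t k) ^ 4 * (10 ^ 30 * N ^ 20) := by ring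
        _ ≤ 1 * (10 ^ 30 * N ^ 20) := by gcongr
        _ = _ := one_mul _
    have : (0 : ℚ) < N ^ 20 := by positivity
    linarith
  have hinj2 (h k : ℤ[X]) (hh : h ∈ T) (hk : k ∈ T) (htk : t h = t k)
      (hc4 : h.coeff 4 = k.coeff 4) : h = k := by
    obtain ⟨h1, h2⟩ := huv h hh
    obtain ⟨k1, k2⟩ := huv k hk
    have hch : (c h : ℚ) ≠ 0 := by exact_mod_cast h1
    have hck : (c k : ℚ) ≠ 0 := by exact_mod_cast k1
    have h3 : c k * v h = c h * v k := by
      simp only [ht] at htk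
      rw [div_eq_div_iff hch hck] at htk
      have : (v h) * c k = v k * c h := by exact_mod_cast htk
      linarith
    have h3C : C (c k) * C (v h) = C (c h) * C (v k) := by rw [← C_mul, ← C_mul, h3]
    have h4 : C (c h * c k) * (h - k) = C (c k * u h - c h * u k) * f := by
      simp only [C_mul, C_sub]
      linear_combination C (c k) * h2 - C (c h) * k2 + g * h3C
    have h5 : c k * u h - c h * u k = 0 := by
      have := congrArg (fun q => q.coeff 4) h4
      simp only [coeff_C_mul, coeff_sub, hc4, sub_self, mul_zero] at this
      refine (mul_eq_zero.mp this.symm).resolve_right ?_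
      rw [← hf4]
      simpa using hf0
    rw [h5, C_0, zero_mul] at h4
    exact sub_eq_zero.mp ((mul_eq_zero.mp h4).resolve_left (by simp [h1, k1]))
  have hcoef (h : ℤ[X]) (hh : h ∈ T) : |h.coeff 4| ≤ 1152 * N := by
    have h1 := hw h hh 4
    have h2 : |h.coeff 4| * (N : ℤ) ^ 4 ≤ 1152 * N * N ^ 4 := by
      refine h1.trans (le_of_eq ?_)
      push_cast
      ring
    exact le_of_mul_le_mul_right h2 (by positivity)
  calc #T ≤ #(Icc (-N : ℤ) N ×ˢ Icc (-(1152 * N) : ℤ) (1152 * N)) := by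
        refine card_le_card_of_injOn (fun h => (⌊N * t h⌋, h.coeff 4)) ?_ ?_
        · intro h hh
          rw [mem_coe] at hh
          have h1 := abs_le.mp (htle h hh)
          have h2 := abs_le.mp (hcoef h hh)
          have hNq : (0 : ℚ) ≤ N := by positivity
          simp only [coe_product, coe_Icc, Set.mem_prod, Set.mem_Icc]
          refine ⟨⟨?_, ?_⟩, h2⟩
          · rw [Int.le_floor]
            push_cast
            nlinarith
          · refine Int.cast_le.mp ((Int.floor_le (N * t h : ℚ)).trans ?_)
            push_cast
            nlinarith
        · intro h hh k hk hhk
          rw [mem_coe] at hh hk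
          simp only [Prod.mk.injEq] at hhk
          exact hinj2 h k hh hk (hinj1 h k hh hk (Int.abs_sub_lt_one_of_floor_eq_floor hhk.1)) hhk.2
    _ = (2 * N + 1) * (2 * (1152 * N) + 1) := by
        rw [card_product, Int.card_Icc, Int.card_Icc]
        congr 1 <;> omega
    _ ≤ (2 * N + N) * (2 * (1152 * N) + N) := by gcongr <;> omega
    _ ≤ _ := by ring_nf; gcongr; norm_num

/-- Few tuples have a given numerator. -/
lemma card_le_of_numer_eq {ι : Type*} [Fintype ι] [DecidableEq ι] [Nonempty ι] {m : ι → ℤ}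
    {N b D : ℕ} (hm : ∀ i, (m i).natAbs ≤ b) (hm0 : ∀ i, m i ≠ 0) (hD1 : 1 ≤ D)
    (hD : ∀ n : ℕ, n ≠ 0 → n ≤ b * N ^ (Fintype.card ι - 1) → #n.divisors ≤ D)
    (S : Finset (ι → ℕ)) (hS : ∀ x ∈ S, (∀ i, x i ∈ Icc 1 N) ∧ Function.Injective x)
    (f : Polynomial ℤ) (hf : ∀ x ∈ S, numer m x = f) :
    #S ≤ (3 * D) ^ Fintype.card ι * N := by
  set i₀ := Classical.arbitrary ι
  have key (v : ℕ) : #(S.filter fun x => x i₀ = v) ≤ (3 * D) ^ Fintype.card ι := by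
    rcases (S.filter fun x => x i₀ = v).eq_empty_or_nonempty with h | ⟨y, hy⟩
    · simp [h]
    obtain ⟨hyS, hyv⟩ := mem_filter.mp hy
    set K := (f.eval (-(v : ℤ))).natAbs with hK
    have hK0 : K ≠ 0 := by
      rw [hK, Int.natAbs_ne_zero, ← hf y hyS, ← hyv]
      exact eval_numer_neg_ne_zero m y hm0 (hS y hyS).2 i₀
    have hKle : K ≤ b * N ^ (Fintype.card ι - 1) := by
      rw [hK, ← hf y hyS, ← hyv]
      exact natAbs_eval_numer_neg_le m y hm (fun i => (mem_Icc.mp ((hS y hyS).1 i)).2) i₀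
    set W : Finset ℕ := insert v
      (K.divisors.biUnion fun d => (Icc 1 N).filter fun w : ℕ => ((v : ℤ) - w).natAbs = d) with hW
    have hWc : #W ≤ 3 * D := by
      have h1 (d : ℕ) : #((Icc 1 N).filter fun w : ℕ => ((v : ℤ) - w).natAbs = d) ≤ 2 := by
        have := card_filter_natAbs_eval_eq_le (Polynomial.X + Polynomial.C (v : ℤ))
          (by rw [Polynomial.natDegree_X_add_C]) (Icc 1 N) d
        rw [Polynomial.natDegree_X_add_C] at this
        simpa [neg_add_eq_sub] using this
      calc #W ≤ #(K.divisors.biUnion fun d =>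
            (Icc 1 N).filter fun w : ℕ => ((v : ℤ) - w).natAbs = d) + 1 := card_insert_le _ _
        _ ≤ #K.divisors * 2 + 1 := by
            gcongr
            exact card_biUnion_le_card_mul _ _ _ fun d _ => h1 d
        _ ≤ D * 2 + D := by gcongr; exact hD K hK0 hKle
        _ = _ := by ring
    calc #(S.filter fun x => x i₀ = v) ≤ #(Fintype.piFinset fun _ : ι => W) := by
          refine card_le_card fun x hx => ?_
          obtain ⟨hxS, hxv⟩ := mem_filter.mp hx
          rw [Fintype.mem_piFinset]
          intro j
          rw [hW, mem_insert]
          by_cases hj : j = i₀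
          · exact Or.inl (hj ▸ hxv)
          right
          refine mem_biUnion.mpr ⟨((v : ℤ) - x j).natAbs, ?_, mem_filter.mpr ⟨(hS x hxS).1 j, rfl⟩⟩
          rw [Nat.mem_divisors]
          refine ⟨?_, hK0⟩
          rw [hK, Int.natAbs_dvd_natAbs, ← hf x hxS, ← hxv, eval_numer_neg]
          refine Dvd.dvd.mul_left ?_ _
          rw [← neg_sub, neg_dvd]
          exact dvd_prod_of_mem (fun j => (x j : ℤ) - x i₀) (mem_erase.mpr ⟨hj, mem_univ j⟩)
      _ = #W ^ Fintype.card ι := by simp [Fintype.card_piFinset]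
      _ ≤ _ := by gcongr
  calc #S ≤ (3 * D) ^ Fintype.card ι * #(Icc 1 N) :=
        card_le_mul_card_image_of_maps_to (f := fun x => x i₀) (fun x hx => (hS x hx).1 i₀) _
          fun v _ => key v
    _ = _ := by simp

/-- The nondegenerate count with six terms, if the numerators do not all drop degree. -/
theorem card_sq_le_of_exists_natDegree_eq_four {ι : Type*} [Fintype ι] [DecidableEq ι] {p : ℕ}
    [Fact p.Prime] {a : ZMod p} {N D : ℕ} {m : ι → ℤ} (hN : 0 < N)
    (ha : ∀ v ∈ Icc 1 N, a + (v : ZMod p) ≠ 0)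
    (hι : Fintype.card ι = 6) (hm : ∀ i, (m i).natAbs ≤ 6) (hm0 : ∀ i, m i ≠ 0)
    (hmsum : ∑ i, m i = 0) (hD : ∀ n : ℕ, n ≠ 0 → n ≤ 6 * N ^ 5 → #n.divisors ≤ D)
    (hp : 10 ^ 40 * N ^ 20 < p) (S : Finset (ι → ℕ)) (hS : ∀ x ∈ S, IsSol p a N m x)
    (hdeg : ∃ x ∈ S, (numer m x).natDegree = 4) :
    #S ^ 2 ≤ 2 ^ 60 * D ^ 228 * N ^ 6 := by
  have hD1 := one_le_of_card_divisors_le hN (by norm_num) hD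
  have hι0 : Nonempty ι := Fintype.card_pos_iff.mp (by omega)
  have hdeg4 (x) : (numer m x).natDegree ≤ 4 := by
    have := natDegree_numer_lt m x hmsum (by omega)
    omega
  have hw (x) (hx : x ∈ S) : WeightLE N 1152 5 (numer m x) := by
    have := (hS x hx).weightLE hm (by omega)
    rwa [hι] at this
  obtain ⟨x₀, hx₀, hx4⟩ := hdeg
  by_cases hco : ∃ x ∈ S, IsCoprime ((numer m x₀).map (Int.castRingHom ℚ))
      ((numer m x).map (Int.castRingHom ℚ))
  · obtain ⟨x, hx, hco⟩ := hco
    have hT := card_le_of_isCoprime hN (S.image (numer m)) a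
      (by simp only [mem_image]; rintro _ ⟨x, -, rfl⟩; exact hdeg4 x)
      (by simp only [mem_image]; rintro _ ⟨x, hx, rfl⟩; exact hw x hx)
      (by simp only [mem_image]; rintro _ ⟨x, hx, rfl⟩; exact (hS x hx).eval_numer ha)
      hp (numer m x₀) (mem_image_of_mem _ hx₀) hx4 ⟨_, mem_image_of_mem _ hx, hco⟩
    have hfib : #S ≤ ((3 * D) ^ 6 * N) * #(S.image (numer m)) := by
      refine card_le_mul_card_image S _ fun f _ => ?_
      have := card_le_of_numer_eq hm hm0 hD1 (fun n h0 h1 => hD n h0 (by rwa [hι] at h1))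
        (S.filter fun x => numer m x = f)
        (fun x hx => ⟨(hS x (mem_filter.mp hx).1).1, (hS x (mem_filter.mp hx).1).2.1⟩) f
        (fun x hx => (mem_filter.mp hx).2)
      rwa [hι] at this
    calc #S ^ 2 ≤ (((3 * D) ^ 6 * N) * (10 ^ 4 * N ^ 2)) ^ 2 := by
          gcongr
          exact hfib.trans (Nat.mul_le_mul_left _ hT)
      _ = (3 ^ 12 * 10 ^ 8) * D ^ 12 * N ^ 6 := by ring
      _ ≤ 2 ^ 60 * D ^ 228 * N ^ 6 := by
          gcongr
          · norm_num
          · norm_num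
  · push Not at hco
    have h1 := card_sq_le_of_forall_not_isCoprime (D := D) (N := N) hm hm0
      (fun n h0 h1 => hD n h0 (by rwa [hι] at h1)) (numer m x₀) ((hS x₀ hx₀).numer_ne_zero hm0)
      hx4.le S fun x hx => ⟨(hS x hx).1, (hS x hx).2.1, hco x hx⟩
    refine (h1.trans (count_bound (by omega) le_rfl hD1)).trans ?_
    rw [hι]
    gcongr <;> norm_num

/-- The signs in `1 / x₀ + 1 / x₁ + 1 / x₂ = 1 / x₃ + 1 / x₄ + 1 / x₅`. -/
def signs : Fin 6 → ℤ := ![1, 1, 1, -1, -1, -1]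

open Polynomial in
lemma sum_eq_of_natDegree_numer_ne_four {x : Fin 6 → ℕ} (h : (numer signs x).natDegree ≠ 4) :
    (x 0 : ℤ) + x 1 + x 2 = x 3 + x 4 + x 5 := by
  have h1 : (numer signs x).coeff 4 = 0 := by
    have h2 := natDegree_numer_lt signs x (by simp [signs, Fin.sum_univ_six]) (by simp)
    rw [Fintype.card_fin] at h2
    exact coeff_eq_zero_of_natDegree_lt (by omega)
  have h3 (i : Fin 6) : (∏ j ∈ univ.erase i, (X + C (x j : ℤ))).coeff 4 =
      ∑ j, (x j : ℤ) - x i := by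
    have hc : #(univ.erase i) = 5 := by rw [card_erase_of_mem (mem_univ i)]; simp
    rw [prod_X_add_C_coeff _ _ (by omega), hc, ← sum_erase_eq_sub (mem_univ i)]
    simp [powersetCard_one]
  rw [numer, finsetSum_coeff] at h1
  simp only [coeff_C_mul, h3, signs, Fin.sum_univ_six] at h1
  simp at h1
  linarith

/-- The difference of the second elementary symmetric functions. -/
def symmTwo (x : Fin 6 → ℕ) : ℤ :=
  x 0 * x 1 + x 0 * x 2 + x 1 * x 2 - (x 3 * x 4 + x 3 * x 5 + x 4 * x 5)

/-- The difference of the third elementary symmetric functions. -/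
def symmThree (x : Fin 6 → ℕ) : ℤ := x 0 * x 1 * x 2 - x 3 * x 4 * x 5

lemma abs_symmTwo_le {x : Fin 6 → ℕ} {N : ℕ} (hx : ∀ i, x i ≤ N) :
    |symmTwo x| ≤ 3 * (N : ℤ) ^ 2 := by
  have h (i j : Fin 6) : (x i : ℤ) * x j ≤ N ^ 2 := by
    have := Nat.mul_le_mul (hx i) (hx j)
    rw [sq]; exact_mod_cast this
  have h' (i j : Fin 6) : 0 ≤ (x i : ℤ) * x j := by positivity
  have := h 0 1; have := h 0 2; have := h 1 2; have := h 3 4; have := h 3 5; have := h 4 5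
  have := h' 0 1; have := h' 0 2; have := h' 1 2; have := h' 3 4; have := h' 3 5
  have := h' 4 5
  rw [abs_le, symmTwo]
  constructor <;> linarith

lemma abs_symmThree_le {x : Fin 6 → ℕ} {N : ℕ} (hx : ∀ i, x i ≤ N) :
    |symmThree x| ≤ (N : ℤ) ^ 3 := by
  have h (i j k : Fin 6) : (x i : ℤ) * x j * x k ≤ N ^ 3 := by
    have := Nat.mul_le_mul (Nat.mul_le_mul (hx i) (hx j)) (hx k)
    rw [pow_succ, sq]; exact_mod_cast this
  have h' (i j k : Fin 6) : 0 ≤ (x i : ℤ) * x j * x k := by positivity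
  have := h 0 1 2; have := h 3 4 5; have := h' 0 1 2; have := h' 3 4 5
  rw [abs_le, symmThree]
  constructor <;> linarith

lemma symmTwo_mul_sub {x : Fin 6 → ℕ} (h : (x 0 : ℤ) + x 1 + x 2 = x 3 + x 4 + x 5) (i : Fin 6)
    (hi : i < 3) : symmTwo x * x i - symmThree x =
      ((x 3 : ℤ) - x i) * ((x 4 : ℤ) - x i) * ((x 5 : ℤ) - x i) := by
  rw [symmTwo, symmThree]
  have h5 : (x 5 : ℤ) = x 0 + x 1 + x 2 - x 3 - x 4 := by linarith
  fin_cases i <;> simp at hi ⊢ <;> rw [h5] <;> ring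

/-- The basic congruence for a solution whose numerator drops degree. -/
lemma mul_symm_eq {p : ℕ} [Fact p.Prime] {a : ZMod p} {N : ℕ}
    (ha : ∀ v ∈ Icc 1 N, a + (v : ZMod p) ≠ 0) {x : Fin 6 → ℕ} (hx : IsSol p a N signs x)
    (h : (x 0 : ℤ) + x 1 + x 2 = x 3 + x 4 + x 5) :
    ((a + x 0) * (a + x 1) + (a + x 2) * (2 * a + x 0 + x 1)) * (symmTwo x * a + symmThree x) =
      symmTwo x * ((a + x 0) * (a + x 1) * (a + x 2)) := by
  have h0 := ha _ (hx.1 0); have h1 := ha _ (hx.1 1); have h2 := ha _ (hx.1 2)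
  have h3 := ha _ (hx.1 3); have h4 := ha _ (hx.1 4); have h5 := ha _ (hx.1 5)
  have hsum := hx.2.2
  have he : (x 5 : ZMod p) = x 0 + x 1 + x 2 - x 3 - x 4 := by
    have : (((x 5 : ℤ) : ZMod p)) = ((x 0 + x 1 + x 2 - x 3 - x 4 : ℤ) : ZMod p) := by
      congr 1; linarith
    push_cast at this
    exact this
  simp [signs, Fin.sum_univ_six] at hsum
  field_simp at hsum
  simp only [symmTwo, symmThree]
  push_cast
  rw [he] at hsum ⊢
  linear_combination -hsum

lemma abs_lt_of_pow_lt {p N : ℕ} (hp : 10 ^ 40 * N ^ 20 < p) (hN : 0 < N) {z : ℤ} {k : ℕ}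
    (hk : k ≤ 20) (hz : |z| ≤ 100 * (N : ℤ) ^ k) : |z| < p := by
  have h1 : (N : ℤ) ^ k ≤ N ^ 20 := by
    exact_mod_cast Nat.pow_le_pow_right hN hk
  have h2 : (10 ^ 40 * N ^ 20 : ℤ) < p := by exact_mod_cast hp
  have h3 : (0 : ℤ) < N ^ 20 := by positivity
  linarith

/-- Solutions for which the first two elementary symmetric functions agree. -/
lemma card_le_of_symmTwo_eq_zero {p : ℕ} [Fact p.Prime] {a : ZMod p} {N : ℕ} (hN : 0 < N)
    (ha : ∀ v ∈ Icc 1 N, a + (v : ZMod p) ≠ 0) (hp : 10 ^ 40 * N ^ 20 < p)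
    (S : Finset (Fin 6 → ℕ)) (hS : ∀ x ∈ S, IsSol p a N signs x ∧
      (x 0 : ℤ) + x 1 + x 2 = x 3 + x 4 + x 5 ∧ symmTwo x = 0) :
    #S ≤ 2 * N ^ 3 := by
  have hNp : N < p := by
    have : N ^ 1 ≤ N ^ 20 := Nat.pow_le_pow_right hN (by norm_num)
    rw [pow_one] at this
    omega
  have key (x) (hx : x ∈ S) :
      (a + x 0) * (a + x 1) + (a + x 2) * (2 * a + x 0 + x 1) = 0 := by
    obtain ⟨h1, h2, h3⟩ := hS x hx
    have h4 := mul_symm_eq ha h1 h2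
    rw [h3, Int.cast_zero, zero_mul, zero_mul, zero_add, mul_eq_zero] at h4
    refine h4.resolve_right fun h5 => ?_
    have h6 := symmTwo_mul_sub h2 0 (by simp)
    rw [ZMod.intCast_zmod_eq_zero_iff_dvd] at h5
    have h7 := Int.eq_zero_of_abs_lt_dvd h5 (abs_lt_of_pow_lt hp hN (k := 3) (by simp)
      ((abs_symmThree_le h1.le).trans (by
        have : (0 : ℤ) ≤ N ^ 3 := by positivity
        linarith)))
    rw [h3, h7, zero_mul, sub_zero, eq_comm, mul_eq_zero, mul_eq_zero, sub_eq_zero, sub_eq_zero,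
      sub_eq_zero] at h6
    rcases h6 with (h6 | h6) | h6
    · exact absurd (h1.2.1 (Int.ofNat_inj.mp h6)) (by decide)
    · exact absurd (h1.2.1 (Int.ofNat_inj.mp h6)) (by decide)
    · exact absurd (h1.2.1 (Int.ofNat_inj.mp h6)) (by decide)
  calc #S ≤ #((Icc 1 N ×ˢ Icc 1 N) ×ˢ (Icc 1 N ×ˢ (univ : Finset Bool))) := by
        refine card_le_card_of_injOn (fun x => ((x 0, x 1), (x 3, decide (x 4 < x 5)))) ?_ ?_
        · intro x hx
          have h1 := (hS x hx).1.1
          simp only [coe_product, Set.mem_prod, mem_coe]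
          exact ⟨⟨h1 0, h1 1⟩, h1 3, mem_univ _⟩
        · intro x hx y hy hxy
          rw [mem_coe] at hx hy
          simp only [Prod.mk.injEq, decide_eq_decide] at hxy
          obtain ⟨⟨e0, e1⟩, e3, e45⟩ := hxy
          obtain ⟨hx1, hx2, hx3⟩ := hS x hx
          obtain ⟨hy1, hy2, hy3⟩ := hS y hy
          have hkx := key x hx
          have hky := key y hy
          have e2 : x 2 = y 2 := by
            have h1 : 2 * a + x 0 + x 1 ≠ 0 := by
              intro h0
              rw [h0, mul_zero, add_zero] at hkx
              exact mul_ne_zero (ha _ (hx1.1 0)) (ha _ (hx1.1 1)) hkx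
            rw [← e0, ← e1] at hky
            have h2 : ((x 2 : ZMod p) - y 2) * (2 * a + x 0 + x 1) = 0 := by
              linear_combination hkx - hky
            have h3 := sub_eq_zero.mp ((mul_eq_zero.mp h2).resolve_right h1)
            have h4 := (ZMod.natCast_eq_natCast_iff' _ _ _).mp h3
            rwa [Nat.mod_eq_of_lt ((hx1.le 2).trans_lt hNp),
              Nat.mod_eq_of_lt ((hy1.le 2).trans_lt hNp)] at h4
          rw [e0, e1, e2, e3] at hx2
          simp only [symmTwo] at hx3 hy3
          rw [e0, e1, e2, e3] at hx3
          have hs : (x 4 : ℤ) + x 5 = y 4 + y 5 := by linarith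
          have hpr : (x 4 : ℤ) * x 5 = y 4 * y 5 := by linear_combination hy3 - hx3 - (y 3 : ℤ) * hs
          have h4 : ((x 4 : ℤ) - y 4) * (x 4 - y 5) = 0 := by
            linear_combination (x 4 : ℤ) * hs - hpr
          have e4 : x 4 = y 4 := by
            rcases mul_eq_zero.mp h4 with h | h
            · omega
            · have : x 4 ≠ x 5 := fun h => absurd (hx1.2.1 h) (by decide)
              omega
          have e5 : x 5 = y 5 := by omega
          funext i
          fin_cases i <;> assumption
    _ = 2 * N ^ 3 := by
        simp only [card_product, Nat.card_Icc, card_univ, Fintype.card_bool, Nat.add_sub_cancel]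
        ring

/-- Solutions for which the first elementary symmetric functions agree and the second differ. -/
lemma card_le_of_symmTwo_ne_zero {p : ℕ} [Fact p.Prime] {a : ZMod p} {N D : ℕ} (hN : 0 < N)
    (ha : ∀ v ∈ Icc 1 N, a + (v : ZMod p) ≠ 0) (hp : 10 ^ 40 * N ^ 20 < p)
    (hD : ∀ n : ℕ, n ≠ 0 → n ≤ 6 * N ^ 9 → #n.divisors ≤ D)
    (S : Finset (Fin 6 → ℕ)) (hS : ∀ x ∈ S, IsSol p a N signs x ∧
      (x 0 : ℤ) + x 1 + x 2 = x 3 + x 4 + x 5 ∧ symmTwo x ≠ 0) :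
    #S ≤ (2 * D) ^ 3 * N ^ 3 := by
  have hcross (x) (hx : x ∈ S) (y) (hy : y ∈ S) (e0 : x 0 = y 0) (e1 : x 1 = y 1)
      (e2 : x 2 = y 2) : symmTwo x * symmThree y = symmTwo y * symmThree x := by
    obtain ⟨hx1, hx2, hx3⟩ := hS x hx
    obtain ⟨hy1, hy2, hy3⟩ := hS y hy
    have h1 := mul_symm_eq ha hx1 hx2
    have h2 := mul_symm_eq ha hy1 hy2
    rw [← e0, ← e1, ← e2] at h2
    set A : ZMod p := (a + x 0) * (a + x 1) * (a + x 2) with hA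
    set A' : ZMod p := (a + x 0) * (a + x 1) + (a + x 2) * (2 * a + x 0 + x 1) with hA'
    have hA0 : A ≠ 0 := mul_ne_zero (mul_ne_zero (ha _ (hx1.1 0)) (ha _ (hx1.1 1))) (ha _ (hx1.1 2))
    have hA'0 : A' ≠ 0 := by
      intro h0
      rw [h0, zero_mul, eq_comm] at h1
      have h3 := (mul_eq_zero.mp h1).resolve_right hA0
      rw [ZMod.intCast_zmod_eq_zero_iff_dvd] at h3
      exact hx3 (Int.eq_zero_of_abs_lt_dvd h3 (abs_lt_of_pow_lt hp hN (k := 2) (by simp)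
        ((abs_symmTwo_le hx1.le).trans (by
          have : (0 : ℤ) ≤ N ^ 2 := by positivity
          linarith))))
    have h3 : A' * ((symmTwo x * symmThree y - symmTwo y * symmThree x : ℤ) : ZMod p) = 0 := by
      push_cast
      linear_combination (symmTwo x : ZMod p) * h2 - (symmTwo y : ZMod p) * h1
    have h4 := (mul_eq_zero.mp h3).resolve_left hA'0
    rw [ZMod.intCast_zmod_eq_zero_iff_dvd] at h4
    refine sub_eq_zero.mp (Int.eq_zero_of_abs_lt_dvd h4
      (abs_lt_of_pow_lt hp hN (k := 5) (by simp) ?_))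
    have hb (x y : Fin 6 → ℕ) (hx : ∀ i, x i ≤ N) (hy : ∀ i, y i ≤ N) :
        |symmTwo x * symmThree y| ≤ 3 * (N : ℤ) ^ 5 := by
      rw [abs_mul]
      calc |symmTwo x| * |symmThree y| ≤ (3 * (N : ℤ) ^ 2) * (N : ℤ) ^ 3 := by
            gcongr
            · exact abs_symmTwo_le hx
            · exact abs_symmThree_le hy
        _ = _ := by ring
    have h5 := hb x y hx1.le hy1.le
    have h6 := hb y x hy1.le hx1.le
    have h7 := abs_sub (symmTwo x * symmThree y) (symmTwo y * symmThree x)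
    have : (0 : ℤ) ≤ N ^ 5 := by positivity
    linarith
  have hfib (c : ℕ × ℕ × ℕ) : #(S.filter fun x => (x 0, x 1, x 2) = c) ≤ (2 * D) ^ 3 := by
    rcases (S.filter fun x => (x 0, x 1, x 2) = c).eq_empty_or_nonempty with h | ⟨y, hy⟩
    · simp [h]
    obtain ⟨hyS, rfl⟩ := mem_filter.mp hy
    obtain ⟨hy1, hy2, hy3⟩ := hS y hyS
    set K : ℤ := (symmTwo y * y 0 - symmThree y) * (symmTwo y * y 1 - symmThree y) *
      (symmTwo y * y 2 - symmThree y) with hK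
    have hterm (i : Fin 6) (hi : i < 3) : symmTwo y * y i - symmThree y ≠ 0 ∧
        |symmTwo y * y i - symmThree y| ≤ (N : ℤ) ^ 3 := by
      rw [symmTwo_mul_sub hy2 i hi]
      have hne (j : Fin 6) (hj : j ≠ i) : (y j : ℤ) - y i ≠ 0 := by
        rw [sub_ne_zero]
        exact fun h => hj (hy1.2.1 (Int.ofNat_inj.mp h))
      have hle (j : Fin 6) : |(y j : ℤ) - y i| ≤ N := by
        have := hy1.le j; have := hy1.le i
        rw [abs_le]; constructor <;> omega
      refine ⟨mul_ne_zero (mul_ne_zero (hne 3 ?_) (hne 4 ?_)) (hne 5 ?_), ?_⟩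
      · rintro rfl; simp at hi
      · rintro rfl; simp at hi
      · rintro rfl; simp at hi
      · rw [abs_mul, abs_mul]
        calc _ ≤ (N : ℤ) * N * N := by gcongr <;> exact hle _
          _ = _ := by ring
    have hK0 : K ≠ 0 := mul_ne_zero (mul_ne_zero (hterm 0 (by simp)).1 (hterm 1 (by simp)).1)
      (hterm 2 (by simp)).1
    have hKle : K.natAbs ≤ 6 * N ^ 9 := by
      zify
      rw [hK, abs_mul, abs_mul]
      calc _ ≤ (N : ℤ) ^ 3 * N ^ 3 * N ^ 3 := by
            gcongr
            · exact (hterm 0 (by simp)).2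
            · exact (hterm 1 (by simp)).2
            · exact (hterm 2 (by simp)).2
        _ = 1 * (N : ℤ) ^ 9 := by ring
        _ ≤ _ := by gcongr; norm_num
    set W : Finset ℕ := K.natAbs.divisors.biUnion fun d =>
      (Icc 1 N).filter fun w : ℕ => (symmTwo y * w - symmThree y).natAbs = d with hW
    have hWc : #W ≤ 2 * D := by
      have h1 (d : ℕ) :
          #((Icc 1 N).filter fun w : ℕ => (symmTwo y * w - symmThree y).natAbs = d) ≤ 2 := by
        have hdeg : (Polynomial.C (-symmTwo y) * Polynomial.X +
            Polynomial.C (-symmThree y)).natDegree = 1 :=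
          Polynomial.natDegree_linear (neg_ne_zero.mpr hy3)
        have := card_filter_natAbs_eval_eq_le _ hdeg.ge (Icc 1 N) d
        rw [hdeg] at this
        simpa [← sub_eq_add_neg] using this
      calc #W ≤ #K.natAbs.divisors * 2 := card_biUnion_le_card_mul _ _ _ fun d _ => h1 d
        _ ≤ D * 2 := by gcongr; exact hD _ (Int.natAbs_ne_zero.mpr hK0) hKle
        _ = _ := mul_comm _ _
    calc #(S.filter fun x => (x 0, x 1, x 2) = (y 0, y 1, y 2)) ≤ #(W ×ˢ W ×ˢ W) := by
          refine card_le_card_of_injOn (fun x => (x 3, x 4, x 5)) ?_ ?_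
          · intro x hx
            obtain ⟨hxS, hxy⟩ := mem_filter.mp (mem_coe.mp hx)
            simp only [Prod.mk.injEq] at hxy
            obtain ⟨e0, e1, e2⟩ := hxy
            obtain ⟨hx1, hx2, hx3⟩ := hS x hxS
            have hc := hcross x hxS y hyS e0 e1 e2
            have hprod : K = (symmTwo y * x 3 - symmThree y) * (symmTwo y * x 4 - symmThree y) *
                (symmTwo y * x 5 - symmThree y) := by
              rw [hK, ← e0, ← e1, ← e2]
              have h2 : symmTwo y ^ 2 * ((symmTwo y * (x 0 * x 1 * x 2 - x 3 * x 4 * x 5)) -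
                  (symmThree y * symmTwo x)) = 0 := by
                rw [symmThree] at hc
                rw [show (x 0 * x 1 * x 2 - x 3 * x 4 * x 5 : ℤ) = symmThree x from rfl]
                rw [show (y 0 * y 1 * y 2 - y 3 * y 4 * y 5 : ℤ) = symmThree y from rfl] at hc
                linear_combination -symmTwo y ^ 2 * hc
              rw [show symmTwo x = x 0 * x 1 + x 0 * x 2 + x 1 * x 2 -
                (x 3 * x 4 + x 3 * x 5 + x 4 * x 5) from rfl] at h2
              linear_combination h2 + symmTwo y * symmThree y ^ 2 * hx2
            have hmem (j : Fin 6) (hj : symmTwo y * x j - symmThree y ∣ K) : x j ∈ W :=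
              mem_biUnion.mpr ⟨_, Nat.mem_divisors.mpr
                ⟨Int.natAbs_dvd_natAbs.mpr hj, Int.natAbs_ne_zero.mpr hK0⟩,
                mem_filter.mpr ⟨hx1.1 j, rfl⟩⟩
            simp only [coe_product, Set.mem_prod, mem_coe]
            refine ⟨hmem 3 ?_, hmem 4 ?_, hmem 5 ?_⟩ <;> rw [hprod]
            · exact (Dvd.intro _ rfl).mul_right _
            · exact (Dvd.intro_left _ rfl).mul_right _
            · exact Dvd.intro_left _ rfl
          · intro x hx z hz hxz
            have hx' := (mem_filter.mp (mem_coe.mp hx)).2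
            have hz' := (mem_filter.mp (mem_coe.mp hz)).2
            simp only [Prod.mk.injEq] at hx' hz' hxz
            funext i
            fin_cases i
            · exact hx'.1.trans hz'.1.symm
            · exact hx'.2.1.trans hz'.2.1.symm
            · exact hx'.2.2.trans hz'.2.2.symm
            · exact hxz.1
            · exact hxz.2.1
            · exact hxz.2.2
      _ = #W ^ 3 := by simp only [card_product]; ring
      _ ≤ _ := by gcongr
  calc #S ≤ (2 * D) ^ 3 * #(Icc 1 N ×ˢ Icc 1 N ×ˢ Icc 1 N) :=
        card_le_mul_card_image_of_maps_to (f := fun x => (x 0, x 1, x 2)) (fun x hx => by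
          have h1 := (hS x hx).1.1
          simp only [mem_product]
          exact ⟨h1 0, h1 1, h1 2⟩) _ fun c _ => hfib c
    _ = _ := by
        simp only [card_product, Nat.card_Icc, Nat.add_sub_cancel]
        ring

/-- The nondegenerate count with six terms. -/
theorem card_sq_le_signs {p : ℕ} [Fact p.Prime] {a : ZMod p} {N D : ℕ} (hN : 0 < N)
    (ha : ∀ v ∈ Icc 1 N, a + (v : ZMod p) ≠ 0) (hp : 10 ^ 40 * N ^ 20 < p)
    (hD : ∀ n : ℕ, n ≠ 0 → n ≤ 6 * N ^ 9 → #n.divisors ≤ D)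
    (S : Finset (Fin 6 → ℕ)) (hS : ∀ x ∈ S, IsSol p a N signs x) :
    #S ^ 2 ≤ 2 ^ 60 * D ^ 228 * N ^ 6 := by
  have hD1 := one_le_of_card_divisors_le hN (by norm_num) hD
  by_cases hdeg : ∃ x ∈ S, (numer signs x).natDegree = 4
  · refine card_sq_le_of_exists_natDegree_eq_four hN ha (by simp) ?_ ?_ ?_
      (fun n h0 h1 => hD n h0 (h1.trans ?_)) hp S hS hdeg
    · intro i; fin_cases i <;> simp [signs]
    · intro i; fin_cases i <;> simp [signs]
    · simp [signs, Fin.sum_univ_six]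
    · gcongr
      norm_num
  · push Not at hdeg
    have h0 := card_le_of_symmTwo_eq_zero hN ha hp (S.filter fun x => symmTwo x = 0) fun x hx =>
      ⟨hS x (mem_filter.mp hx).1, sum_eq_of_natDegree_numer_ne_four (hdeg x (mem_filter.mp hx).1),
        (mem_filter.mp hx).2⟩
    have h1 := card_le_of_symmTwo_ne_zero hN ha hp hD (S.filter fun x => ¬ symmTwo x = 0)
      fun x hx => ⟨hS x (mem_filter.mp hx).1,
        sum_eq_of_natDegree_numer_ne_four (hdeg x (mem_filter.mp hx).1), (mem_filter.mp hx).2⟩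
    have h2 : #S ≤ 10 * D ^ 3 * N ^ 3 := by
      rw [← card_filter_add_card_filter_not (s := S) fun x => symmTwo x = 0]
      have : 1 ≤ D ^ 3 := Nat.one_le_pow _ _ hD1
      calc _ ≤ 2 * N ^ 3 + (2 * D) ^ 3 * N ^ 3 := add_le_add h0 h1
        _ ≤ 2 * D ^ 3 * N ^ 3 + (2 * D) ^ 3 * N ^ 3 := by gcongr; omega
        _ = _ := by ring
    calc #S ^ 2 ≤ (10 * D ^ 3 * N ^ 3) ^ 2 := by gcongr
      _ = 10 ^ 2 * D ^ 6 * N ^ 6 := by ring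
      _ ≤ 2 ^ 60 * D ^ 228 * N ^ 6 := Nat.mul_le_mul
          (Nat.mul_le_mul (by norm_num) (Nat.pow_le_pow_right hD1 (by norm_num))) le_rfl

/-- The solutions of `1 / y₀ + 1 / y₁ + 1 / y₂ = 1 / y₃ + 1 / y₄ + 1 / y₅` in an interval. -/
def sixfold (p : ℕ) (a : ZMod p) (N : ℕ) : Finset (Fin 6 → ℕ) :=
  (Fintype.piFinset fun _ => Icc 1 N).filter fun x =>
    ∑ i, (signs i : ZMod p) * (a + x i)⁻¹ = 0

lemma signs_ne_zero (i : Fin 6) : signs i ≠ 0 := by fin_cases i <;> simp [signs]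

lemma natAbs_signs (i : Fin 6) : (signs i).natAbs = 1 := by fin_cases i <;> simp [signs]

lemma sum_signs : ∑ i, signs i = 0 := by simp [signs, Fin.sum_univ_six]

/-- A choice of representatives for the classes of equal coordinates. -/
noncomputable def rep (x : Fin 6 → ℕ) (i : Fin 6) : Fin 6 := Function.invFun x (x i)

lemma apply_rep (x : Fin 6 → ℕ) (i : Fin 6) : x (rep x i) = x i :=
  Function.invFun_eq ⟨i, rfl⟩

lemma rep_rep (x : Fin 6 → ℕ) (i : Fin 6) : rep x (rep x i) = rep x i := by
  change Function.invFun x (x (rep x i)) = rep x i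
  rw [apply_rep x i, rep]

/-- The multiplicity of a class of equal coordinates. -/
def mult (ρ : Fin 6 → Fin 6) (c : Fin 6) : ℤ := ∑ i with ρ i = c, signs i

lemma card_add_two_mul_card_le (ρ : Fin 6 → Fin 6) :
    #{c | ρ c = c ∧ mult ρ c ≠ 0} + 2 * #{c | ρ c = c ∧ mult ρ c = 0} ≤ 6 := by
  have h1 (c : Fin 6) : (if ρ c = c ∧ mult ρ c ≠ 0 then 1 else 0) +
      2 * (if ρ c = c ∧ mult ρ c = 0 then 1 else 0) ≤ #{i | ρ i = c} := by
    by_cases hc : ρ c = c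
    · have hmem : c ∈ ({i | ρ i = c} : Finset (Fin 6)) := by simp [hc]
      have h1 : 1 ≤ #{i | ρ i = c} := card_pos.mpr ⟨c, hmem⟩
      by_cases hm : mult ρ c = 0
      · have h2 : #{i | ρ i = c} ≠ 1 := by
          intro h2
          obtain ⟨d, hd⟩ := card_eq_one.mp h2
          rw [mult, hd, sum_singleton] at hm
          exact signs_ne_zero d hm
        simp [hc, hm]; omega
      · simpa [hc, hm] using h1
    · simp [hc]
  calc _ = ∑ c, ((if ρ c = c ∧ mult ρ c ≠ 0 then 1 else 0) +
      2 * (if ρ c = c ∧ mult ρ c = 0 then 1 else 0)) := by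
        rw [sum_add_distrib, ← mul_sum, card_filter, card_filter]
    _ ≤ ∑ c, #{i | ρ i = c} := sum_le_sum fun c _ => h1 c
    _ = 6 := by
        rw [← card_eq_sum_card_fiberwise (fun _ _ => mem_coe.mpr (mem_univ _))]
        simp

lemma natAbs_mult_le (ρ : Fin 6 → Fin 6) (c : Fin 6) : (mult ρ c).natAbs ≤ 6 := by
  rw [mult]
  calc _ ≤ ∑ i with ρ i = c, (signs i).natAbs := Int.natAbs_sum_le _ _
    _ = #{i | ρ i = c} := by simp [natAbs_signs]
    _ ≤ #(univ : Finset (Fin 6)) := card_le_card (subset_univ _)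
    _ = 6 := by simp

/-- Grouping equal coordinates. -/
lemma sum_signs_mul {R : Type*} [CommRing R] (ρ : Fin 6 → Fin 6) (hρ : ∀ i, ρ (ρ i) = ρ i)
    (f : Fin 6 → R) (hf : ∀ i, f (ρ i) = f i) :
    ∑ i, (signs i : R) * f i =
      ∑ c : {c // ρ c = c ∧ mult ρ c ≠ 0}, (mult ρ c : R) * f c := by
  rw [← sum_subtype (univ.filter fun c => ρ c = c ∧ mult ρ c ≠ 0) (by simp)
    (fun c => (mult ρ c : R) * f c)]
  have h1 : ∑ i, (signs i : R) * f i = ∑ c, (mult ρ c : R) * f c := by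
    rw [← sum_fiberwise univ ρ]
    refine sum_congr rfl fun c _ => ?_
    rw [mult, Int.cast_sum, sum_mul]
    refine sum_congr rfl fun i hi => ?_
    rw [← (mem_filter.mp hi).2, hf]
  rw [h1, sum_filter]
  refine sum_congr rfl fun c _ => ?_
  split_ifs with h
  · rfl
  · rw [not_and_or, not_not] at h
    rcases h with h | h
    · rw [mult, sum_eq_zero, Int.cast_zero, zero_mul]
      intro i hi
      exact absurd (by rw [← (mem_filter.mp hi).2, hρ]) h
    · rw [h, Int.cast_zero, zero_mul]

lemma card_sq_le_of_rep_eq {p : ℕ} [Fact p.Prime] {a : ZMod p} {N D : ℕ} (hN : 0 < N)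
    (ha : ∀ v ∈ Icc 1 N, a + (v : ZMod p) ≠ 0) (hp : 10 ^ 40 * N ^ 20 < p)
    (hD : ∀ n : ℕ, n ≠ 0 → n ≤ 6 * N ^ 9 → #n.divisors ≤ D) (ρ : Fin 6 → Fin 6) :
    #((sixfold p a N).filter fun x => rep x = ρ) ^ 2 ≤ 2 ^ 60 * D ^ 228 * N ^ 6 := by
  have hsol (x) (hx : x ∈ (sixfold p a N).filter fun x => rep x = ρ) :
      (∀ i, x i ∈ Icc 1 N) ∧ ∑ i, (signs i : ZMod p) * (a + x i)⁻¹ = 0 ∧ rep x = ρ := by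
    obtain ⟨h1, h2⟩ := mem_filter.mp hx
    obtain ⟨h3, h4⟩ := mem_filter.mp h1
    exact ⟨fun i => Fintype.mem_piFinset.mp h3 i, h4, h2⟩
  rcases ((sixfold p a N).filter fun x => rep x = ρ).eq_empty_or_nonempty with h0 | ⟨y, hy⟩
  · rw [h0]; simp
  have hρ (i) : ρ (ρ i) = ρ i := by rw [← (hsol y hy).2.2]; exact rep_rep y i
  have hinj (x) (hx : x ∈ (sixfold p a N).filter fun x => rep x = ρ) (c d : Fin 6)
      (hc : ρ c = c) (hd : ρ d = d) (h : x c = x d) : c = d := by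
    rw [← hc, ← hd, ← (hsol x hx).2.2, rep, rep, h]
  by_cases hid : ∀ i, ρ i = i
  · refine card_sq_le_signs hN ha hp hD _ fun x hx => ⟨(hsol x hx).1, ?_, (hsol x hx).2.1⟩
    exact fun c d h => hinj x hx c d (hid c) (hid d) h
  set T := (sixfold p a N).filter fun x => rep x = ρ with hT
  have hcard := card_add_two_mul_card_le ρ
  have hS5 : #{c | ρ c = c ∧ mult ρ c ≠ 0} ≤ 5 := by
    push Not at hid
    obtain ⟨i, hi⟩ := hid
    have h1 : ({c | ρ c = c ∧ mult ρ c ≠ 0} : Finset (Fin 6)) ⊆ univ.erase i := by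
      intro c hc
      rw [mem_erase]
      refine ⟨?_, mem_univ _⟩
      rintro rfl
      exact hi (mem_filter.mp hc).2.1
    calc _ ≤ #(univ.erase i) := card_le_card h1
      _ = 5 := by rw [card_erase_of_mem (mem_univ i)]; simp
  rw [← Fintype.card_subtype, ← Fintype.card_subtype] at hcard
  rw [← Fintype.card_subtype] at hS5
  set U : Finset ({c // ρ c = c ∧ mult ρ c ≠ 0} → ℕ) := T.image fun x c => x c with hU
  have hUsol : #U ^ 2 ≤ 2 ^ 40 * D ^ 228 * N ^ Fintype.card {c // ρ c = c ∧ mult ρ c ≠ 0} := by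
    refine card_sq_le_of_card_le_five (m := fun c : {c // ρ c = c ∧ mult ρ c ≠ 0} => mult ρ c)
      hN ha hS5
      (fun c => natAbs_mult_le ρ c) (fun c => c.2.2) ?_
      (fun n h0 h1 => hD n h0 (h1.trans ?_)) hp U ?_
    · have := sum_signs_mul ρ hρ (fun _ => (1 : ℤ)) (fun _ => rfl)
      simp only [mul_one, Int.cast_id, sum_signs] at this
      exact this.symm
    · gcongr
      norm_num
    · intro z hz
      obtain ⟨x, hx, rfl⟩ := mem_image.mp hz
      refine ⟨fun c => (hsol x hx).1 c, fun c d h => Subtype.ext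
        (hinj x hx c d c.2.1 d.2.1 h), ?_⟩
      rw [← sum_signs_mul ρ hρ (fun i => (a + (x i : ZMod p))⁻¹), (hsol x hx).2.1]
      intro i
      rw [← (hsol x hx).2.2]
      exact congrArg _ (congrArg _ (congrArg _ (apply_rep x i)))
  have hTU : #T ≤ N ^ Fintype.card {c // ρ c = c ∧ mult ρ c = 0} * #U := by
    calc #T ≤ #((Fintype.piFinset fun _ : {c // ρ c = c ∧ mult ρ c = 0} => Icc 1 N) ×ˢ U) := by
          refine card_le_card_of_injOn (fun x => (fun c => x c, fun c => x c)) ?_ ?_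
          · intro x hx
            simp only [coe_product, Set.mem_prod, mem_coe]
            exact ⟨Fintype.mem_piFinset.mpr fun c => (hsol x hx).1 c, mem_image_of_mem _ hx⟩
          · intro x hx z hz hxz
            simp only [Prod.mk.injEq] at hxz
            funext i
            have hxi : x (ρ i) = x i := by rw [← (hsol x hx).2.2]; exact apply_rep x i
            have hzi : z (ρ i) = z i := by rw [← (hsol z hz).2.2]; exact apply_rep z i
            rw [← hxi, ← hzi]
            by_cases hm : mult ρ (ρ i) = 0
            · exact congrFun hxz.1 ⟨ρ i, hρ i, hm⟩
            · exact congrFun hxz.2 ⟨ρ i, hρ i, hm⟩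
      _ = _ := by rw [card_product]; simp [Fintype.card_piFinset]
  generalize Fintype.card {c // ρ c = c ∧ mult ρ c ≠ 0} = s at *
  generalize Fintype.card {c // ρ c = c ∧ mult ρ c = 0} = z at *
  calc #T ^ 2 ≤ (N ^ z * #U) ^ 2 := by gcongr
    _ = #U ^ 2 * N ^ (2 * z) := by ring
    _ ≤ 2 ^ 40 * D ^ 228 * N ^ s * N ^ (2 * z) := by gcongr
    _ = 2 ^ 40 * D ^ 228 * N ^ (s + 2 * z) := by rw [pow_add]; ring
    _ ≤ 2 ^ 60 * D ^ 228 * N ^ 6 := Nat.mul_le_mul (Nat.mul_le_mul (by norm_num) le_rfl)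
        (Nat.pow_le_pow_right hN hcard)

theorem card_sixfold_sq_le {p : ℕ} [Fact p.Prime] {a : ZMod p} {N D : ℕ} (hN : 0 < N)
    (ha : ∀ v ∈ Icc 1 N, a + (v : ZMod p) ≠ 0) (hp : 10 ^ 40 * N ^ 20 < p)
    (hD : ∀ n : ℕ, n ≠ 0 → n ≤ 6 * N ^ 9 → #n.divisors ≤ D) :
    #(sixfold p a N) ^ 2 ≤ 2 ^ 100 * D ^ 228 * N ^ 6 := by
  obtain ⟨ρ, -, hρ⟩ := exists_max_image (univ : Finset (Fin 6 → Fin 6))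
    (fun ρ => #((sixfold p a N).filter fun x => rep x = ρ)) univ_nonempty
  have h1 : #(sixfold p a N) ≤ 6 ^ 6 * #((sixfold p a N).filter fun x => rep x = ρ) := by
    rw [card_eq_sum_card_fiberwise (f := rep) (t := univ) (fun _ _ => mem_coe.mpr (mem_univ _))]
    refine (sum_le_card_nsmul _ _ _ fun σ _ => hρ σ (mem_univ _)).trans ?_
    simp
  calc _ ≤ (6 ^ 6 * #((sixfold p a N).filter fun x => rep x = ρ)) ^ 2 := by gcongr
    _ = 6 ^ 12 * #((sixfold p a N).filter fun x => rep x = ρ) ^ 2 := by ring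
    _ ≤ 6 ^ 12 * (2 ^ 60 * D ^ 228 * N ^ 6) := by
        gcongr; exact card_sq_le_of_rep_eq hN ha hp hD ρ
    _ = 6 ^ 12 * 2 ^ 60 * D ^ 228 * N ^ 6 := by ring
    _ ≤ _ := by gcongr; norm_num

/-- The third energy of the inverses of an interval is essentially optimal. -/
theorem exists_card_sixfold_le (κ : ℝ) (hκ : 0 < κ) :
    ∃ C : ℝ, 1 ≤ C ∧ ∀ (p : ℕ) [Fact p.Prime] (a : ZMod p) (N : ℕ), 0 < N →
      (∀ v ∈ Icc 1 N, a + (v : ZMod p) ≠ 0) → 10 ^ 40 * N ^ 20 < p →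
        (#(sixfold p a N) : ℝ) ≤ C * (N : ℝ) ^ (3 + κ) := by
  obtain ⟨C, hC1, hC⟩ := exists_card_divisors_le (κ / 1026) (by positivity)
  set E : ℝ := 2 ^ 50 * (C * 6 ^ (κ / 1026)) ^ 114 with hE
  have h6 : (1 : ℝ) ≤ 6 ^ (κ / 1026) := Real.one_le_rpow (by norm_num) (by positivity)
  refine ⟨E, ?_, fun p _ a N hN ha hp => ?_⟩
  · have : 1 ≤ C * 6 ^ (κ / 1026) := by nlinarith
    have := one_le_pow₀ this (n := 114)
    rw [hE]
    linarith
  have hN0 : (0 : ℝ) < N := by exact_mod_cast hN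
  have h1 := card_sixfold_sq_le hN ha hp (D := ⌊C * 6 ^ (κ / 1026) * (N : ℝ) ^ (κ / 114)⌋₊)
    fun n h0 h1 => by
      refine Nat.le_floor ((hC n h0).trans ?_)
      rw [mul_assoc]
      gcongr
      calc (n : ℝ) ^ (κ / 1026) ≤ (6 * (N : ℝ) ^ 9) ^ (κ / 1026) := by
            gcongr; exact_mod_cast h1
        _ = _ := by
            rw [Real.mul_rpow (by norm_num) (by positivity), ← Real.rpow_natCast,
              ← Real.rpow_mul hN0.le]
            norm_num
            ring_nf
            simp
  refine abs_le_of_sq_le_sq' ?_ (by positivity) |>.2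
  have hpow : ((N : ℝ) ^ (3 + κ)) ^ 2 = ((N : ℝ) ^ (κ / 114)) ^ 228 * N ^ 6 := by
    rw [← Real.rpow_natCast, ← Real.rpow_natCast, ← Real.rpow_natCast, ← Real.rpow_mul hN0.le,
      ← Real.rpow_mul hN0.le, ← Real.rpow_add hN0]
    congr 1
    push_cast
    ring
  calc (#(sixfold p a N) : ℝ) ^ 2
      ≤ 2 ^ 100 * (⌊C * 6 ^ (κ / 1026) * (N : ℝ) ^ (κ / 114)⌋₊ : ℝ) ^ 228 * N ^ 6 := by
        exact_mod_cast h1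
    _ ≤ 2 ^ 100 * (C * 6 ^ (κ / 1026) * (N : ℝ) ^ (κ / 114)) ^ 228 * N ^ 6 := by
        gcongr
        exact Nat.floor_le (by positivity)
    _ = (E * (N : ℝ) ^ (3 + κ)) ^ 2 := by
        rw [mul_pow E, hpow, hE]
        ring

section Fourier

variable {p : ℕ} [Fact p.Prime]

/-- The cosine `cos (2 π x / p)`. -/
noncomputable def cs (x : ZMod p) : ℝ := (ZMod.stdAddChar x).re

lemma stdAddChar_neg (x : ZMod p) : ZMod.stdAddChar (-x) = (starRingEnd ℂ) (ZMod.stdAddChar x) :=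
  AddChar.map_neg_eq_conj _ _

lemma cs_zero : cs (0 : ZMod p) = 1 := by simp [cs]

lemma cs_neg (x : ZMod p) : cs (-x) = cs x := by simp [cs, stdAddChar_neg]

lemma cs_add_add_cs_sub (x y : ZMod p) : cs (x + y) + cs (x - y) = 2 * (cs x * cs y) := by
  simp only [cs, sub_eq_add_neg, AddChar.map_add_eq_mul, stdAddChar_neg, Complex.mul_re,
    Complex.conj_re, Complex.conj_im]
  ring

lemma abs_cs_le (x : ZMod p) : |cs x| ≤ 1 := by
  refine (Complex.abs_re_le_norm _).trans ?_
  rw [AddChar.norm_apply]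

lemma sum_cs (x : ZMod p) : ∑ ξ, cs (x * ξ) = if x = 0 then (p : ℝ) else 0 := by
  have h := AddChar.sum_mulShift (R' := ℂ) x (ZMod.isPrimitive_stdAddChar p)
  have h1 := congrArg Complex.re h
  rw [Complex.re_sum] at h1
  simp only [cs]
  simp_rw [mul_comm x]
  rw [h1]
  split_ifs <;> simp [ZMod.card]

/-- The cosine transform. -/
noncomputable def ft (f : ZMod p → ℝ) (ξ : ZMod p) : ℝ := ∑ x, f x * cs (x * ξ)

lemma ft_zero (f : ZMod p → ℝ) : ft f 0 = ∑ x, f x := by simp [ft, cs_zero]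

lemma ft_neg (f : ZMod p → ℝ) (ξ : ZMod p) : ft f (-ξ) = ft f ξ := by simp [ft, cs_neg]

lemma sum_mul_cs_add {f : ZMod p → ℝ} (hf : ∀ x, f (-x) = f x) (ξ t : ZMod p) :
    ∑ x, f x * cs (x * ξ + t) = ft f ξ * cs t := by
  have h1 : ∑ x, f x * cs (x * ξ + t) = ∑ x, f x * cs (x * ξ - t) := by
    rw [← Equiv.sum_comp (Equiv.neg (ZMod p))]
    refine sum_congr rfl fun x _ => ?_
    rw [Equiv.neg_apply, hf, ← cs_neg (x * ξ - t)]
    congr 2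
    ring
  have h2 : ∑ x, f x * cs (x * ξ + t) + ∑ x, f x * cs (x * ξ - t) = 2 * (ft f ξ * cs t) := by
    rw [← sum_add_distrib, ft, sum_mul, mul_sum]
    refine sum_congr rfl fun x _ => ?_
    rw [← mul_add, cs_add_add_cs_sub]
    ring
  linarith

lemma sum_ft_mul_cs {f : ZMod p → ℝ} (hf : ∀ x, f (-x) = f x) (x : ZMod p) :
    ∑ ξ, ft f ξ * cs (x * ξ) = p * f x := by
  calc ∑ ξ, ft f ξ * cs (x * ξ) = ∑ ξ, ∑ y, f y * cs (y * ξ + x * ξ) := by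
        refine sum_congr rfl fun ξ _ => ?_
        rw [← sum_mul_cs_add hf]
    _ = ∑ y, f y * ∑ ξ, cs ((y + x) * ξ) := by
        rw [sum_comm]
        refine sum_congr rfl fun y _ => ?_
        rw [mul_sum]
        simp only [add_mul]
    _ = p * f x := by
        simp only [sum_cs]
        rw [sum_eq_single (-x)]
        · simp [hf, mul_comm]
        · intro y _ hy
          rw [if_neg (fun h => hy (eq_neg_of_add_eq_zero_left h)), mul_zero]
        · simp

lemma sum_ft {f : ZMod p → ℝ} (hf : ∀ x, f (-x) = f x) : ∑ ξ, ft f ξ = p * f 0 := by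
  rw [← sum_ft_mul_cs hf]
  simp [cs_zero]

lemma sum_mul_ft_comm (f g : ZMod p → ℝ) (t : ZMod p) :
    ∑ x, f x * ft g (x * t) = ∑ x, g x * ft f (x * t) := by
  simp only [ft, mul_sum]
  rw [sum_comm]
  refine sum_congr rfl fun y _ => sum_congr rfl fun x _ => ?_
  rw [show y * (x * t) = x * (y * t) by ring]
  ring

lemma sum_ft_mul_ft {f g : ZMod p → ℝ} (hf : ∀ x, f (-x) = f x) :
    ∑ ξ, ft f ξ * ft g ξ = p * ∑ x, f x * g x := by
  calc ∑ ξ, ft f ξ * ft g ξ = ∑ x, g x * ∑ ξ, ft f ξ * cs (x * ξ) := by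
        rw [show ∑ ξ, ft f ξ * ft g ξ = ∑ ξ, ∑ x, ft f ξ * (g x * cs (x * ξ)) from
          sum_congr rfl fun ξ _ => by rw [← mul_sum]; rfl, sum_comm]
        refine sum_congr rfl fun x _ => ?_
        rw [mul_sum]
        exact sum_congr rfl fun ξ _ => by ring
    _ = p * ∑ x, f x * g x := by
        simp only [sum_ft_mul_cs hf]
        rw [mul_sum]
        exact sum_congr rfl fun x _ => by ring

/-- Symmetric probability measures with nonnegative Fourier transform. -/
structure IsPos (f : ZMod p → ℝ) : Prop where
  nonneg : ∀ x, 0 ≤ f x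
  sum_eq : ∑ x, f x = 1
  even : ∀ x, f (-x) = f x
  ft_nonneg : ∀ ξ, 0 ≤ ft f ξ

lemma abs_ft_le {f : ZMod p → ℝ} (hf : ∀ x, 0 ≤ f x) (ξ : ZMod p) : |ft f ξ| ≤ ∑ x, f x := by
  refine (abs_sum_le_sum_abs _ _).trans (sum_le_sum fun x _ => ?_)
  rw [abs_mul, abs_of_nonneg (hf x)]
  exact mul_le_of_le_one_right (hf x) (abs_cs_le _)

namespace IsPos

variable {f g : ZMod p → ℝ}

lemma ft_le_one (hf : IsPos f) (ξ : ZMod p) : ft f ξ ≤ 1 :=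
  (le_abs_self _).trans ((abs_ft_le hf.nonneg ξ).trans hf.sum_eq.le)

lemma ft_zero (hf : IsPos f) : ft f 0 = 1 := by rw [MultilinearKloosterman.ft_zero, hf.sum_eq]

lemma le_apply_zero (hf : IsPos f) (x : ZMod p) : f x ≤ f 0 := by
  have hp : (0 : ℝ) < p := by exact_mod_cast (Fact.out : p.Prime).pos
  refine le_of_mul_le_mul_left ?_ hp
  rw [← sum_ft_mul_cs hf.even, ← sum_ft hf.even]
  exact sum_le_sum fun ξ _ =>
    mul_le_of_le_one_right (hf.ft_nonneg ξ) ((le_abs_self _).trans (abs_cs_le _))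

lemma one_le_mul_apply_zero (hf : IsPos f) : 1 ≤ p * f 0 := by
  rw [← sum_ft hf.even, ← hf.ft_zero]
  exact single_le_sum (fun ξ _ => hf.ft_nonneg ξ) (mem_univ _)

lemma apply_zero_pos (hf : IsPos f) : 0 < f 0 := by
  have := hf.one_le_mul_apply_zero
  by_contra! h
  nlinarith [(Nat.cast_nonneg p : (0 : ℝ) ≤ p)]

lemma apply_zero_le_one (hf : IsPos f) : f 0 ≤ 1 := by
  rw [← hf.sum_eq]
  exact single_le_sum (fun x _ => hf.nonneg x) (mem_univ _)

lemma sum_sq_le (hf : IsPos f) : ∑ x, f x ^ 2 ≤ f 0 := by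
  calc ∑ x, f x ^ 2 ≤ ∑ x, f 0 * f x := sum_le_sum fun x _ => by
        rw [sq]; exact mul_le_mul_of_nonneg_right (hf.le_apply_zero x) (hf.nonneg x)
    _ = f 0 := by rw [← mul_sum, hf.sum_eq, mul_one]

lemma sum_ft_sq_le (hf : IsPos f) : ∑ ξ, ft f ξ ^ 2 ≤ p * f 0 := by
  simp only [sq]
  rw [sum_ft_mul_ft hf.even]
  gcongr
  simpa only [sq] using hf.sum_sq_le

/-- The bilinear bound. -/
lemma bilinear_sq_le (hf : IsPos f) (hg : IsPos g) {t : ZMod p} (ht : t ≠ 0) :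
    (∑ x, f x * ft g (x * t)) ^ 2 ≤ p * (f 0 * g 0) := by
  calc _ ≤ (∑ x, f x ^ 2) * ∑ x, ft g (x * t) ^ 2 := sum_mul_sq_le_sq_mul_sq _ _ _
    _ = (∑ x, f x ^ 2) * ∑ x, ft g x ^ 2 := by
        congr 1
        exact Equiv.sum_comp (Equiv.mulRight₀ t ht) fun x => ft g x ^ 2
    _ ≤ f 0 * (p * g 0) := mul_le_mul hf.sum_sq_le hg.sum_ft_sq_le
        (sum_nonneg fun _ _ => sq_nonneg _) hf.apply_zero_pos.le
    _ = _ := by ring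

end IsPos

/-- The law of `x + e y`. -/
noncomputable def shiftConv (e : ZMod p) (f g : ZMod p → ℝ) (z : ZMod p) : ℝ :=
  ∑ y, g y * f (z - e * y)

lemma ft_shiftConv {e : ZMod p} {f g : ZMod p → ℝ} (hf : ∀ x, f (-x) = f x) (ξ : ZMod p) :
    ft (shiftConv e f g) ξ = ft f ξ * ft g (e * ξ) := by
  calc ft (shiftConv e f g) ξ = ∑ y, g y * ∑ z, f (z - e * y) * cs (z * ξ) := by
        simp only [ft, shiftConv, sum_mul]
        rw [sum_comm]
        refine sum_congr rfl fun y _ => ?_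
        rw [mul_sum]
        exact sum_congr rfl fun z _ => by ring
    _ = ∑ y, g y * (ft f ξ * cs (y * (e * ξ))) := by
        refine sum_congr rfl fun y _ => ?_
        rw [← Equiv.sum_comp (Equiv.addRight (e * y)), ← sum_mul_cs_add hf]
        congr 1
        refine sum_congr rfl fun x _ => ?_
        rw [Equiv.coe_addRight, add_sub_cancel_right]
        congr 2
        ring
    _ = _ := by
        rw [ft.eq_def g, mul_sum]
        exact sum_congr rfl fun y _ => by ring

lemma IsPos.of_ft {f : ZMod p → ℝ} (h0 : ∀ x, 0 ≤ f x) (h1 : ft f 0 = 1)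
    (h2 : ∀ x, f (-x) = f x) (h3 : ∀ ξ, 0 ≤ ft f ξ) : IsPos f :=
  ⟨h0, by rw [← MultilinearKloosterman.ft_zero, h1], h2, h3⟩

lemma shiftConv_neg {e : ZMod p} {f g : ZMod p → ℝ} (hf : ∀ x, f (-x) = f x)
    (hg : ∀ x, g (-x) = g x) (z : ZMod p) : shiftConv e f g (-z) = shiftConv e f g z := by
  rw [shiftConv, ← Equiv.sum_comp (Equiv.neg (ZMod p))]
  refine sum_congr rfl fun y _ => ?_
  rw [Equiv.neg_apply, hg, ← hf]
  congr 2
  ring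

lemma shiftConv_nonneg {e : ZMod p} {f g : ZMod p → ℝ} (hf : ∀ x, 0 ≤ f x)
    (hg : ∀ x, 0 ≤ g x) (z : ZMod p) : 0 ≤ shiftConv e f g z :=
  sum_nonneg fun _ _ => mul_nonneg (hg _) (hf _)

lemma IsPos.shiftConv {f g : ZMod p → ℝ} (hf : IsPos f) (hg : IsPos g) (e : ZMod p) :
    IsPos (shiftConv e f g) := by
  refine .of_ft (shiftConv_nonneg hf.nonneg hg.nonneg) ?_ (shiftConv_neg hf.even hg.even) ?_
  · rw [ft_shiftConv hf.even, mul_zero, hf.ft_zero, hg.ft_zero, mul_one]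
  · intro ξ
    rw [ft_shiftConv hf.even]
    exact mul_nonneg (hf.ft_nonneg _) (hg.ft_nonneg _)

lemma shiftConv_apply_zero {e : ZMod p} {f g : ZMod p → ℝ} (hf : ∀ x, f (-x) = f x) :
    shiftConv e f g 0 = ∑ y, g y * f (e * y) := by
  refine sum_congr rfl fun y _ => ?_
  rw [zero_sub, hf]

lemma isPos_shiftConv_self {f : ZMod p → ℝ} (h0 : ∀ x, 0 ≤ f x) (h1 : ∑ x, f x = 1)
    (h2 : ∀ x, f (-x) = f x) : IsPos (shiftConv 1 f f) := by
  refine .of_ft (shiftConv_nonneg h0 h0) ?_ (shiftConv_neg h2 h2) ?_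
  · rw [ft_shiftConv h2, mul_zero, ft_zero, h1, mul_one]
  · intro ξ
    rw [ft_shiftConv h2, one_mul]
    exact mul_self_nonneg _

/-- The normalised product of `g` and a dilate of `f`. -/
noncomputable def dilMul (e : ZMod p) (f g : ZMod p → ℝ) (x : ZMod p) : ℝ :=
  g x * f (e * x) / shiftConv e f g 0

lemma ft_dilate {e : ZMod p} (he : e ≠ 0) (f : ZMod p → ℝ) (ξ : ZMod p) :
    ft (fun x => f (e * x)) ξ = ft f (e⁻¹ * ξ) := by
  rw [ft, ft, ← Equiv.sum_comp (Equiv.mulLeft₀ e he) fun x => f x * cs (x * (e⁻¹ * ξ))]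
  refine sum_congr rfl fun x _ => ?_
  change _ = f (e * x) * cs (e * x * (e⁻¹ * ξ))
  congr 2
  field_simp

lemma ft_mul_nonneg {f g : ZMod p → ℝ} (hf : ∀ x, f (-x) = f x) (hf0 : ∀ ξ, 0 ≤ ft f ξ)
    (hg0 : ∀ ξ, 0 ≤ ft g ξ) (ξ : ZMod p) : 0 ≤ ft (fun x => f x * g x) ξ := by
  have hp : (0 : ℝ) < p := by exact_mod_cast (Fact.out : p.Prime).pos
  have h1 : ∀ η, ft (fun x => g x * cs (x * ξ)) η = (ft g (ξ + η) + ft g (ξ - η)) / 2 := by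
    intro η
    rw [ft, ft, ft, ← sum_add_distrib, sum_div]
    refine sum_congr rfl fun x _ => ?_
    rw [← mul_add, mul_add x, mul_sub, cs_add_add_cs_sub]
    ring
  have h2 := sum_ft_mul_ft (g := fun x => g x * cs (x * ξ)) hf
  have h3 : 0 ≤ p * ∑ x, f x * (g x * cs (x * ξ)) := by
    rw [← h2]
    refine sum_nonneg fun η _ => mul_nonneg (hf0 η) ?_
    rw [h1]
    have := hg0 (ξ + η)
    have := hg0 (ξ - η)
    positivity
  have h4 := nonneg_of_mul_nonneg_right h3 hp
  simpa only [ft, mul_assoc] using h4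

lemma shiftConv_apply_zero_pos {f g : ZMod p → ℝ} (hf : IsPos f) (hg : IsPos g) (e : ZMod p) :
    0 < shiftConv e f g 0 := (hf.shiftConv hg e).apply_zero_pos

lemma dilMul_apply_zero (e : ZMod p) (f g : ZMod p → ℝ) :
    dilMul e f g 0 = g 0 * f 0 / shiftConv e f g 0 := by simp [dilMul]

lemma IsPos.dilMul {f g : ZMod p → ℝ} (hf : IsPos f) (hg : IsPos g) {e : ZMod p} (he : e ≠ 0) :
    IsPos (dilMul e f g) := by
  have hW := shiftConv_apply_zero_pos hf hg e
  refine ⟨fun x => div_nonneg (mul_nonneg (hg.nonneg _) (hf.nonneg _)) hW.le, ?_, fun x => ?_,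
    fun ξ => ?_⟩
  · simp only [MultilinearKloosterman.dilMul]
    rw [← sum_div, ← shiftConv_apply_zero hf.even, div_self hW.ne']
  · simp only [MultilinearKloosterman.dilMul]
    rw [hg.even, mul_neg, hf.even]
  · have h := ft_mul_nonneg (f := g) (g := fun x => f (e * x)) hg.even hg.ft_nonneg
      (fun η => by rw [ft_dilate he]; exact hf.ft_nonneg _) ξ
    have h2 : ft (MultilinearKloosterman.dilMul e f g) ξ =
        ft (fun x => g x * f (e * x)) ξ / MultilinearKloosterman.shiftConv e f g 0 := by
      simp only [ft, MultilinearKloosterman.dilMul]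
      rw [sum_div]
      exact sum_congr rfl fun x _ => by ring
    rw [h2]
    exact div_nonneg h hW.le

/-- The law of `x y`. -/
noncomputable def mulConv (f g : ZMod p → ℝ) (z : ZMod p) : ℝ :=
  ∑ x, ∑ y, if x * y = z then f x * g y else 0

lemma sum_mulConv_mul (f g h : ZMod p → ℝ) :
    ∑ z, mulConv f g z * h z = ∑ x, f x * ∑ y, g y * h (x * y) := by
  simp only [mulConv, sum_mul]
  rw [sum_comm]
  refine sum_congr rfl fun x _ => ?_
  rw [sum_comm, mul_sum]
  refine sum_congr rfl fun y _ => ?_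
  simp [mul_assoc]

lemma ft_mulConv (f g : ZMod p → ℝ) (ξ : ZMod p) :
    ft (mulConv f g) ξ = ∑ x, f x * ft g (x * ξ) := by
  rw [ft, sum_mulConv_mul f g fun z => cs (z * ξ)]
  refine sum_congr rfl fun x _ => ?_
  congr 1
  exact sum_congr rfl fun y _ => by rw [show x * y * ξ = y * (x * ξ) by ring]

lemma IsPos.mulConv {f g : ZMod p → ℝ} (hf : IsPos f) (hg : IsPos g) :
    IsPos (mulConv f g) := by
  refine .of_ft (fun z => sum_nonneg fun x _ => sum_nonneg fun y _ => ?_) ?_ (fun z => ?_) ?_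
  · split_ifs
    exacts [mul_nonneg (hf.nonneg _) (hg.nonneg _), le_rfl]
  · rw [ft_mulConv]
    simp [hg.ft_zero, hf.sum_eq]
  · rw [MultilinearKloosterman.mulConv, ← Equiv.sum_comp (Equiv.neg (ZMod p))]
    refine sum_congr rfl fun x _ => sum_congr rfl fun y _ => ?_
    rw [Equiv.neg_apply, hf.even, neg_mul]
    simp only [neg_inj]
  · intro ξ
    rw [ft_mulConv]
    exact sum_nonneg fun x _ => mul_nonneg (hf.nonneg _) (hg.ft_nonneg _)

end Fourier

section SumProduct

variable {p : ℕ} [Fact p.Prime]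

/-- `ζ H` is covered by `K` translates of `H`. -/
def Covers (H : Finset (ZMod p)) (K : ℕ) (ζ : ZMod p) : Prop :=
  ∃ T : Finset (ZMod p), #T ≤ K ∧ ∀ h ∈ H, ∃ t ∈ T, ∃ h' ∈ H, ζ * h = t + h'

/-- A symmetric set of differences with small doubling. -/
structure SmallDoubling (X H : Finset (ZMod p)) (K : ℕ) : Prop where
  mem_iff : ∀ h, h ∈ H ↔ ∃ x ∈ X, ∃ y ∈ X, x - y = h
  nonempty : X.Nonempty
  card_le : #H ≤ K * #X
  cover : ∃ T : Finset (ZMod p), #T ≤ K ∧ ∀ h ∈ H, ∀ h' ∈ H, ∃ t ∈ T, ∃ h'' ∈ H, h + h' = t + h''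

lemma Covers.mono {H : Finset (ZMod p)} {K L : ℕ} {ζ : ZMod p} (h : Covers H K ζ) (hKL : K ≤ L) :
    Covers H L ζ := by
  obtain ⟨T, hT, h⟩ := h
  exact ⟨T, hT.trans hKL, h⟩

lemma Covers.mul {H : Finset (ZMod p)} {K L : ℕ} {ζ ξ : ZMod p} (h1 : Covers H K ζ)
    (h2 : Covers H L ξ) : Covers H (K * L) (ζ * ξ) := by
  obtain ⟨T, hT, h1⟩ := h1
  obtain ⟨U, hU, h2⟩ := h2
  refine ⟨(T ×ˢ U).image fun x => x.1 + ζ * x.2, card_image_le.trans ?_, fun h hh => ?_⟩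
  · rw [card_product]; exact Nat.mul_le_mul hT hU
  · obtain ⟨u, hu, h', hh', e1⟩ := h2 h hh
    obtain ⟨t, ht, h'', hh'', e2⟩ := h1 h' hh'
    refine ⟨t + ζ * u, mem_image.2 ⟨(t, u), mem_product.2 ⟨ht, hu⟩, rfl⟩, h'', hh'', ?_⟩
    rw [mul_assoc, e1, mul_add, e2]
    ring

namespace SmallDoubling

variable {X H : Finset (ZMod p)} {K₀ : ℕ}

lemma neg_mem (hX : SmallDoubling X H K₀) {h : ZMod p} (hh : h ∈ H) : -h ∈ H := by
  obtain ⟨x, hx, y, hy, rfl⟩ := (hX.mem_iff h).1 hh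
  exact (hX.mem_iff _).2 ⟨y, hy, x, hx, by ring⟩

lemma one_le (hX : SmallDoubling X H K₀) : 1 ≤ K₀ := by
  by_contra! h
  have h1 := hX.card_le
  obtain ⟨x, hx⟩ := hX.nonempty
  have : 0 < #H := card_pos.2 ⟨x - x, (hX.mem_iff _).2 ⟨x, hx, x, hx, rfl⟩⟩
  have h0 : K₀ = 0 := by omega
  rw [h0] at h1
  omega

lemma card_le_card (hX : SmallDoubling X H K₀) : #X ≤ #H := by
  obtain ⟨y, hy⟩ := hX.nonempty
  exact card_le_card_of_injOn (fun x => x - y) (fun x hx => (hX.mem_iff _).2 ⟨x, hx, y, hy, rfl⟩)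
    fun a _ b _ h => sub_left_injective h

lemma covers_one (_ : SmallDoubling X H K₀) : Covers H 1 1 :=
  ⟨{0}, by simp, fun h hh => ⟨0, by simp, h, hh, by ring⟩⟩

lemma covers_neg (hX : SmallDoubling X H K₀) {K : ℕ} {ζ : ZMod p} (h1 : Covers H K ζ) :
    Covers H K (-ζ) := by
  obtain ⟨T, hT, h1⟩ := h1
  refine ⟨T.image fun x => -x, card_image_le.trans hT, fun h hh => ?_⟩
  obtain ⟨t, ht, h', hh', e⟩ := h1 h hh
  refine ⟨-t, mem_image_of_mem _ ht, -h', hX.neg_mem hh', ?_⟩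
  rw [neg_mul, e]
  ring

lemma covers_add (hX : SmallDoubling X H K₀) {K L : ℕ} {ζ ξ : ZMod p} (h1 : Covers H K ζ)
    (h2 : Covers H L ξ) : Covers H (K * L * K₀) (ζ + ξ) := by
  obtain ⟨T, hT, h1⟩ := h1
  obtain ⟨U, hU, h2⟩ := h2
  obtain ⟨V, hV, h3⟩ := hX.cover
  refine ⟨((T ×ˢ U) ×ˢ V).image fun x => x.1.1 + x.1.2 + x.2, card_image_le.trans ?_,
    fun h hh => ?_⟩
  · rw [card_product, card_product]; exact Nat.mul_le_mul (Nat.mul_le_mul hT hU) hV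
  · obtain ⟨t, ht, h', hh', e1⟩ := h1 h hh
    obtain ⟨u, hu, h'', hh'', e2⟩ := h2 h hh
    obtain ⟨v, hv, k, hk, e3⟩ := h3 h' hh' h'' hh''
    refine ⟨t + u + v, mem_image.2 ⟨((t, u), v), by simp [ht, hu, hv], rfl⟩, k, hk, ?_⟩
    rw [add_mul, e1, e2]
    linear_combination e3

lemma covers_sub (hX : SmallDoubling X H K₀) {K L : ℕ} {ζ ξ : ZMod p} (h1 : Covers H K ζ)
    (h2 : Covers H L ξ) : Covers H (K * L * K₀) (ζ - ξ) := by
  rw [sub_eq_add_neg]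
  exact hX.covers_add h1 (hX.covers_neg h2)

open scoped Pointwise in
lemma card_add_dilate_le (hX : SmallDoubling X H K₀) {K : ℕ} {ζ : ZMod p} (h1 : Covers H K ζ) :
    #(H + H.image (ζ * ·)) ≤ K * K₀ * #H := by
  obtain ⟨T, hT, h1⟩ := h1
  obtain ⟨V, hV, h3⟩ := hX.cover
  calc #(H + H.image (ζ * ·)) ≤ #((T + V) + H) := by
        refine Finset.card_le_card fun x hx => ?_
        obtain ⟨h, hh, y, hy, rfl⟩ := mem_add.1 hx
        obtain ⟨h', hh', rfl⟩ := mem_image.1 hy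
        obtain ⟨t, ht, k, hk, e1⟩ := h1 h' hh'
        obtain ⟨v, hv, l, hl, e2⟩ := h3 h hh k hk
        refine mem_add.2 ⟨t + v, add_mem_add ht hv, l, hl, ?_⟩
        rw [e1]
        linear_combination -e2
    _ ≤ #(T + V) * #H := card_add_le
    _ ≤ K * K₀ * #H := Nat.mul_le_mul_right _ (card_add_le.trans (Nat.mul_le_mul hT hV))

open scoped Pointwise in
lemma covers_inv (hX : SmallDoubling X H K₀) {K : ℕ} {ζ : ZMod p} (hζ : ζ ≠ 0)
    (h1 : Covers H K ζ) : Covers H (K * K₀ * K₀) ζ⁻¹ := by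
  have hcard : #(X.image (ζ * ·)) = #X := card_image_of_injective _ (mul_right_injective₀ hζ)
  have h2 : #(H + X.image (ζ * ·)) ≤ (K * K₀ * K₀) * #(X.image (ζ * ·)) := by
    obtain ⟨y, hy⟩ := hX.nonempty
    calc #(H + X.image (ζ * ·)) ≤ #(H + H.image (ζ * ·)) := by
          refine card_le_card_of_injOn (fun x => x - ζ * y) (fun x hx => ?_)
            fun a _ b _ h => sub_left_injective h
          obtain ⟨h, hh, z, hz, rfl⟩ := mem_add.1 hx
          obtain ⟨w, hw, rfl⟩ := mem_image.1 hz
          refine mem_add.2 ⟨h, hh, ζ * (w - y), mem_image_of_mem _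
            ((hX.mem_iff _).2 ⟨w, hw, y, hy, rfl⟩), by ring⟩
      _ ≤ K * K₀ * #H := hX.card_add_dilate_le h1
      _ ≤ K * K₀ * (K₀ * #X) := Nat.mul_le_mul_left _ hX.card_le
      _ = _ := by rw [hcard]; ring
  obtain ⟨F, -, hF, hsub⟩ := Finset.ruzsa_covering_add (A := H) (K := ((K * K₀ * K₀ : ℕ) : ℝ))
    (hX.nonempty.image (ζ * ·)) (by exact_mod_cast h2)
  refine ⟨F.image (ζ⁻¹ * ·), card_image_le.trans (by exact_mod_cast hF), fun h hh => ?_⟩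
  obtain ⟨f, hf, d, hd, rfl⟩ := mem_add.1 (hsub hh)
  obtain ⟨u, hu, v, hv, rfl⟩ := mem_sub.1 hd
  obtain ⟨x, hx, rfl⟩ := mem_image.1 hu
  obtain ⟨y, hy, rfl⟩ := mem_image.1 hv
  refine ⟨ζ⁻¹ * f, mem_image_of_mem _ hf, x - y, (hX.mem_iff _).2 ⟨x, hx, y, hy, rfl⟩, ?_⟩
  field_simp

/-- The dichotomy behind the growth of a set of multipliers. -/
lemma exists_quotient_or (hX : SmallDoubling X H K₀) {K : ℕ} {R : Finset (ZMod p)}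
    (hR : ∀ ζ ∈ R, Covers H K ζ) (hR2 : 2 ≤ #R) :
    (∀ ζ, Covers H ((K * K₀) ^ 4) ζ) ∨
      ∃ R' : Finset (ZMod p), #R' = #R ^ 2 ∧ ∀ ζ ∈ R', Covers H ((K * K₀) ^ 6) ζ := by
  classical
  have hQ : ∀ ζ, (∃ a ∈ R, ∃ b ∈ R, ∃ c ∈ R, ∃ d ∈ R, c ≠ d ∧ ζ * (c - d) = a - b) →
      Covers H ((K * K₀) ^ 4) ζ := by
    rintro ζ ⟨a, ha, b, hb, c, hc, d, hd, hcd, e⟩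
    have hne : c - d ≠ 0 := sub_ne_zero.2 hcd
    have h1 := (hX.covers_sub (hR a ha) (hR b hb)).mul
      (hX.covers_inv hne (hX.covers_sub (hR c hc) (hR d hd)))
    have h2 : ζ = (a - b) * (c - d)⁻¹ := by rw [← e]; field_simp
    rw [h2]
    convert h1 using 1
    ring
  obtain ⟨c, hc, d, hd, hcd⟩ := one_lt_card.1 (show 1 < #R by omega)
  by_cases hall : ∀ ζ, ∃ a ∈ R, ∃ b ∈ R, ∃ c ∈ R, ∃ d ∈ R, c ≠ d ∧ ζ * (c - d) = a - b
  · exact Or.inl fun ζ => hQ ζ (hall ζ)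
  right
  have hex : ∃ ξ : ZMod p, (∃ a ∈ R, ∃ b ∈ R, ∃ c ∈ R, ∃ d ∈ R, c ≠ d ∧ ξ * (c - d) = a - b) ∧
      ¬ ∃ a ∈ R, ∃ b ∈ R, ∃ c ∈ R, ∃ d ∈ R, c ≠ d ∧ (ξ + 1) * (c - d) = a - b := by
    by_contra! hcon
    refine hall fun ζ => ?_
    have : ∀ n : ℕ, ∃ a ∈ R, ∃ b ∈ R, ∃ c ∈ R, ∃ d ∈ R, c ≠ d ∧ (n : ZMod p) * (c - d) = a - b := by
      intro n
      induction n with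
      | zero => exact ⟨c, hc, c, hc, c, hc, d, hd, hcd, by simp⟩
      | succ n ih => rw [Nat.cast_succ]; exact hcon _ ih
    rw [← ZMod.natCast_zmod_val ζ]
    exact this _
  obtain ⟨ξ, hξ, hξ'⟩ := hex
  refine ⟨(R ×ˢ R).image fun x => x.1 + (ξ + 1) * x.2, ?_, fun ζ hζ => ?_⟩
  · rw [card_image_of_injOn, card_product, sq]
    rintro ⟨a, b⟩ hab ⟨a', b'⟩ hab' e
    simp only [coe_product, Set.mem_prod, mem_coe] at hab hab'
    simp only at e
    have hb : b = b' := by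
      by_contra hne
      exact hξ' ⟨a', hab'.1, a, hab.1, b, hab.2, b', hab'.2, hne, by linear_combination e⟩
    subst hb
    rw [add_left_injective _ e]
  · obtain ⟨⟨a, b⟩, hab, rfl⟩ := mem_image.1 hζ
    rw [mem_product] at hab
    have h1 := hX.covers_add (hR a hab.1)
      ((hX.covers_add (hQ ξ hξ) hX.covers_one).mul (hR b hab.2))
    convert h1 using 1
    ring

lemma covers_all (hX : SmallDoubling X H K₀) (k : ℕ) : ∀ {K : ℕ} {R : Finset (ZMod p)},
    1 ≤ K → (∀ ζ ∈ R, Covers H K ζ) → 2 ≤ #R → p < #R ^ 2 ^ k →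
      ∀ ζ, Covers H ((K * K₀) ^ (4 * 7 ^ k)) ζ := by
  induction k with
  | zero =>
    intro K R _ _ _ h
    have := Finset.card_le_univ R
    rw [ZMod.card] at this
    simp at h
    omega
  | succ k ih =>
    intro K R hK hR hR2 hp ζ
    have h1 : 1 ≤ K * K₀ := Nat.mul_pos hK hX.one_le
    have h7 : 1 ≤ 7 ^ k := Nat.one_le_pow _ _ (by norm_num)
    rcases hX.exists_quotient_or hR hR2 with h | ⟨R', hc, hR'⟩
    · exact (h ζ).mono (Nat.pow_le_pow_right h1 (by rw [pow_succ]; omega))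
    · refine (ih (Nat.one_le_pow _ _ h1) hR' ?_ ?_ ζ).mono ?_
      · rw [hc]; nlinarith
      · rwa [hc, ← pow_mul, ← pow_succ']
      · calc ((K * K₀) ^ 6 * K₀) ^ (4 * 7 ^ k) ≤ ((K * K₀) ^ 6 * (K * K₀)) ^ (4 * 7 ^ k) :=
              Nat.pow_le_pow_left (Nat.mul_le_mul_left _ (Nat.le_mul_of_pos_left _ hK)) _
          _ = _ := by rw [← pow_succ, ← pow_mul, pow_succ]; ring_nf

end SmallDoubling

open scoped Pointwise in
/-- If `H + ξ H` is small for all `ξ`, then `H` is very small or very large. -/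
lemma mul_card_le_of_card_add_dilate_le {H : Finset (ZMod p)} (hH : H.Nonempty) {L : ℕ}
    (h : ∀ ξ : ZMod p, #(H + H.image (ξ * ·)) ≤ L * #H) : p * #H ≤ L * (p + #H ^ 2) := by
  classical
  have key : ∀ ξ : ZMod p, #H ^ 4 ≤ L * #H *
      #(((H ×ˢ H) ×ˢ (H ×ˢ H)).filter fun x => x.1.1 + ξ * x.1.2 = x.2.1 + ξ * x.2.2) := by
    intro ξ
    have hm : ∀ x ∈ H ×ˢ H, x.1 + ξ * x.2 ∈ H + H.image (ξ * ·) := fun x hx => by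
      rw [mem_product] at hx
      exact add_mem_add hx.1 (mem_image_of_mem _ hx.2)
    have h1 := card_eq_sum_card_fiberwise hm
    have h2 : #(((H ×ˢ H) ×ˢ (H ×ˢ H)).filter fun x => x.1.1 + ξ * x.1.2 = x.2.1 + ξ * x.2.2)
        = ∑ z ∈ H + H.image (ξ * ·), #((H ×ˢ H).filter fun x => x.1 + ξ * x.2 = z) ^ 2 := by
      rw [card_eq_sum_card_fiberwise (f := fun x => x.1.1 + ξ * x.1.2)
        (t := H + H.image (ξ * ·))]
      · refine sum_congr rfl fun z _ => ?_
        rw [sq, ← card_product]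
        congr 1
        ext ⟨x, y⟩
        simp only [mem_filter, mem_product]
        constructor
        · rintro ⟨⟨⟨h1, h2⟩, h3⟩, h4⟩
          exact ⟨⟨h1, h4⟩, h2, by rw [← h3, h4]⟩
        · rintro ⟨⟨h1, h2⟩, h3, h4⟩
          exact ⟨⟨⟨h1, h3⟩, by rw [h2, h4]⟩, h2⟩
      · intro x hx
        exact hm _ (mem_product.1 (mem_filter.1 hx).1).1
    rw [h2]
    calc #H ^ 4 = (#(H ×ˢ H)) ^ 2 := by rw [card_product]; ring
      _ ≤ #(H + H.image (ξ * ·)) * ∑ z ∈ H + H.image (ξ * ·),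
          #((H ×ˢ H).filter fun x => x.1 + ξ * x.2 = z) ^ 2 := by
          rw [h1]; exact sq_sum_le_card_mul_sum_sq
      _ ≤ _ := Nat.mul_le_mul_right _ (h ξ)
  have htot : ∑ ξ : ZMod p,
      #(((H ×ˢ H) ×ˢ (H ×ˢ H)).filter fun x => x.1.1 + ξ * x.1.2 = x.2.1 + ξ * x.2.2)
      ≤ p * #H ^ 2 + #H ^ 4 := by
    simp only [card_filter]
    rw [sum_comm]
    have h1 : ∀ x ∈ (H ×ˢ H) ×ˢ (H ×ˢ H),
        (∑ ξ : ZMod p, if x.1.1 + ξ * x.1.2 = x.2.1 + ξ * x.2.2 then 1 else 0) ≤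
          (if x.1 = x.2 then p else 0) + 1 := by
      rintro ⟨⟨a, b⟩, c, d⟩ -
      simp only [← card_filter, Prod.mk.injEq]
      by_cases hbd : b = d
      · subst hbd
        by_cases hac : a = c
        · rw [if_pos ⟨hac, rfl⟩]
          refine (Finset.card_le_univ _).trans ?_
          rw [ZMod.card]; omega
        · simp [hac]
      · rw [if_neg (fun h => hbd h.2), zero_add, card_le_one]
        simp only [mem_filter, mem_univ, true_and]
        intro ξ h1 ξ' h2
        have h3 : (ξ - ξ') * (b - d) = 0 := by linear_combination h1 - h2
        rcases mul_eq_zero.1 h3 with h | h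
        · exact sub_eq_zero.1 h
        · exact absurd (sub_eq_zero.1 h) hbd
    refine (sum_le_sum h1).trans ?_
    rw [sum_add_distrib, sum_const, smul_eq_mul, mul_one, card_product, card_product,
      sum_product]
    have h2 : ∀ x ∈ H ×ˢ H, (∑ y ∈ H ×ˢ H, if x = y then p else 0) = p := by
      intro x hx
      rw [sum_ite_eq, if_pos hx]
    rw [sum_congr rfl h2, sum_const, card_product, smul_eq_mul]
    apply le_of_eq; ring
  have h1 : p * #H ^ 4 ≤ L * #H * (p * #H ^ 2 + #H ^ 4) := by
    calc p * #H ^ 4 = ∑ ξ : ZMod p, #H ^ 4 := by simp [ZMod.card]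
      _ ≤ _ := sum_le_sum fun ξ _ => key ξ
      _ ≤ _ := by rw [← mul_sum]; exact Nat.mul_le_mul_left _ htot
  have h3 : 0 < #H ^ 3 := pow_pos (card_pos.2 hH) 3
  refine Nat.le_of_mul_le_mul_left ?_ h3
  calc _ = p * #H ^ 4 := by ring
    _ ≤ _ := h1
    _ = _ := by ring

open scoped Pointwise in
/-- A sum-product theorem: a set with many nearly invariant dilations is very small or very
large. -/
theorem mul_card_le_of_card_sub_dilate_le {X R : Finset (ZMod p)} (hX : X.Nonempty) {K : ℕ}
    (k : ℕ) (hR0 : (0 : ZMod p) ∉ R) (hR2 : 2 ≤ #R) (hp : p < #R ^ 2 ^ k)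
    (h : ∀ ζ ∈ R, #(X - X.image (ζ * ·)) ≤ K * #X) :
    p * #X ≤ K ^ (88 * 7 ^ k + 30) * (p + #X ^ 2) := by
  classical
  have hXpos := card_pos.2 hX
  have hcard : ∀ ζ ∈ R, #(X.image (ζ * ·)) = #X := fun ζ hζ =>
    card_image_of_injective _ (mul_right_injective₀ (ne_of_mem_of_not_mem hζ hR0))
  obtain ⟨ζ₀, hζ₀⟩ : R.Nonempty := card_pos.1 (by omega)
  have hK : 1 ≤ K := by
    by_contra! hK
    have h0 := h ζ₀ hζ₀
    have h1 : 0 < #(X - X.image (ζ₀ * ·)) := card_pos.2 (hX.sub (hX.image _))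
    have : K = 0 := by omega
    rw [this] at h0
    omega
  have hH : #(X - X) ≤ K ^ 2 * #X := by
    have h1 := ruzsa_triangle_inequality_sub_sub_sub X (X.image (ζ₀ * ·)) X
    rw [hcard ζ₀ hζ₀] at h1
    refine Nat.le_of_mul_le_mul_right ?_ hXpos
    calc #(X - X) * #X ≤ _ := h1
      _ ≤ (K * #X) * (K * #X) := Nat.mul_le_mul (h _ hζ₀) (h _ hζ₀)
      _ = _ := by ring
  have hSD : SmallDoubling X (X - X) (K ^ 10) := by
    refine ⟨fun h => mem_sub, hX, hH.trans
      (Nat.mul_le_mul_right _ (Nat.pow_le_pow_right hK (by norm_num))), ?_⟩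
    have h1 := pluennecke_ruzsa_inequality_nsmul_sub_nsmul_sub hX X 3 2
    have h2 : #(3 • X - 2 • X) ≤ K ^ 10 * #X := by
      have h3 : ((#(X - X) : ℚ≥0) / #X) ≤ K ^ 2 := by
        rw [div_le_iff₀ (by exact_mod_cast hXpos)]
        exact_mod_cast hH
      have h4 : ((#(X - X) : ℚ≥0) / #X) ^ (3 + 2) * #X ≤ (K ^ 2) ^ (3 + 2) * #X := by gcongr
      have h5 := h1.trans h4
      rw [← pow_mul] at h5
      exact_mod_cast h5
    have h6 : #((X - X + (X - X)) + X) ≤ K ^ 10 * #X := by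
      refine (Finset.card_le_card ?_).trans h2
      apply le_of_eq
      rw [show 3 • X = X + X + X by rw [succ_nsmul, two_nsmul], two_nsmul]
      simp only [sub_eq_add_neg, neg_add]
      ac_rfl
    obtain ⟨F, -, hF, hsub⟩ := Finset.ruzsa_covering_add (A := X - X + (X - X))
      (K := ((K ^ 10 : ℕ) : ℝ)) hX (by exact_mod_cast h6)
    refine ⟨F, by exact_mod_cast hF, fun a ha b hb => ?_⟩
    obtain ⟨f, hf, d, hd, e⟩ := mem_add.1 (hsub (add_mem_add ha hb))
    exact ⟨f, hf, d, hd, e.symm⟩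
  have hcov : ∀ ζ ∈ R, Covers (X - X) (K ^ 12) ζ := by
    intro ζ hζ
    have h1 : #(X.image (ζ * ·) + -X) ≤ K * #(-X) := by
      rw [card_neg, ← sub_eq_add_neg, ← card_neg, neg_sub]
      exact h ζ hζ
    obtain ⟨F, -, hF, hsub⟩ := Finset.ruzsa_covering_add (A := X.image (ζ * ·)) (B := -X)
      (K := (K : ℝ)) hX.neg (by exact_mod_cast h1)
    obtain ⟨T, hT, hTc⟩ := hSD.cover
    have hF' : #F ≤ K := by exact_mod_cast hF
    have hsub' : ∀ x ∈ X, ∃ f ∈ F, ∃ d ∈ X - X, ζ * x = f + d := by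
      intro x hx
      obtain ⟨f, hf, d, hd, e⟩ := mem_add.1 (hsub (mem_image_of_mem _ hx))
      refine ⟨f, hf, d, ?_, e.symm⟩
      rw [neg_sub_neg] at hd
      exact hd
    refine ⟨F - F + T, ?_, fun d hd => ?_⟩
    · calc #(F - F + T) ≤ (#F * #F) * #T := card_add_le.trans (Nat.mul_le_mul_right _ card_sub_le)
        _ ≤ (K * K) * K ^ 10 := Nat.mul_le_mul (Nat.mul_le_mul hF' hF') hT
        _ = _ := by ring
    · obtain ⟨x, hx, y, hy, rfl⟩ := mem_sub.1 hd
      obtain ⟨f, hf, d, hd, e⟩ := hsub' x hx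
      obtain ⟨f', hf', d', hd', e'⟩ := hsub' y hy
      obtain ⟨t, ht, h'', hh, e2⟩ := hTc d hd (-d') (hSD.neg_mem hd')
      refine ⟨f - f' + t, add_mem_add (sub_mem_sub hf hf') ht, h'', hh, ?_⟩
      linear_combination e - e' + e2
  have hall := hSD.covers_all k (Nat.one_le_pow _ _ hK) hcov hR2 hp
  have hfin := mul_card_le_of_card_add_dilate_le (hX.sub hX)
    fun ξ => hSD.card_add_dilate_le (hall ξ)
  have hle := hSD.card_le_card
  have hpos : 0 < #(X - X) := by omega
  set L := ((K ^ 12 * K ^ 10) ^ (4 * 7 ^ k) * K ^ 10) with hL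
  have hexp : K ^ (88 * 7 ^ k + 30) = L * K ^ 20 := by
    rw [hL, ← pow_add, ← pow_mul, ← pow_add, ← pow_add]
    congr 1
    ring
  rw [hexp]
  have hK20 : K ^ 2 ≤ K ^ 20 := Nat.pow_le_pow_right hK (by norm_num)
  have h1K20 : 1 ≤ K ^ 20 := Nat.one_le_pow _ _ hK
  refine Nat.le_of_mul_le_mul_left ?_ hpos
  calc #(X - X) * (p * #X) = #X * (p * #(X - X)) := by ring
    _ ≤ #X * (L * (p + #(X - X) ^ 2)) := Nat.mul_le_mul_left _ hfin
    _ = L * (#X * p + #(X - X) * (#X * #(X - X))) := by ring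
    _ ≤ L * (#(X - X) * p + #(X - X) * (#X * (K ^ 2 * #X))) := by gcongr
    _ = #(X - X) * (L * (1 * p + K ^ 2 * #X ^ 2)) := by ring
    _ ≤ #(X - X) * (L * (K ^ 20 * p + K ^ 20 * #X ^ 2)) := by gcongr
    _ = _ := by ring

end SumProduct

section BalogSzemerediGowers

variable {p : ℕ} [Fact p.Prime]

/-- Selection of a set most of whose pairs have many common neighbours. -/
lemma exists_popular_neighbourhood {V : Type*} [DecidableEq V] {D : Finset V} (r : V → V → Prop)
    [DecidableRel r] {α : ℝ} (hα : 0 < α) (hD : D.Nonempty)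
    (h : α * (#D : ℝ) ^ 2 ≤ #((D ×ˢ D).filter fun x => r x.1 x.2)) :
    ∃ A ⊆ D, α / 2 * #D ≤ #A ∧
      16 * (#((A ×ˢ A).filter fun x =>
        (#(D.filter fun z => r x.1 z ∧ r x.2 z) : ℝ) < α ^ 2 / 32 * #D) : ℝ) ≤ (#A : ℝ) ^ 2 := by
  set n : ℝ := (#D : ℝ) with hn
  have hn0 : 0 < n := Nat.cast_pos.2 (card_pos.2 hD)
  set N : V → Finset V := fun z => D.filter fun x => r x z with hN
  set bad : V × V → Prop := fun x =>
    (#(D.filter fun z => r x.1 z ∧ r x.2 z) : ℝ) < α ^ 2 / 32 * n with hbad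
  have h1 : ∑ z ∈ D, (#(N z) : ℝ) = #((D ×ˢ D).filter fun x => r x.1 x.2) := by
    rw [card_filter, sum_product_right]
    push_cast
    refine sum_congr rfl fun z _ => ?_
    rw [hN, card_filter]
    push_cast
    rfl
  have h2 : α ^ 2 * n ^ 3 ≤ ∑ z ∈ D, (#(N z) : ℝ) ^ 2 := by
    have h3 := sq_sum_le_card_mul_sum_sq (s := D) (f := fun z => (#(N z) : ℝ))
    rw [h1] at h3
    have h4 : (α * n ^ 2) ^ 2 ≤ n * ∑ z ∈ D, (#(N z) : ℝ) ^ 2 :=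
      (pow_le_pow_left₀ (by positivity) h 2).trans h3
    refine le_of_mul_le_mul_left ?_ hn0
    calc _ = (α * n ^ 2) ^ 2 := by ring
      _ ≤ _ := h4
  have h3 : ∑ z ∈ D, (#((N z ×ˢ N z).filter bad) : ℝ) ≤ α ^ 2 / 32 * n * n ^ 2 := by
    have h4 : ∀ z ∈ D, (#((N z ×ˢ N z).filter bad) : ℝ) =
        ∑ x ∈ (D ×ˢ D).filter bad, if r x.1 z ∧ r x.2 z then 1 else 0 := by
      intro z _
      rw [sum_boole, filter_filter]
      congr 2
      ext x
      simp only [hN, mem_filter, mem_product]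
      tauto
    rw [sum_congr rfl h4, sum_comm]
    calc _ ≤ ∑ x ∈ (D ×ˢ D).filter bad, α ^ 2 / 32 * n := by
          refine sum_le_sum fun x hx => ?_
          rw [sum_boole]
          exact (mem_filter.1 hx).2.le
      _ ≤ ∑ x ∈ (D ×ˢ D), α ^ 2 / 32 * n :=
          sum_le_sum_of_subset_of_nonneg (filter_subset _ _) fun _ _ _ => by positivity
      _ = _ := by rw [sum_const, card_product, nsmul_eq_mul]; push_cast; ring
  obtain ⟨z, hz, hz2⟩ : ∃ z ∈ D, α ^ 2 * n ^ 2 / 2 ≤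
      (#(N z) : ℝ) ^ 2 - 16 * #((N z ×ˢ N z).filter bad) := by
    refine exists_le_of_sum_le hD ?_
    rw [sum_const, sum_sub_distrib, ← mul_sum, nsmul_eq_mul]
    nlinarith
  refine ⟨N z, filter_subset _ _, ?_, ?_⟩
  · refine le_of_sq_le_sq ?_ (Nat.cast_nonneg _)
    have : (0 : ℝ) ≤ #((N z ×ˢ N z).filter bad) := Nat.cast_nonneg _
    nlinarith [sq_nonneg (α * n)]
  · nlinarith [sq_nonneg (α * n)]

open scoped Pointwise in
/-- The Balog-Szemerédi-Gowers theorem. -/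
theorem exists_subset_card_sub_le {D E : Finset (ZMod p)} (hD : D.Nonempty) {α L : ℝ} (hα : 0 < α)
    (hL : (#E : ℝ) ≤ L * #D)
    (h : α * (#D : ℝ) ^ 2 ≤ #((D ×ˢ D).filter fun x => x.1 - x.2 ∈ E)) :
    ∃ X ⊆ D, 3 * α / 8 * #D ≤ #X ∧ (#(X - X) : ℝ) ≤ 2 ^ 14 * L ^ 4 / α ^ 6 * #X := by
  classical
  obtain ⟨A, hAD, hA, hbad⟩ := exists_popular_neighbourhood (fun x y => x - y ∈ E) hα hD h
  set n : ℝ := (#D : ℝ) with hn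
  have hn0 : 0 < n := Nat.cast_pos.2 (card_pos.2 hD)
  set a : ℝ := (#A : ℝ) with ha
  have ha0 : 0 < a := lt_of_lt_of_le (by positivity) hA
  set β : ℝ := α ^ 2 / 32 with hβ
  set cn : ZMod p → ZMod p → Finset (ZMod p) :=
    fun x y => D.filter fun z => x - z ∈ E ∧ y - z ∈ E with hcn
  set bd : ZMod p → Finset (ZMod p) := fun x => A.filter fun y => (#(cn x y) : ℝ) < β * n with hbd
  set X := A.filter fun x => (#(bd x) : ℝ) ≤ a / 4 with hX
  have h1 : (#((A ×ˢ A).filter fun x => (#(cn x.1 x.2) : ℝ) < β * n) : ℝ) =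
      ∑ x ∈ A, (#(bd x) : ℝ) := by
    rw [card_filter, sum_product]
    push_cast
    refine sum_congr rfl fun x _ => ?_
    rw [hbd, card_filter]
    push_cast
    rfl
  have h2 : (#(A \ X) : ℝ) ≤ a / 4 := by
    have h3 : (#(A \ X) : ℝ) * (a / 4) ≤ a ^ 2 / 16 := by
      calc (#(A \ X) : ℝ) * (a / 4) = ∑ x ∈ A \ X, a / 4 := by rw [sum_const, nsmul_eq_mul]
        _ ≤ ∑ x ∈ A \ X, (#(bd x) : ℝ) := by
            refine sum_le_sum fun x hx => ?_
            rw [mem_sdiff, hX, mem_filter, not_and] at hx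
            exact (not_le.1 (hx.2 hx.1)).le
        _ ≤ ∑ x ∈ A, (#(bd x) : ℝ) :=
            sum_le_sum_of_subset_of_nonneg sdiff_subset fun _ _ _ => Nat.cast_nonneg _
        _ ≤ a ^ 2 / 16 := by rw [← h1]; linarith
    by_contra! h4
    nlinarith
  have hXA : X ⊆ A := filter_subset _ _
  have hXc : 3 / 4 * a ≤ #X := by
    have := card_sdiff_add_card_eq_card hXA
    have h5 : (#(A \ X) : ℝ) + #X = a := by rw [ha, ← this]; push_cast; rfl
    linarith
  have hX0 : 3 * α / 8 * n ≤ #X := by linarith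
  refine ⟨X, hXA.trans hAD, hX0, ?_⟩
  have hmem : ∀ d ∈ X - X, ∃ x : ZMod p × ZMod p, x.1 ∈ X ∧ x.2 ∈ X ∧ x.1 - x.2 = d := by
    intro d hd
    obtain ⟨x, hx, y, hy, e⟩ := mem_sub.1 hd
    exact ⟨(x, y), hx, hy, e⟩
  choose! g hg1 hg2 hg3 using hmem
  set T : ZMod p → Finset (ZMod p) := fun d => A.filter fun y =>
    ¬ (#(cn (g d).1 y) : ℝ) < β * n ∧ ¬ (#(cn (g d).2 y) : ℝ) < β * n with hT
  have hTc : ∀ d ∈ X - X, a / 2 ≤ #(T d) := by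
    intro d hd
    have h3 : A ⊆ T d ∪ (bd (g d).1 ∪ bd (g d).2) := by
      intro y hy
      simp only [hT, hbd, mem_union, mem_filter, hy, true_and]
      tauto
    have h4 := (card_le_card h3).trans (card_union_le _ _)
    have h5 := card_union_le (bd (g d).1) (bd (g d).2)
    have h6 := (mem_filter.1 (hg1 d hd)).2
    have h7 := (mem_filter.1 (hg2 d hd)).2
    have h8 : a ≤ #(T d) + (#(bd (g d).1) + #(bd (g d).2)) := by
      rw [ha]; exact_mod_cast h4.trans (by omega)
    linarith
  set S := (X - X).sigma fun d => (T d).sigma fun y => cn (g d).1 y ×ˢ cn (g d).2 y with hS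
  have hS1 : (#(X - X) : ℝ) * (a / 2 * (β * n) ^ 2) ≤ #S := by
    rw [hS, card_sigma]
    push_cast
    rw [← nsmul_eq_mul]
    refine card_nsmul_le_sum _ _ _ fun d hd => ?_
    rw [card_sigma]
    push_cast
    calc a / 2 * (β * n) ^ 2 ≤ #(T d) * (β * n) ^ 2 :=
          mul_le_mul_of_nonneg_right (hTc d hd) (sq_nonneg _)
      _ = #(T d) • (β * n) ^ 2 := by rw [nsmul_eq_mul]
      _ ≤ _ := by
          refine card_nsmul_le_sum _ _ _ fun y hy => ?_
          have hy' := (mem_filter.1 hy).2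
          rw [not_lt, not_lt] at hy'
          rw [card_product]
          push_cast
          rw [sq]
          exact mul_le_mul hy'.1 hy'.2 (by positivity) (by positivity)
  have hS2 : #S ≤ #E ^ 4 := by
    rw [show #E ^ 4 = #((E ×ˢ E) ×ˢ (E ×ˢ E)) by simp only [card_product]; ring]
    refine card_le_card_of_injOn (fun s => (((g s.1).1 - s.2.2.1, s.2.1 - s.2.2.1),
      (s.2.1 - s.2.2.2, (g s.1).2 - s.2.2.2))) ?_ ?_
    · rintro ⟨d, y, u, v⟩ hs
      simp only [hS, coe_sigma, Set.mem_sigma_iff, mem_coe, mem_product, hcn,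
        mem_filter] at hs
      simp only [coe_product, Set.mem_prod, mem_coe]
      tauto
    · rintro ⟨d, y, u, v⟩ hs ⟨d', y', u', v'⟩ hs' e
      simp only [hS, coe_sigma, Set.mem_sigma_iff, mem_coe] at hs hs'
      simp only [Prod.mk.injEq] at e
      obtain ⟨⟨e1, e2⟩, e3, e4⟩ := e
      have hd : d = d' := by
        rw [← hg3 d hs.1, ← hg3 d' hs'.1]
        linear_combination e1 - e2 + e3 - e4
      subst hd
      have hu : u = u' := by linear_combination -e1
      have hv : v = v' := by linear_combination -e4
      have hy : y = y' := by linear_combination e2 + hu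
      subst hu hv hy
      rfl
  have hE4 : (#E : ℝ) ^ 4 ≤ (L * n) ^ 4 := pow_le_pow_left₀ (Nat.cast_nonneg _) hL 4
  have hS3 : (#S : ℝ) ≤ (#E : ℝ) ^ 4 := by exact_mod_cast hS2
  have hfin : (#(X - X) : ℝ) * (a / 2 * (β * n) ^ 2) ≤ (L * n) ^ 4 :=
    hS1.trans (hS3.trans hE4)
  have hfin2 : (#(X - X) : ℝ) * (α ^ 5 * n ^ 3) ≤ 4096 * (L * n) ^ 4 := by
    have h4 : α ^ 5 * n ^ 3 ≤ 4096 * (a / 2 * (β * n) ^ 2) := by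
      rw [hβ]
      calc α ^ 5 * n ^ 3 = 2 * α ^ 4 * n ^ 2 * (α / 2 * n) := by ring
        _ ≤ 2 * α ^ 4 * n ^ 2 * a := mul_le_mul_of_nonneg_left hA (by positivity)
        _ = _ := by ring
    calc _ ≤ (#(X - X) : ℝ) * (4096 * (a / 2 * (β * n) ^ 2)) :=
          mul_le_mul_of_nonneg_left h4 (Nat.cast_nonneg _)
      _ = 4096 * ((#(X - X) : ℝ) * (a / 2 * (β * n) ^ 2)) := by ring
      _ ≤ _ := mul_le_mul_of_nonneg_left hfin (by norm_num)
  have hfin3 : (#(X - X) : ℝ) * α ^ 5 ≤ 4096 * L ^ 4 * n := by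
    refine le_of_mul_le_mul_right ?_ (pow_pos hn0 3)
    calc _ = (#(X - X) : ℝ) * (α ^ 5 * n ^ 3) := by ring
      _ ≤ _ := hfin2
      _ = _ := by ring
  rw [div_mul_eq_mul_div, le_div_iff₀ (pow_pos hα 6)]
  have hL4 : 0 ≤ L ^ 4 := by positivity
  calc (#(X - X) : ℝ) * α ^ 6 = ((#(X - X) : ℝ) * α ^ 5) * α := by ring
    _ ≤ (4096 * L ^ 4 * n) * α := mul_le_mul_of_nonneg_right hfin3 hα.le
    _ = 4096 * L ^ 4 * (8 / 3) * (3 * α / 8 * n) := by ring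
    _ ≤ 4096 * L ^ 4 * (8 / 3) * #X := mul_le_mul_of_nonneg_left hX0 (by positivity)
    _ ≤ 2 ^ 14 * L ^ 4 * #X := by
        have : (0 : ℝ) ≤ L ^ 4 * #X := by positivity
        nlinarith

/-- Many members of a family of dense sets have large intersection with one of them. -/
lemma exists_many_card_inter_ge {ι V : Type*} [DecidableEq ι] [DecidableEq V] {R : Finset ι}
    {Z : Finset V} {Y : ι → Finset V} (hR : R.Nonempty) (hZ : Z.Nonempty)
    (hY : ∀ i ∈ R, Y i ⊆ Z) {c : ℝ} (hc : 0 ≤ c) (hYc : ∀ i ∈ R, c * #Z ≤ #(Y i)) :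
    ∃ i₀ ∈ R, c ^ 2 / 2 * #R ≤
      #(R.filter fun i => c ^ 2 / 2 * (#Z : ℝ) ≤ #(Y i ∩ Y i₀)) := by
  set z : ℝ := (#Z : ℝ) with hz
  have hz0 : 0 < z := Nat.cast_pos.2 (card_pos.2 hZ)
  set r : ℝ := (#R : ℝ) with hr
  have h1 : ∑ v ∈ Z, (∑ i ∈ R, if v ∈ Y i then (1 : ℝ) else 0) = ∑ i ∈ R, (#(Y i) : ℝ) := by
    rw [sum_comm]
    refine sum_congr rfl fun i hi => ?_
    rw [sum_boole, filter_mem_eq_inter, inter_eq_right.2 (hY i hi)]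
  have h2 : ∑ v ∈ Z, (∑ i ∈ R, if v ∈ Y i then (1 : ℝ) else 0) ^ 2 =
      ∑ j ∈ R, ∑ i ∈ R, (#(Y i ∩ Y j) : ℝ) := by
    simp only [sq, sum_mul_sum]
    rw [sum_comm]
    refine sum_congr rfl fun j hj => ?_
    rw [sum_comm]
    refine sum_congr rfl fun i hi => ?_
    rw [← inter_eq_right.2 (inter_subset_left.trans (hY i hi)), ← filter_mem_eq_inter, ← sum_boole]
    refine sum_congr rfl fun v _ => ?_
    by_cases hi : v ∈ Y i <;> by_cases hj : v ∈ Y j <;> simp [hi, hj]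
  have h3 := sq_sum_le_card_mul_sum_sq (s := Z)
    (f := fun v => ∑ i ∈ R, if v ∈ Y i then (1 : ℝ) else 0)
  rw [h1, h2] at h3
  have h4 : r * (c * z) ≤ ∑ i ∈ R, (#(Y i) : ℝ) := by
    rw [hr, ← nsmul_eq_mul]
    exact card_nsmul_le_sum _ _ _ hYc
  have h5 : r * (c ^ 2 * r * z) ≤ ∑ j ∈ R, ∑ i ∈ R, (#(Y i ∩ Y j) : ℝ) := by
    refine le_of_mul_le_mul_left ?_ hz0
    calc _ = (r * (c * z)) ^ 2 := by ring
      _ ≤ _ := pow_le_pow_left₀ (by positivity) h4 2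
      _ ≤ _ := h3
  obtain ⟨j, hj, hj2⟩ : ∃ j ∈ R, c ^ 2 * r * z ≤ ∑ i ∈ R, (#(Y i ∩ Y j) : ℝ) := by
    refine exists_le_of_sum_le hR ?_
    rwa [sum_const, nsmul_eq_mul]
  refine ⟨j, hj, ?_⟩
  set R' := R.filter fun i => c ^ 2 / 2 * z ≤ #(Y i ∩ Y j) with hR'
  have h6 : ∑ i ∈ R, (#(Y i ∩ Y j) : ℝ) ≤ ∑ i ∈ R, ((if i ∈ R' then z else 0) + c ^ 2 / 2 * z) := by
    refine sum_le_sum fun i hi => ?_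
    split_ifs with h
    · have : (#(Y i ∩ Y j) : ℝ) ≤ z := by
        rw [hz]; exact_mod_cast card_le_card (inter_subset_left.trans (hY i hi))
      have : 0 ≤ c ^ 2 / 2 * z := by positivity
      linarith
    · rw [hR', mem_filter, not_and] at h
      linarith [not_le.1 (h hi)]
  rw [sum_add_distrib, ← sum_filter, filter_mem_eq_inter, inter_eq_right.2 (filter_subset _ _),
    sum_const, sum_const, nsmul_eq_mul, nsmul_eq_mul] at h6
  refine le_of_mul_le_mul_right ?_ hz0
  nlinarith

end BalogSzemerediGowers

section RichDilates

variable {p : ℕ} [Fact p.Prime]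

open scoped Pointwise in
lemma card_sub_mul_card_inter_le (A B : Finset (ZMod p)) :
    #(A - B) * #(A ∩ B) ≤ #(A - A) * #(B - B) :=
  (ruzsa_triangle_inequality_sub_sub_sub A (A ∩ B) B).trans
    (Nat.mul_le_mul (card_le_card (sub_subset_sub_left inter_subset_left))
      (card_le_card (sub_subset_sub_left inter_subset_right)))

open scoped Pointwise in
lemma image_mul_sub_image_mul (ξ : ZMod p) (A B : Finset (ZMod p)) :
    A.image (ξ * ·) - B.image (ξ * ·) = (A - B).image (ξ * ·) := by
  ext z
  simp only [mem_sub, mem_image]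
  constructor
  · rintro ⟨_, ⟨a, ha, rfl⟩, _, ⟨b, hb, rfl⟩, rfl⟩
    exact ⟨a - b, ⟨a, ha, b, hb, rfl⟩, mul_sub _ _ _⟩
  · rintro ⟨_, ⟨a, ha, b, hb, rfl⟩, rfl⟩
    exact ⟨ξ * a, ⟨a, ha, rfl⟩, ξ * b, ⟨b, hb, rfl⟩, (mul_sub _ _ _).symm⟩

open scoped Pointwise in
lemma card_image_mul_sub_image_mul_le (ξ : ZMod p) (A B : Finset (ZMod p)) :
    #(A.image (ξ * ·) - B.image (ξ * ·)) ≤ #(A - B) := by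
  rw [image_mul_sub_image_mul]
  exact card_image_le

open scoped Pointwise in
/-- From a family of structured sets to a single set nearly invariant under many dilations. -/
lemma exists_many_dilates {A R : Finset (ZMod p)} (hA : A.Nonempty) (hR : R.Nonempty)
    (hR0 : (0 : ZMod p) ∉ R) {X : ZMod p → Finset (ZMod p)} {c K : ℝ} (hc : 0 < c) (hK : 0 ≤ K)
    (h1 : ∀ ξ ∈ R, X ξ ⊆ A) (h2 : ∀ ξ ∈ R, (X ξ).image (ξ * ·) ⊆ A)
    (h3 : ∀ ξ ∈ R, c * #A ≤ #(X ξ)) (h4 : ∀ ξ ∈ R, (#(X ξ - X ξ) : ℝ) ≤ K * #(X ξ)) :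
    ∃ ξ₀ ∈ R, ∃ R' : Finset (ZMod p), 0 ∉ R' ∧ c ^ 4 / 2 * #R ≤ #R' ∧
      ∀ ζ ∈ R', (#(X ξ₀ - (X ξ₀).image (ζ * ·)) : ℝ) ≤ 4 * K ^ 4 / c ^ 10 * #(X ξ₀) := by
  classical
  set s : ℝ := (#A : ℝ) with hs
  have hs0 : 0 < s := Nat.cast_pos.2 (card_pos.2 hA)
  have hcard : ∀ ξ ∈ R, ∀ Y : Finset (ZMod p), #(Y.image (ξ * ·)) = #Y := fun ξ hξ Y =>
    card_image_of_injective _ (mul_right_injective₀ (ne_of_mem_of_not_mem hξ hR0))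
  obtain ⟨ξ₀, hξ₀, hcount⟩ := exists_many_card_inter_ge (c := c ^ 2) (Z := A ×ˢ A)
    (Y := fun ξ => X ξ ×ˢ (X ξ).image (ξ * ·)) hR (hA.product hA)
    (fun ξ hξ => product_subset_product (h1 ξ hξ) (h2 ξ hξ)) (by positivity)
    (fun ξ hξ => by
      rw [card_product, card_product, hcard ξ hξ]
      push_cast
      calc c ^ 2 * (s * s) = (c * s) * (c * s) := by ring
        _ ≤ _ := mul_le_mul (h3 ξ hξ) (h3 ξ hξ) (by positivity) (by positivity))
  have hξ₀0 : ξ₀ ≠ 0 := ne_of_mem_of_not_mem hξ₀ hR0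
  have hle : ∀ ξ ∈ R, (#(X ξ) : ℝ) ≤ s := fun ξ hξ =>
    Nat.cast_le.2 (card_le_card (h1 ξ hξ))
  have hdiff : ∀ ξ ∈ R, (#(X ξ - X ξ) : ℝ) ≤ K * s := fun ξ hξ =>
    (h4 ξ hξ).trans (mul_le_mul_of_nonneg_left (hle ξ hξ) hK)
  set κ : ℝ := c ^ 4 / 2 with hκ
  have hκ0 : 0 < κ := by positivity
  have hstep : ∀ B C : Finset (ZMod p), (#(B - B) : ℝ) ≤ K * s → (#(C - C) : ℝ) ≤ K * s →
      κ * s ≤ #(B ∩ C) → (#(B - C) : ℝ) ≤ K ^ 2 / κ * s := by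
    intro B C hB hC hBC
    rw [div_mul_eq_mul_div, le_div_iff₀ hκ0]
    refine le_of_mul_le_mul_right ?_ hs0
    calc (#(B - C) : ℝ) * κ * s = #(B - C) * (κ * s) := by ring
      _ ≤ #(B - C) * #(B ∩ C) := mul_le_mul_of_nonneg_left hBC (Nat.cast_nonneg _)
      _ ≤ #(B - B) * #(C - C) := by exact_mod_cast card_sub_mul_card_inter_le B C
      _ ≤ (K * s) * (K * s) := mul_le_mul hB hC (Nat.cast_nonneg _) (by positivity)
      _ = _ := by ring
  refine ⟨ξ₀, hξ₀, (R.filter fun ξ => (c ^ 2) ^ 2 / 2 * (#(A ×ˢ A) : ℝ) ≤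
    #((X ξ ×ˢ (X ξ).image (ξ * ·)) ∩ (X ξ₀ ×ˢ (X ξ₀).image (ξ₀ * ·)))).image (ξ₀⁻¹ * ·),
    ?_, ?_, ?_⟩
  · intro h
    obtain ⟨ξ, hξ, e⟩ := mem_image.1 h
    rcases mul_eq_zero.1 e with h | h
    · exact inv_ne_zero hξ₀0 h
    · exact hR0 (h ▸ (mem_filter.1 hξ).1)
  · rw [card_image_of_injective _ (mul_right_injective₀ (inv_ne_zero hξ₀0))]
    refine le_trans (le_of_eq ?_) hcount
    rw [hκ]
    ring
  · intro ζ hζ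
    obtain ⟨ξ, hξ, rfl⟩ := mem_image.1 hζ
    obtain ⟨hξ, hbig⟩ := mem_filter.1 hξ
    rw [product_inter_product, card_product, card_product, ← pow_mul] at hbig
    push_cast at hbig
    have hi1 : (#(X ξ ∩ X ξ₀) : ℝ) ≤ s :=
      Nat.cast_le.2 (card_le_card (inter_subset_left.trans (h1 ξ hξ)))
    have hi2 : (#((X ξ).image (ξ * ·) ∩ (X ξ₀).image (ξ₀ * ·)) : ℝ) ≤ s :=
      Nat.cast_le.2 (card_le_card (inter_subset_left.trans (h2 ξ hξ)))
    have hb1 : κ * s ≤ #(X ξ ∩ X ξ₀) := by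
      refine le_of_mul_le_mul_right ?_ hs0
      calc κ * s * s = c ^ (2 * 2) / 2 * (s * s) := by rw [hκ]; ring
        _ ≤ _ := hbig
        _ ≤ _ := mul_le_mul_of_nonneg_left hi2 (Nat.cast_nonneg _)
    have hb2 : κ * s ≤ #((X ξ).image (ξ * ·) ∩ (X ξ₀).image (ξ₀ * ·)) := by
      refine le_of_mul_le_mul_left ?_ hs0
      calc s * (κ * s) = c ^ (2 * 2) / 2 * (s * s) := by rw [hκ]; ring
        _ ≤ _ := hbig
        _ ≤ _ := mul_le_mul_of_nonneg_right hi1 (Nat.cast_nonneg _)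
    have hd : ∀ η, ∀ ξ ∈ R, (#((X ξ).image (η * ·) - (X ξ).image (η * ·)) : ℝ) ≤ K * s :=
      fun η ξ hξ => (Nat.cast_le.2 (card_image_mul_sub_image_mul_le η _ _)).trans (hdiff ξ hξ)
    have e1 := hstep ((X ξ₀).image (ξ₀ * ·)) ((X ξ).image (ξ * ·)) (hd _ _ hξ₀) (hd _ _ hξ)
      (by rwa [inter_comm])
    have e2 : (#((X ξ₀).image (ξ * ·) - (X ξ).image (ξ * ·)) : ℝ) ≤ K ^ 2 / κ * s :=
      (Nat.cast_le.2 (card_image_mul_sub_image_mul_le ξ _ _)).trans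
        (hstep _ _ (hdiff _ hξ₀) (hdiff _ hξ) (by rwa [inter_comm]))
    have e3 := ruzsa_triangle_inequality_sub_sub_sub ((X ξ₀).image (ξ₀ * ·))
      ((X ξ).image (ξ * ·)) ((X ξ₀).image (ξ * ·))
    rw [hcard ξ hξ] at e3
    have e4 : #(X ξ₀ - (X ξ₀).image (ξ₀⁻¹ * ξ * ·)) ≤
        #((X ξ₀).image (ξ₀ * ·) - (X ξ₀).image (ξ * ·)) := by
      rw [← hcard ξ₀ hξ₀ (X ξ₀ - _), ← image_mul_sub_image_mul, image_image]
      have : ((ξ₀ * ·) ∘ (ξ₀⁻¹ * ξ * ·) : ZMod p → ZMod p) = (ξ * ·) := by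
        funext x
        simp only [Function.comp]
        field_simp
      rw [this]
    have e5 : (#(X ξ₀ - (X ξ₀).image (ξ₀⁻¹ * ξ * ·)) : ℝ) * (c * s) ≤ (K ^ 2 / κ * s) ^ 2 := by
      calc _ ≤ (#((X ξ₀).image (ξ₀ * ·) - (X ξ₀).image (ξ * ·)) : ℝ) * #(X ξ) :=
            mul_le_mul (by exact_mod_cast e4) (h3 ξ hξ) (by positivity) (Nat.cast_nonneg _)
        _ ≤ #((X ξ₀).image (ξ₀ * ·) - (X ξ).image (ξ * ·)) *
            #((X ξ₀).image (ξ * ·) - (X ξ).image (ξ * ·)) := by exact_mod_cast e3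
        _ ≤ (K ^ 2 / κ * s) * (K ^ 2 / κ * s) :=
            mul_le_mul e1 e2 (Nat.cast_nonneg _) (by positivity)
        _ = _ := by ring
    have e6 : (#(X ξ₀ - (X ξ₀).image (ξ₀⁻¹ * ξ * ·)) : ℝ) ≤ 4 * K ^ 4 / c ^ 9 * s := by
      refine le_of_mul_le_mul_right ?_ (mul_pos hc hs0)
      refine e5.trans (le_of_eq ?_)
      rw [hκ]
      field_simp
      norm_num
    refine e6.trans ?_
    calc 4 * K ^ 4 / c ^ 9 * s = 4 * K ^ 4 / c ^ 10 * (c * s) := by field_simp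
      _ ≤ _ := mul_le_mul_of_nonneg_left (h3 _ hξ₀) (by positivity)

lemma IsPos.sq_sum_le {f : ZMod p → ℝ} (hf : IsPos f) (D : Finset (ZMod p)) :
    (∑ x ∈ D, f x) ^ 2 ≤ f 0 * ∑ x ∈ D, ∑ y ∈ D, f (x - y) := by
  have hp : (0 : ℝ) < p := by exact_mod_cast (Fact.out : p.Prime).pos
  set S : ZMod p → ℝ := fun ξ => ∑ x ∈ D, cs (x * ξ) with hS
  have h1 : p * ∑ x ∈ D, f x = ∑ ξ, ft f ξ * S ξ := by
    simp only [hS, mul_sum, ← sum_ft_mul_cs hf.even]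
    rw [sum_comm]
  have h2 : ∑ ξ, ft f ξ * S ξ ^ 2 ≤ p * ∑ x ∈ D, ∑ y ∈ D, f (x - y) := by
    have h3 : p * ∑ x ∈ D, ∑ y ∈ D, f (x - y) =
        ∑ ξ, ft f ξ * ∑ x ∈ D, ∑ y ∈ D, cs ((x - y) * ξ) := by
      simp only [mul_sum, ← sum_ft_mul_cs hf.even]
      rw [sum_comm (s := univ)]
      refine sum_congr rfl fun x _ => ?_
      rw [sum_comm]
    rw [h3]
    refine sum_le_sum fun ξ _ => mul_le_mul_of_nonneg_left ?_ (hf.ft_nonneg ξ)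
    set T : ℝ := ∑ x ∈ D, (ZMod.stdAddChar (x * ξ)).im with hT
    have h4 : ∑ x ∈ D, ∑ y ∈ D, cs ((x - y) * ξ) = S ξ ^ 2 + T ^ 2 := by
      rw [sq, sq, hS, hT]
      simp only [sum_mul_sum, ← sum_add_distrib]
      refine sum_congr rfl fun x _ => sum_congr rfl fun y _ => ?_
      simp only [cs, sub_eq_add_neg, add_mul, neg_mul, AddChar.map_add_eq_mul, stdAddChar_neg,
        Complex.mul_re, Complex.conj_re, Complex.conj_im]
      ring
    nlinarith [sq_nonneg T]
  have h3 : (∑ ξ, ft f ξ * S ξ) ^ 2 ≤ (∑ ξ, ft f ξ) * ∑ ξ, ft f ξ * S ξ ^ 2 :=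
    sum_sq_le_sum_mul_sum_of_sq_le_mul _ (fun ξ _ => hf.ft_nonneg ξ)
      (fun ξ _ => mul_nonneg (hf.ft_nonneg ξ) (sq_nonneg _)) fun ξ _ => le_of_eq (by ring)
  rw [← h1, sum_ft hf.even] at h3
  have h4 := h3.trans (mul_le_mul_of_nonneg_left h2
    (mul_nonneg hp.le hf.apply_zero_pos.le))
  refine le_of_mul_le_mul_left ?_ (mul_pos hp hp)
  calc _ = (p * ∑ x ∈ D, f x) ^ 2 := by ring
    _ ≤ _ := h4
    _ = _ := by ring

open scoped Pointwise in
/-- A correlation of `f` with one of its dilates produces a structured set. -/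
lemma IsPos.exists_structured {f : ZMod p → ℝ} (hf : IsPos f) {θ : ℝ} (hθ : 0 < θ)
    {ξ : ZMod p} (hξ : ξ ≠ 0) (h : θ * f 0 ≤ ∑ y, f y * f (ξ * y)) :
    ∃ X : Finset (ZMod p), X ⊆ univ.filter (fun y => θ / 4 * f 0 ≤ f y) ∧
      X.image (ξ * ·) ⊆ univ.filter (fun y => θ / 4 * f 0 ≤ f y) ∧
      θ ^ 4 / 2 ^ 10 * #(univ.filter fun y => θ / 4 * f 0 ≤ f y) ≤ #X ∧
      θ ^ 3 ≤ 2 ^ 8 * f 0 * #X ∧ (#(X - X) : ℝ) ≤ 2 ^ 68 / θ ^ 24 * #X := by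
  have hf0 := hf.apply_zero_pos
  set A := univ.filter fun y => θ / 4 * f 0 ≤ f y with hA
  set D := univ.filter fun y => θ / 4 * f 0 ≤ f y ∧ θ / 4 * f 0 ≤ f (ξ * y) with hD
  set E := univ.filter fun y => θ ^ 2 / 32 * f 0 ≤ f y with hE
  have hmark : ∀ c : ℝ, c * f 0 * #(univ.filter fun y => c * f 0 ≤ f y) ≤ 1 := by
    intro c
    rw [← hf.sum_eq, mul_comm, ← nsmul_eq_mul]
    exact (card_nsmul_le_sum _ _ _ fun y hy => (mem_filter.1 hy).2).trans
      (sum_le_sum_of_subset_of_nonneg (subset_univ _) fun y _ _ => hf.nonneg y)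
  have hD1 : θ / 2 ≤ #D * f 0 := by
    have h1 : ∑ y, f y * f (ξ * y) ≤ ∑ y, ((if y ∈ D then f 0 * f 0 else 0) +
        θ / 4 * f 0 * f (ξ * y) + θ / 4 * f 0 * f y) := by
      refine sum_le_sum fun y _ => ?_
      have p1 := hf.nonneg y
      have p2 := hf.nonneg (ξ * y)
      have p3 : 0 ≤ θ / 4 * f 0 := by positivity
      split_ifs with hy
      · have := mul_le_mul (hf.le_apply_zero y) (hf.le_apply_zero (ξ * y)) p2 hf0.le
        nlinarith [mul_nonneg p3 p1, mul_nonneg p3 p2]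
      · rw [hD, mem_filter, not_and_or, not_and_or] at hy
        rcases hy with hy | hy | hy
        · simp at hy
        · nlinarith [mul_nonneg p3 p1, mul_le_mul_of_nonneg_right (not_le.1 hy).le p2]
        · nlinarith [mul_nonneg p3 p2, mul_le_mul_of_nonneg_left (not_le.1 hy).le p1]
    have h2 : ∑ y, f (ξ * y) = 1 := by
      rw [← hf.sum_eq]
      exact Equiv.sum_comp (Equiv.mulLeft₀ ξ hξ) f
    rw [sum_add_distrib, sum_add_distrib, ← mul_sum, ← mul_sum, h2, hf.sum_eq, sum_ite_mem,
      univ_inter, sum_const, nsmul_eq_mul] at h1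
    refine le_of_mul_le_mul_right ?_ hf0
    nlinarith
  have hDne : D.Nonempty := by
    rw [nonempty_iff_ne_empty]
    intro h0
    rw [h0] at hD1
    simp at hD1
    linarith
  have hpairs : θ ^ 2 / 32 * (#D : ℝ) ^ 2 ≤ #((D ×ˢ D).filter fun x => x.1 - x.2 ∈ E) := by
    have h1 := hf.sq_sum_le D
    have h2 : #D * (θ / 4 * f 0) ≤ ∑ x ∈ D, f x := by
      rw [← nsmul_eq_mul]
      exact card_nsmul_le_sum _ _ _ fun y hy => (mem_filter.1 hy).2.1
    have h3 : ∑ x ∈ D, ∑ y ∈ D, f (x - y) ≤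
        f 0 * #((D ×ˢ D).filter fun x => x.1 - x.2 ∈ E) + θ ^ 2 / 32 * f 0 * (#D : ℝ) ^ 2 := by
      rw [← sum_product' (f := fun x y => f (x - y))]
      calc _ ≤ ∑ x ∈ D ×ˢ D, ((if x.1 - x.2 ∈ E then f 0 else 0) + θ ^ 2 / 32 * f 0) := by
            refine sum_le_sum fun x _ => ?_
            split_ifs with hx
            · have := hf.le_apply_zero (x.1 - x.2)
              have : 0 ≤ θ ^ 2 / 32 * f 0 := by positivity
              linarith
            · rw [hE, mem_filter, not_and] at hx
              have := not_le.1 (hx (mem_univ _))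
              linarith
        _ = _ := by
            rw [sum_add_distrib, ← sum_filter, sum_const, sum_const, card_product, nsmul_eq_mul,
              nsmul_eq_mul]
            push_cast
            ring
    have h4 := (pow_le_pow_left₀ (by positivity) h2 2).trans
      (h1.trans (mul_le_mul_of_nonneg_left h3 hf0.le))
    refine le_of_mul_le_mul_left ?_ (mul_pos hf0 hf0)
    nlinarith
  have hEL : (#E : ℝ) ≤ 64 / θ ^ 3 * #D := by
    have h1 := hmark (θ ^ 2 / 32)
    rw [div_mul_eq_mul_div, le_div_iff₀ (by positivity)]
    refine le_of_mul_le_mul_right ?_ hf0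
    have h2 : θ ^ 2 * f 0 * #E ≤ 32 := by linarith
    calc (#E : ℝ) * θ ^ 3 * f 0 = θ * (θ ^ 2 * f 0 * #E) := by ring
      _ ≤ θ * 32 := mul_le_mul_of_nonneg_left h2 hθ.le
      _ ≤ 64 * (#D * f 0) := by linarith
      _ = _ := by ring
  obtain ⟨X, hXD, hX1, hX2⟩ := exists_subset_card_sub_le hDne (by positivity) hEL hpairs
  have hX3 : θ ^ 2 / 2 ^ 7 * #D ≤ #X := by
    have : (0 : ℝ) ≤ θ ^ 2 * #D := by positivity
    linarith
  refine ⟨X, fun x hx => ?_, fun x hx => ?_, ?_, ?_, ?_⟩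
  · rw [hA, mem_filter]
    exact ⟨mem_univ _, (mem_filter.1 (hXD hx)).2.1⟩
  · obtain ⟨y, hy, rfl⟩ := mem_image.1 hx
    rw [hA, mem_filter]
    exact ⟨mem_univ _, (mem_filter.1 (hXD hy)).2.2⟩
  · refine le_trans ?_ hX3
    have h1 := hmark (θ / 4)
    rw [← hA] at h1
    refine le_of_mul_le_mul_right ?_ hf0
    have h2 : θ ^ 3 * (θ / 4 * f 0 * #A) ≤ θ ^ 3 * 1 :=
      mul_le_mul_of_nonneg_left h1 (by positivity)
    have h3 : θ ^ 2 * (θ / 2) ≤ θ ^ 2 * (#D * f 0) :=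
      mul_le_mul_of_nonneg_left hD1 (by positivity)
    nlinarith
  · have h3 : θ ^ 2 * (θ / 2) ≤ θ ^ 2 * (#D * f 0) :=
      mul_le_mul_of_nonneg_left hD1 (by positivity)
    have h4 := mul_le_mul_of_nonneg_right hX3 hf0.le
    nlinarith
  · refine hX2.trans (le_of_eq ?_)
    congr 1
    field_simp
    norm_num

/-- A positive measure cannot correlate with too many of its dilates. -/
theorem IsPos.rich_dilates {f : ZMod p → ℝ} (hf : IsPos f) {θ : ℝ} (hθ : 0 < θ) (hθ1 : θ ≤ 1)
    (k : ℕ) {R : Finset (ZMod p)} (hR0 : (0 : ZMod p) ∉ R)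
    (hR : ∀ ξ ∈ R, θ * f 0 ≤ ∑ y, f y * f (ξ * y)) (hR2 : 2 ≤ θ ^ 16 / 2 ^ 41 * #R)
    (hp : (p : ℝ) < (θ ^ 16 / 2 ^ 41 * #R) ^ 2 ^ k) :
    θ ^ 3 ≤ 2 ^ 8 * (2 ^ 375 / θ ^ 136) ^ (88 * 7 ^ k + 30) * (f 0 + 1 / (p * f 0)) := by
  classical
  have hp0 : (0 : ℝ) < p := by exact_mod_cast (Fact.out : p.Prime).pos
  have hf0 := hf.apply_zero_pos
  have hex : ∀ ξ ∈ R, _ := fun ξ hξ =>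
    hf.exists_structured hθ (ne_of_mem_of_not_mem hξ hR0) (hR ξ hξ)
  choose! X h1 h2 h3 h4 h5 using hex
  set A := univ.filter fun y => θ / 4 * f 0 ≤ f y with hA
  have hAne : A.Nonempty := ⟨0, mem_filter.2 ⟨mem_univ _, by nlinarith⟩⟩
  have hRne : R.Nonempty := by
    rw [nonempty_iff_ne_empty]
    rintro rfl
    simp at hR2
    linarith
  obtain ⟨ξ₀, hξ₀, R', hR'0, hR'c, hR'⟩ := exists_many_dilates hAne hRne hR0
    (by positivity : 0 < θ ^ 4 / 2 ^ 10) (by positivity) h1 h2 h3 h5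
  have hcc : θ ^ 16 / 2 ^ 41 * #R ≤ #R' := by
    refine le_trans (le_of_eq ?_) hR'c
    ring
  set Kr : ℝ := 2 ^ 375 / θ ^ 136 with hKr
  have hθ136 : θ ^ 136 ≤ 1 := pow_le_one₀ hθ.le hθ1
  have hKr2 : 4 * (2 ^ 68 / θ ^ 24) ^ 4 / (θ ^ 4 / 2 ^ 10) ^ 10 + 1 ≤ Kr := by
    have e : 4 * (2 ^ 68 / θ ^ 24) ^ 4 / (θ ^ 4 / 2 ^ 10) ^ 10 = 2 ^ 374 / θ ^ 136 := by
      field_simp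
      norm_num
    rw [e, hKr, div_add_one (by positivity)]
    gcongr
    have h6 : (1 : ℝ) ≤ 2 ^ 374 := one_le_pow₀ (by norm_num)
    rw [pow_succ (2 : ℝ) 374]
    generalize (2 : ℝ) ^ 374 = T at h6 ⊢
    linarith
  set K := ⌊Kr⌋₊ with hK
  have hKr0 : 0 ≤ Kr := by positivity
  have hKle : (K : ℝ) ≤ Kr := Nat.floor_le hKr0
  have hX0pos : 0 < (#(X ξ₀) : ℝ) := by
    by_contra! hcon
    have := h4 ξ₀ hξ₀
    have h6 : 0 < θ ^ 3 := by positivity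
    nlinarith
  have hsp := mul_card_le_of_card_sub_dilate_le (X := X ξ₀) (R := R') (K := K)
    (card_pos.1 (by exact_mod_cast hX0pos)) k hR'0 (by exact_mod_cast hR2.trans hcc)
    (by exact_mod_cast hp.trans_le (pow_le_pow_left₀ (by linarith) hcc _)) (by
      intro ζ hζ
      have h6 := hR' ζ hζ
      have h7 : 4 * (2 ^ 68 / θ ^ 24) ^ 4 / (θ ^ 4 / 2 ^ 10) ^ 10 ≤ K :=
        le_of_add_le_add_right (hKr2.trans (Nat.lt_floor_add_one Kr).le)
      exact_mod_cast h6.trans (mul_le_mul_of_nonneg_right h7 (Nat.cast_nonneg _)))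
  set C := 88 * 7 ^ k + 30
  have hspr : (p : ℝ) * #(X ξ₀) ≤ (K : ℝ) ^ C * (p + (#(X ξ₀) : ℝ) ^ 2) := by exact_mod_cast hsp
  have hspr2 : (p : ℝ) * #(X ξ₀) ≤ Kr ^ C * (p + (#(X ξ₀) : ℝ) ^ 2) :=
    hspr.trans (mul_le_mul_of_nonneg_right (pow_le_pow_left₀ (Nat.cast_nonneg _) hKle _)
      (by positivity))
  set x : ℝ := (#(X ξ₀) : ℝ) with hx
  have hlow := h4 ξ₀ hξ₀
  have hup : θ * f 0 * x ≤ 4 := by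
    have h6 : x * (θ / 4 * f 0) ≤ 1 := by
      rw [← hf.sum_eq, hx, ← nsmul_eq_mul]
      exact (card_nsmul_le_sum _ _ _ fun y hy => (mem_filter.1 (h1 ξ₀ hξ₀ hy)).2).trans
        (sum_le_sum_of_subset_of_nonneg (subset_univ _) fun y _ _ => hf.nonneg y)
    linarith
  have hup2 : θ ^ 3 * x ≤ 2 ^ 8 / f 0 := by
    rw [le_div_iff₀ hf0]
    calc θ ^ 3 * x * f 0 = θ ^ 2 * (θ * f 0 * x) := by ring
      _ ≤ 1 * 4 := mul_le_mul (pow_le_one₀ hθ.le hθ1) hup (by positivity) zero_le_one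
      _ ≤ _ := by norm_num
  refine le_of_mul_le_mul_right ?_ (mul_pos hp0 hX0pos)
  calc θ ^ 3 * (p * x) ≤ θ ^ 3 * (Kr ^ C * (p + x ^ 2)) :=
        mul_le_mul_of_nonneg_left hspr2 (by positivity)
    _ = Kr ^ C * (p * θ ^ 3 + x * (θ ^ 3 * x)) := by ring
    _ ≤ Kr ^ C * (p * (2 ^ 8 * f 0 * x) + x * (2 ^ 8 / f 0)) := by gcongr
    _ = _ := by field_simp

end RichDilates

section Trilinear

variable {p : ℕ} [Fact p.Prime]

/-- The trilinear form `∑ μ(a) ν(b) χ(c) cos (2 π a b c / p)`. -/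
noncomputable def tri (μ ν χ : ZMod p → ℝ) : ℝ := ∑ c, χ c * ∑ b, ν b * ft μ (b * c)

lemma IsPos.sum_mul_ft_nonneg {μ ν : ZMod p → ℝ} (hμ : IsPos μ) (hν : IsPos ν) (c : ZMod p) :
    0 ≤ ∑ b, ν b * ft μ (b * c) :=
  sum_nonneg fun _ _ => mul_nonneg (hν.nonneg _) (hμ.ft_nonneg _)

lemma IsPos.sum_mul_ft_le_one {μ ν : ZMod p → ℝ} (hμ : IsPos μ) (hν : IsPos ν) (c : ZMod p) :
    ∑ b, ν b * ft μ (b * c) ≤ 1 := by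
  rw [← hν.sum_eq]
  exact sum_le_sum fun b _ => mul_le_of_le_one_right (hν.nonneg _) (hμ.ft_le_one _)

lemma sum_erase_mul_dilate (F G : ZMod p → ℝ) (H : ZMod p → ZMod p → ℝ) :
    ∑ e ∈ univ.erase 0, ∑ b ∈ univ.erase 0, F b * G (e * b) * H b (e * b) =
      ∑ b ∈ univ.erase 0, F b * ∑ a ∈ univ.erase 0, G a * H b a := by
  rw [sum_comm]
  refine sum_congr rfl fun b hb => ?_
  have hb0 := (mem_erase.1 hb).1
  rw [mul_sum]
  refine sum_nbij' (fun e => e * b) (fun a => a * b⁻¹) ?_ ?_ ?_ ?_ ?_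
  · intro e he
    simp only [mem_erase, mem_univ, and_true] at he ⊢
    exact mul_ne_zero he hb0
  · intro e he
    simp only [mem_erase, mem_univ, and_true] at he ⊢
    exact mul_ne_zero he (inv_ne_zero hb0)
  · intro e _
    field_simp
  · intro e _
    field_simp
  · intro e _
    ring

/-- One step of the density increment for trilinear forms. -/
lemma trilinear_step {μ ν χ : ZMod p → ℝ} (hμ : IsPos μ) (hν : IsPos ν) (hχ : IsPos χ)
    {σ ρ T : ℝ} (hT : T = tri μ ν χ) (hT0 : 0 < T) (hρ : 0 < ρ)
    (hσ : p * (μ 0 * ν 0 * χ 0) ≤ σ) (hσT : 32 * σ ≤ T ^ 4) (hμ0 : μ 0 ≤ T ^ 2 / 4)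
    (hν0 : ν 0 ≤ T ^ 2 / 4) :
    (∃ e : ZMod p, e ≠ 0 ∧ shiftConv e μ ν 0 ≤ ρ * μ 0 ∧
      T ^ 2 / 8 ≤ tri (shiftConv e μ ν) (dilMul e μ ν) χ ∧
      dilMul e μ ν 0 ≤ 16 * σ / T ^ 4) ∨
    (T ^ 4 ≤ 16 * (p * (χ 0 * μ 0)) ∧ ∃ R : Finset (ZMod p), 0 ∉ R ∧
      (∀ ξ ∈ R, T ^ 2 / 16 * ρ * μ 0 ≤ ∑ y, μ y * μ (ξ * y)) ∧ T ^ 2 / 16 * ρ ≤ #R * ν 0) := by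
  classical
  have hp : (0 : ℝ) < p := by exact_mod_cast (Fact.out : p.Prime).pos
  have hμ00 := hμ.apply_zero_pos
  have hν00 := hν.apply_zero_pos
  have hχ00 := hχ.apply_zero_pos
  set Z := (univ : Finset (ZMod p)).erase 0 with hZ
  set W : ZMod p → ℝ := fun e => ∑ b ∈ Z, ν b * μ (e * b) with hW
  set g : ZMod p → ZMod p → ℝ := fun e b => ∑ c, χ c * ft (shiftConv e μ ν) (c * b) with hg
  set X : ZMod p → ℝ := fun e => ∑ b ∈ Z, ν b * μ (e * b) * g e b with hX
  have hnn : ∀ e b, 0 ≤ ν b * μ (e * b) := fun e b => mul_nonneg (hν.nonneg _) (hμ.nonneg _)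
  have hW0 : ∀ e, 0 ≤ W e := fun e => sum_nonneg fun b _ => hnn e b
  have hsc : ∀ e, IsPos (shiftConv e μ ν) := fun e => hμ.shiftConv hν e
  have hg1 : ∀ e b, g e b ≤ 1 := fun e b => (hsc e).sum_mul_ft_le_one hχ b
  have hg0 : ∀ e b, 0 ≤ g e b := fun e b => (hsc e).sum_mul_ft_nonneg hχ b
  have hXW : ∀ e, X e ≤ W e := fun e =>
    sum_le_sum fun b _ => mul_le_of_le_one_right (hnn e b) (hg1 e b)
  have hWfull : ∀ e, shiftConv e μ ν 0 = W e + ν 0 * μ 0 := by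
    intro e
    rw [shiftConv_apply_zero hμ.even, ← sum_erase_add _ _ (mem_univ (0 : ZMod p)), mul_zero]
  have hWle : ∀ e, shiftConv e μ ν 0 ≤ μ 0 := by
    intro e
    rw [shiftConv_apply_zero hμ.even]
    calc _ ≤ ∑ b, ν b * μ 0 :=
          sum_le_sum fun b _ => mul_le_mul_of_nonneg_left (hμ.le_apply_zero _) (hν.nonneg _)
      _ = _ := by rw [← sum_mul, hν.sum_eq, one_mul]
  have hsum0 : ∀ {f : ZMod p → ℝ}, IsPos f → ∑ b ∈ Z, f b = 1 - f 0 := by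
    intro f hf
    rw [← hf.sum_eq, ← sum_erase_add _ _ (mem_univ (0 : ZMod p))]
    ring
  have hWsum : ∑ e ∈ Z, W e ≤ 1 := by
    have h := sum_erase_mul_dilate ν μ fun _ _ => 1
    simp only [mul_one] at h
    rw [hW, h, ← sum_mul, hsum0 hμ, hsum0 hν]
    have := hμ.apply_zero_le_one
    have := hν.apply_zero_le_one
    nlinarith
  have hT1 : T ≤ 1 := by
    rw [hT, ← hχ.sum_eq]
    exact sum_le_sum fun c _ =>
      mul_le_of_le_one_right (hχ.nonneg _) (hμ.sum_mul_ft_le_one hν c)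
  have hXsum : T ^ 2 / 2 ≤ ∑ e ∈ Z, X e := by
    set t : ZMod p → ℝ := fun c => ∑ b, ν b * ft μ (b * c) with ht
    have h1 : ∑ e ∈ Z, X e = ∑ c, χ c * ((t c - ν 0) * (t c - μ 0)) := by
      have h2 : ∀ c, ∑ e ∈ Z, ∑ b ∈ Z, ν b * μ (e * b) * ft (shiftConv e μ ν) (c * b) =
          (t c - ν 0) * (t c - μ 0) := by
        intro c
        have h3 := sum_erase_mul_dilate ν μ fun b a => ft μ (b * c) * ft ν (a * c)
        have h4 : t c - ν 0 = ∑ b ∈ Z, ν b * ft μ (b * c) := by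
          rw [ht]
          simp only
          rw [← sum_erase_add _ _ (mem_univ (0 : ZMod p)), zero_mul, hμ.ft_zero]
          ring
        have h5 : t c - μ 0 = ∑ b ∈ Z, μ b * ft ν (b * c) := by
          rw [ht]
          simp only
          rw [sum_mul_ft_comm, ← sum_erase_add _ _ (mem_univ (0 : ZMod p)), zero_mul, hν.ft_zero]
          ring
        rw [h4, h5, sum_mul]
        refine Eq.trans ?_ (h3.trans ?_)
        · refine sum_congr rfl fun e _ => sum_congr rfl fun b _ => ?_
          rw [ft_shiftConv hμ.even, mul_comm c b, mul_assoc e b c]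
        · refine sum_congr rfl fun b _ => ?_
          rw [mul_assoc]
          congr 1
          rw [mul_sum]
          exact sum_congr rfl fun a _ => by ring
      simp only [← h2, hX, hg, mul_sum]
      rw [sum_comm (s := univ)]
      refine sum_congr rfl fun e _ => ?_
      rw [sum_comm (s := univ)]
      exact sum_congr rfl fun b _ => sum_congr rfl fun c _ => by ring
    have h2 : T = ∑ c, χ c * t c := hT
    have h3 : T ^ 2 ≤ ∑ c, χ c * t c ^ 2 := by
      have := sum_sq_le_sum_mul_sum_of_sq_le_mul univ (r := fun c => χ c * t c) (f := χ)
        (g := fun c => χ c * t c ^ 2) (fun c _ => hχ.nonneg c)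
        (fun c _ => mul_nonneg (hχ.nonneg c) (sq_nonneg _)) fun c _ => le_of_eq (by ring)
      rwa [← h2, hχ.sum_eq, one_mul] at this
    have h4 : ∑ c, χ c * ((t c - ν 0) * (t c - μ 0)) =
        ∑ c, χ c * t c ^ 2 - (ν 0 + μ 0) * T + ν 0 * μ 0 := by
      rw [h2, mul_sum, ← sum_sub_distrib, ← mul_one (ν 0 * μ 0), ← hχ.sum_eq, mul_sum,
        ← sum_add_distrib]
      exact sum_congr rfl fun c _ => by ring
    rw [h1, h4]
    nlinarith [mul_pos hν00 hμ00]
  set G := Z.filter fun e => T ^ 2 / 4 * W e ≤ X e ∧ 0 < W e with hG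
  have hGW : T ^ 2 / 4 ≤ ∑ e ∈ G, W e := by
    have h1 : ∑ e ∈ Z, X e ≤ ∑ e ∈ Z, ((if e ∈ G then W e else 0) + T ^ 2 / 4 * W e) := by
      refine sum_le_sum fun e he => ?_
      have h3 : 0 ≤ T ^ 2 / 4 * W e := mul_nonneg (by positivity) (hW0 e)
      split_ifs with h
      · have := hXW e
        linarith
      · rw [hG, mem_filter, not_and, not_and_or] at h
        rcases h he with h | h
        · linarith
        · have := hXW e
          have : W e = 0 := le_antisymm (not_lt.1 h) (hW0 e)
          linarith
    rw [sum_add_distrib, ← mul_sum, ← sum_filter, filter_mem_eq_inter,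
      inter_eq_right.2 (filter_subset _ _)] at h1
    have : T ^ 2 / 4 * ∑ e ∈ Z, W e ≤ T ^ 2 / 4 * 1 :=
      mul_le_mul_of_nonneg_left hWsum (by positivity)
    linarith
  have hGprop : ∀ e ∈ G, T ^ 4 ≤ 16 * (p * (χ 0 * shiftConv e μ ν 0)) ∧
      shiftConv e μ ν 0 ≤ 2 * W e ∧ ν 0 * μ 0 * T ^ 4 ≤ 16 * σ * shiftConv e μ ν 0 := by
    intro e he
    obtain ⟨heZ, he1, he2⟩ := mem_filter.1 he
    have hs := (hsc e).apply_zero_pos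
    have h1 : T ^ 4 ≤ 16 * (p * (χ 0 * shiftConv e μ ν 0)) := by
      have h2 : X e ≤ W e * √(p * (χ 0 * shiftConv e μ ν 0)) := by
        rw [hW]
        simp only
        rw [sum_mul]
        refine sum_le_sum fun b hb => mul_le_mul_of_nonneg_left ?_ (hnn e b)
        exact Real.le_sqrt_of_sq_le (hχ.bilinear_sq_le (hsc e) (mem_erase.1 hb).1)
      have h3 : T ^ 2 / 4 ≤ √(p * (χ 0 * shiftConv e μ ν 0)) := by
        refine le_of_mul_le_mul_left ?_ he2
        linarith
      have h4 := (Real.le_sqrt (by positivity) (by positivity)).1 h3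
      linarith
    have h2 : ν 0 * μ 0 * T ^ 4 ≤ 16 * σ * shiftConv e μ ν 0 := by
      calc ν 0 * μ 0 * T ^ 4 ≤ ν 0 * μ 0 * (16 * (p * (χ 0 * shiftConv e μ ν 0))) :=
            mul_le_mul_of_nonneg_left h1 (by positivity)
        _ = 16 * (p * (μ 0 * ν 0 * χ 0)) * shiftConv e μ ν 0 := by ring
        _ ≤ _ := by gcongr
    refine ⟨h1, ?_, h2⟩
    have h3 : ν 0 * μ 0 ≤ shiftConv e μ ν 0 / 2 := by
      refine le_of_mul_le_mul_right ?_ (pow_pos hT0 4)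
      nlinarith
    have := hWfull e
    linarith
  by_cases hcase : ∃ e ∈ G, shiftConv e μ ν 0 ≤ ρ * μ 0
  · obtain ⟨e, he, hes⟩ := hcase
    obtain ⟨heZ, he1, he2⟩ := mem_filter.1 he
    obtain ⟨h1, h2, h3⟩ := hGprop e he
    have hs := (hsc e).apply_zero_pos
    refine Or.inl ⟨e, (mem_erase.1 heZ).1, hes, ?_, ?_⟩
    · have h4 : X e ≤ shiftConv e μ ν 0 * tri (shiftConv e μ ν) (dilMul e μ ν) χ := by
        have h5 : shiftConv e μ ν 0 * tri (shiftConv e μ ν) (dilMul e μ ν) χ =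
            ∑ b, ν b * μ (e * b) * g e b := by
          simp only [tri, hg, dilMul, mul_sum]
          rw [sum_comm]
          refine sum_congr rfl fun b _ => sum_congr rfl fun c _ => ?_
          rw [mul_comm b c]
          field_simp
        rw [h5]
        exact sum_le_sum_of_subset_of_nonneg (subset_univ _) fun b _ _ =>
          mul_nonneg (hnn e b) (hg0 e b)
      refine le_of_mul_le_mul_left ?_ hs
      have h5 : T ^ 2 / 8 * shiftConv e μ ν 0 ≤ T ^ 2 / 8 * (2 * W e) :=
        mul_le_mul_of_nonneg_left h2 (by positivity)
      linarith
    · rw [dilMul_apply_zero, div_le_div_iff₀ hs (pow_pos hT0 4)]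
      exact h3
  · right
    push Not at hcase
    have hGne : G.Nonempty := by
      rw [nonempty_iff_ne_empty]
      intro h
      rw [h, sum_empty] at hGW
      have : 0 < T ^ 2 := by positivity
      linarith
    obtain ⟨e₀, he₀⟩ := hGne
    refine ⟨(hGprop e₀ he₀).1.trans ?_, ?_⟩
    · have := hWle e₀
      gcongr
    set w : ZMod p → ℝ := fun ξ => ∑ y, μ y * μ (ξ * y) with hw
    set θ := T ^ 2 / 16 * ρ with hθ
    have hw0 : ∀ ξ, 0 ≤ w ξ := fun ξ =>
      sum_nonneg fun y _ => mul_nonneg (hμ.nonneg _) (hμ.nonneg _)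
    have hwle : ∀ ξ, w ξ ≤ μ 0 := by
      intro ξ
      calc w ξ ≤ ∑ y, μ y * μ 0 :=
            sum_le_sum fun y _ => mul_le_mul_of_nonneg_left (hμ.le_apply_zero _) (hμ.nonneg _)
        _ = μ 0 := by rw [← sum_mul, hμ.sum_eq, one_mul]
    set V : ZMod p → ℝ := fun ξ => ∑ b ∈ Z, ν b * ν (ξ * b) with hV
    have hV0 : ∀ ξ, 0 ≤ V ξ := fun ξ =>
      sum_nonneg fun y _ => mul_nonneg (hν.nonneg _) (hν.nonneg _)
    have hVle : ∀ ξ, V ξ ≤ ν 0 := by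
      intro ξ
      calc V ξ ≤ ∑ y ∈ Z, ν y * ν 0 :=
            sum_le_sum fun y _ => mul_le_mul_of_nonneg_left (hν.le_apply_zero _) (hν.nonneg _)
        _ ≤ ν 0 := by rw [← sum_mul, hsum0 hν]; nlinarith
    have hVsum : ∑ ξ ∈ Z, V ξ ≤ 1 := by
      have h := sum_erase_mul_dilate ν ν fun _ _ => 1
      simp only [mul_one] at h
      rw [hV, h, ← sum_mul, hsum0 hν]
      have := hν.apply_zero_le_one
      nlinarith
    have hlow : 2 * θ * μ 0 ≤ ∑ e ∈ Z, W e ^ 2 := by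
      calc 2 * θ * μ 0 = T ^ 2 / 4 * (ρ * μ 0 / 2) := by rw [hθ]; ring
        _ ≤ (∑ e ∈ G, W e) * (ρ * μ 0 / 2) := mul_le_mul_of_nonneg_right hGW (by positivity)
        _ ≤ ∑ e ∈ G, W e ^ 2 := by
            rw [sum_mul]
            refine sum_le_sum fun e he => ?_
            rw [sq]
            refine mul_le_mul_of_nonneg_left ?_ (hW0 e)
            have := hcase e he
            have := (hGprop e he).2.1
            linarith
        _ ≤ _ := sum_le_sum_of_subset_of_nonneg (filter_subset _ _) fun _ _ _ => sq_nonneg _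
    have hup : ∑ e ∈ Z, W e ^ 2 ≤ ∑ ξ ∈ Z, V ξ * w ξ := by
      have h1 : ∑ e ∈ Z, W e ^ 2 =
          ∑ b ∈ Z, ∑ b' ∈ Z, ν b * ν b' * ∑ e ∈ Z, μ (e * b) * μ (e * b') := by
        simp only [hW, sq, sum_mul_sum]
        rw [sum_comm]
        refine sum_congr rfl fun b _ => ?_
        rw [sum_comm]
        refine sum_congr rfl fun b' _ => ?_
        rw [mul_sum]
        exact sum_congr rfl fun e _ => by ring
      have h2 : ∑ ξ ∈ Z, V ξ * w ξ = ∑ b ∈ Z, ν b * ∑ b' ∈ Z, ν b' * w (b' * b⁻¹) := by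
        rw [← sum_erase_mul_dilate ν ν fun b a => w (a * b⁻¹)]
        refine sum_congr rfl fun ξ _ => ?_
        rw [hV]
        simp only
        rw [sum_mul]
        refine sum_congr rfl fun b hb => ?_
        have hb0 := (mem_erase.1 hb).1
        rw [mul_assoc ξ b, mul_inv_cancel₀ hb0, mul_one]
      rw [h1, h2]
      refine sum_le_sum fun b hb => ?_
      rw [mul_sum]
      refine sum_le_sum fun b' hb' => ?_
      rw [mul_assoc]
      refine mul_le_mul_of_nonneg_left (mul_le_mul_of_nonneg_left ?_ (hν.nonneg _)) (hν.nonneg _)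
      have hb0 := (mem_erase.1 hb).1
      have h3 : w (b' * b⁻¹) = ∑ e, μ (e * b) * μ (e * b') := by
        rw [hw]
        simp only
        rw [← Equiv.sum_comp (Equiv.mulRight₀ b hb0)]
        refine sum_congr rfl fun e _ => ?_
        change μ (e * b) * μ (b' * b⁻¹ * (e * b)) = _
        congr 2
        field_simp
      rw [h3]
      exact sum_le_sum_of_subset_of_nonneg (subset_univ _) fun e _ _ =>
        mul_nonneg (hμ.nonneg _) (hμ.nonneg _)
    refine ⟨Z.filter fun ξ => θ * μ 0 ≤ w ξ, fun h => (mem_erase.1 (mem_filter.1 h).1).1 rfl,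
      fun ξ hξ => (mem_filter.1 hξ).2, ?_⟩
    set R := Z.filter fun ξ => θ * μ 0 ≤ w ξ with hR
    have hfin : ∑ ξ ∈ Z, V ξ * w ξ ≤ ∑ ξ ∈ Z, ((if ξ ∈ R then ν 0 * μ 0 else 0) +
        θ * μ 0 * V ξ) := by
      refine sum_le_sum fun ξ hξ => ?_
      have h0 : 0 ≤ θ * μ 0 * V ξ := mul_nonneg (by positivity) (hV0 ξ)
      split_ifs with h
      · have := mul_le_mul (hVle ξ) (hwle ξ) (hw0 ξ) hν00.le
        linarith
      · rw [hR, mem_filter, not_and, not_le] at h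
        have := mul_le_mul_of_nonneg_left (h hξ).le (hV0 ξ)
        linarith
    rw [sum_add_distrib, ← mul_sum, ← sum_filter, filter_mem_eq_inter,
      inter_eq_right.2 (filter_subset _ _), sum_const, nsmul_eq_mul] at hfin
    have h5 : θ * μ 0 * ∑ ξ ∈ Z, V ξ ≤ θ * μ 0 * 1 :=
      mul_le_mul_of_nonneg_left hVsum (by positivity)
    refine le_of_mul_le_mul_right ?_ hμ00
    linarith

end Trilinear

section TrilinearBound

lemma exists_le_rpow (A : ℝ) {c : ℝ} (hc : 0 < c) :
    ∃ p0 : ℕ, ∀ p : ℕ, p0 ≤ p → A ≤ (p : ℝ) ^ c :=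
  Filter.eventually_atTop.1
    (((tendsto_rpow_atTop hc).comp tendsto_natCast_atTop_atTop).eventually_ge_atTop A)

lemma mul_rpow_le {P c a b d : ℝ} (hP : 1 ≤ P) (hc : c ≤ P ^ d) (h : a + d ≤ b) :
    c * P ^ a ≤ P ^ b := by
  have hP0 : 0 < P := by linarith
  calc c * P ^ a ≤ P ^ d * P ^ a := mul_le_mul_of_nonneg_right hc (by positivity)
    _ = P ^ (d + a) := (Real.rpow_add hP0 _ _).symm
    _ ≤ P ^ b := Real.rpow_le_rpow_of_exponent_le hP (by linarith)

/-- Asymptotic form of `IsPos.rich_dilates`. -/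
lemma exists_rich_dilates (τ : ℝ) (hτ : 0 < τ) :
    ∃ η : ℝ, 0 < η ∧ η ≤ τ ∧ ∃ p0 : ℕ, ∀ (p : ℕ) [Fact p.Prime], p0 ≤ p →
      ∀ f : ZMod p → ℝ, IsPos f → f 0 ≤ (p : ℝ) ^ (-τ) → (p : ℝ) ^ (-1 + τ) ≤ f 0 →
      ∀ R : Finset (ZMod p), 0 ∉ R → (p : ℝ) ^ τ ≤ #R →
      (∀ ξ ∈ R, (p : ℝ) ^ (-η) * f 0 ≤ ∑ y, f y * f (ξ * y)) → False := by
  obtain ⟨k, hk⟩ := pow_unbounded_of_one_lt (2 / τ) (one_lt_two : (1 : ℝ) < 2)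
  set m : ℕ := 88 * 7 ^ k + 30 with hm
  set D : ℝ := 2 ^ 9 * (2 ^ 375) ^ m with hD
  have hC : (0 : ℝ) < 3 + 136 * m := by positivity
  set η : ℝ := min (τ / 64) (τ / (4 * (3 + 136 * m))) with hη
  have hη0 : 0 < η := lt_min (by positivity) (by positivity)
  have hη1 : η ≤ τ / 64 := min_le_left _ _
  have hη2 : (3 + 136 * m) * η ≤ τ / 4 := by
    calc (3 + 136 * m) * η ≤ (3 + 136 * m) * (τ / (4 * (3 + 136 * m))) :=
          mul_le_mul_of_nonneg_left (min_le_right _ _) hC.le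
      _ = τ / 4 := by field_simp
  obtain ⟨p1, hp1⟩ := exists_le_rpow (2 ^ 41) (c := τ / 4) (by positivity)
  obtain ⟨p2, hp2⟩ := exists_le_rpow 2 (c := τ / 2) (by positivity)
  obtain ⟨p3, hp3⟩ := exists_le_rpow D (c := τ / 2) (by positivity)
  refine ⟨η, hη0, by linarith, p1 + p2 + p3, ?_⟩
  intro p _ hp f hf hf1 hf2 R hR0 hR hRf
  have hP1 : (1 : ℝ) < p := by exact_mod_cast (Fact.out : p.Prime).one_lt
  have hP0 : (0 : ℝ) < p := by linarith
  specialize hp1 p (by omega)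
  specialize hp2 p (by omega)
  specialize hp3 p (by omega)
  have hf0 := hf.apply_zero_pos
  set P : ℝ := (p : ℝ) with hPdef
  have hθ1 : P ^ (-η) ≤ 1 := Real.rpow_le_one_of_one_le_of_nonpos hP1.le (by linarith)
  have hX : P ^ (τ / 2) ≤ (P ^ (-η)) ^ 16 / 2 ^ 41 * #R := by
    rw [div_mul_eq_mul_div, le_div_iff₀ (by positivity), mul_comm]
    calc 2 ^ 41 * P ^ (τ / 2) ≤ P ^ (-η * (16 : ℕ) + τ) :=
          mul_rpow_le hP1.le hp1 (by push_cast; linarith)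
      _ = (P ^ (-η)) ^ 16 * P ^ τ := by
          rw [Real.rpow_add hP0, Real.rpow_mul_natCast hP0.le]
      _ ≤ _ := by gcongr
  have hlast := hf.rich_dilates (Real.rpow_pos_of_pos hP0 (-η)) hθ1 k hR0 hRf (hp2.trans hX) (by
    calc P = P ^ (1 : ℝ) := (Real.rpow_one _).symm
      _ < P ^ (τ / 2 * (2 ^ k : ℕ)) := by
          refine Real.rpow_lt_rpow_of_exponent_lt hP1 ?_
          rw [div_lt_iff₀ hτ] at hk
          push_cast
          linarith
      _ = (P ^ (τ / 2)) ^ 2 ^ k := by rw [Real.rpow_mul_natCast hP0.le]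
      _ ≤ _ := by gcongr)
  rw [← hm] at hlast
  have h1 : f 0 + 1 / (P * f 0) ≤ 2 * P ^ (-τ) := by
    have : 1 / (P * f 0) ≤ P ^ (-τ) := by
      rw [div_le_iff₀ (by positivity)]
      calc (1 : ℝ) = P ^ (-τ) * (P ^ (1 : ℝ) * P ^ (-1 + τ)) := by
            rw [← Real.rpow_add hP0, ← Real.rpow_add hP0]
            simp
        _ ≤ _ := by
            rw [Real.rpow_one]
            gcongr
    linarith
  have h2 : (2 ^ 375 / (P ^ (-η)) ^ 136) ^ m = (2 ^ 375) ^ m * P ^ (136 * m * η) := by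
    rw [← Real.rpow_mul_natCast hP0.le, div_eq_mul_inv, ← Real.rpow_neg hP0.le, mul_pow,
      ← Real.rpow_mul_natCast hP0.le]
    congr 2
    push_cast
    ring
  have h3 : P ^ (-η * (3 : ℕ)) ≤ D * P ^ (136 * m * η - τ) := by
    rw [Real.rpow_mul_natCast hP0.le]
    calc _ ≤ _ := hlast
      _ ≤ 2 ^ 8 * (2 ^ 375 / (P ^ (-η)) ^ 136) ^ m * (2 * P ^ (-τ)) := by gcongr
      _ = _ := by
          rw [h2, sub_eq_add_neg, Real.rpow_add hP0, hD]
          ring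
  have h4 : P ^ (-η * (3 : ℕ)) < P ^ (-η * (3 : ℕ)) := by
    calc _ ≤ D * P ^ (136 * m * η - τ) := h3
      _ ≤ P ^ (136 * m * η - τ / 2) := mul_rpow_le hP1.le hp3 (by linarith)
      _ < _ := Real.rpow_lt_rpow_of_exponent_lt hP1 (by push_cast; linarith)
  exact lt_irrefl _ h4

lemma exists_increment (τ : ℝ) (hτ : 0 < τ) :
    ∃ η : ℝ, 0 < η ∧ ∃ p0 : ℕ, ∀ (p : ℕ) [Fact p.Prime], p0 ≤ p →
      ∀ μ ν χ : ZMod p → ℝ, IsPos μ → IsPos ν → IsPos χ → μ 0 ≤ (p : ℝ) ^ (-(τ / 2)) →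
      ν 0 ≤ (p : ℝ) ^ (-(τ / 2)) → χ 0 ≤ (p : ℝ) ^ (-τ) →
      p * (μ 0 * ν 0 * χ 0) ≤ (p : ℝ) ^ (-τ) → (p : ℝ) ^ (-(η / 4)) ≤ tri μ ν χ →
      ∃ μ' ν' : ZMod p → ℝ, IsPos μ' ∧ IsPos ν' ∧ μ' 0 ≤ (p : ℝ) ^ (-(τ / 2)) ∧
        ν' 0 ≤ (p : ℝ) ^ (-(τ / 2)) ∧ p * (μ' 0 * ν' 0 * χ 0) ≤ (p : ℝ) ^ (-τ) ∧
        tri μ ν χ ^ 2 / 8 ≤ tri μ' ν' χ ∧ (p : ℝ) ^ η * ν 0 ≤ ν' 0 := by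
  obtain ⟨η, hη0, hητ, p1, hp1⟩ := exists_rich_dilates (τ / 4) (by positivity)
  obtain ⟨p2, hp2⟩ := exists_le_rpow 32 (c := η / 4) (by positivity)
  refine ⟨η / 2, by positivity, p1 + p2, ?_⟩
  intro p _ hp μ ν χ hμ hν hχ hμ0 hν0 hχ0 hprod hT
  have hP1 : (1 : ℝ) < p := by exact_mod_cast (Fact.out : p.Prime).one_lt
  have hP0 : (0 : ℝ) < p := by linarith
  specialize hp1 p (by omega)
  specialize hp2 p (by omega)
  have hμ00 := hμ.apply_zero_pos
  have hν00 := hν.apply_zero_pos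
  have hχ00 := hχ.apply_zero_pos
  have e16 : (16 : ℝ) ≤ (p : ℝ) ^ (η / 4) := by linarith
  have hT0 : 0 < tri μ ν χ := lt_of_lt_of_le (Real.rpow_pos_of_pos hP0 _) hT
  set T := tri μ ν χ with hTdef
  set P : ℝ := (p : ℝ) with hPdef
  have hT2 : P ^ (-(η / 4)) ≤ T ^ 2 := by
    calc P ^ (-(η / 4)) = P ^ (-(η / 2 / 4) * (2 : ℕ)) := by
          congr 1
          push_cast
          ring
      _ = (P ^ (-(η / 2 / 4))) ^ 2 := Real.rpow_mul_natCast hP0.le _ _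
      _ ≤ T ^ 2 := by gcongr
  have hT4 : P ^ (-(η / 2)) ≤ T ^ 4 := by
    calc P ^ (-(η / 2)) = P ^ (-(η / 4) * (2 : ℕ)) := by
          congr 1
          push_cast
          ring
      _ = (P ^ (-(η / 4))) ^ 2 := Real.rpow_mul_natCast hP0.le _ _
      _ ≤ (T ^ 2) ^ 2 := by gcongr
      _ = T ^ 4 := by ring
  have hsmall : P ^ (-(τ / 2)) ≤ T ^ 2 / 4 := by
    have := mul_rpow_le (a := -(τ / 2)) (b := -(η / 4)) hP1.le e16 (by linarith)
    have := Real.rpow_pos_of_pos hP0 (-(τ / 2))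
    linarith
  have hρ : 0 < P ^ (-(η / 2)) := Real.rpow_pos_of_pos hP0 _
  have hρ1 : P ^ (-(η / 2)) ≤ 1 :=
    Real.rpow_le_one_of_one_le_of_nonpos hP1.le (by linarith)
  rcases trilinear_step hμ hν hχ hTdef hT0 hρ hprod
    ((mul_rpow_le hP1.le hp2 (by linarith)).trans hT4) (hμ0.trans hsmall) (hν0.trans hsmall) with
    ⟨e, he, h1, h2, h3⟩ | ⟨h1, R, hR0, hR, hRc⟩
  · have hs := shiftConv_apply_zero_pos hμ hν e
    refine ⟨_, _, hμ.shiftConv hν e, hμ.dilMul hν he, ?_, ?_, ?_, h2, ?_⟩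
    · exact h1.trans ((mul_le_of_le_one_left hμ00.le hρ1).trans hμ0)
    · refine h3.trans ?_
      rw [div_le_iff₀ (by positivity)]
      calc 16 * P ^ (-τ) ≤ P ^ (-(τ / 2) + -(η / 2)) := mul_rpow_le hP1.le e16 (by linarith)
        _ = P ^ (-(τ / 2)) * P ^ (-(η / 2)) := Real.rpow_add hP0 _ _
        _ ≤ _ := by gcongr
    · rw [dilMul_apply_zero, mul_div_cancel₀ _ hs.ne', mul_comm (ν 0)]
      exact hprod
    · rw [dilMul_apply_zero, le_div_iff₀ hs]
      calc P ^ (η / 2) * ν 0 * shiftConv e μ ν 0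
          ≤ P ^ (η / 2) * ν 0 * (P ^ (-(η / 2)) * μ 0) := by gcongr
        _ = (P ^ (η / 2) * P ^ (-(η / 2))) * (ν 0 * μ 0) := by ring
        _ = _ := by rw [← Real.rpow_add hP0]; simp
  · exfalso
    have hθ : P ^ (-η) ≤ T ^ 2 / 16 * P ^ (-(η / 2)) := by
      have : 16 * P ^ (-(η / 2)) ≤ P ^ (-(η / 4)) := mul_rpow_le hP1.le e16 (by linarith)
      calc P ^ (-η) = P ^ (-(η / 2)) * P ^ (-(η / 2)) := by
            rw [← Real.rpow_add hP0]
            congr 1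
            ring
        _ ≤ _ := by
            gcongr
            linarith
    refine hp1 μ hμ (hμ0.trans (Real.rpow_le_rpow_of_exponent_le hP1.le (by linarith))) ?_ R hR0
      ?_ fun ξ hξ => le_trans (by gcongr) (hR ξ hξ)
    · have h2 : T ^ 4 ≤ 16 * (P ^ (1 - τ) * μ 0) := by
        refine h1.trans ?_
        rw [show P ^ (1 - τ) = P * P ^ (-τ) by
          rw [sub_eq_add_neg, Real.rpow_add hP0, Real.rpow_one], mul_assoc]
        gcongr
      have h3 : 16 * (P ^ (1 - τ) * P ^ (-1 + τ / 4)) ≤ P ^ (-(η / 2)) := by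
        rw [← Real.rpow_add hP0]
        exact mul_rpow_le hP1.le e16 (by linarith)
      refine le_of_mul_le_mul_left ?_ (Real.rpow_pos_of_pos hP0 (1 - τ))
      linarith
    · have h2 : P ^ (-η) ≤ #R * P ^ (-(τ / 2)) :=
        hθ.trans (hRc.trans (by gcongr))
      calc P ^ (τ / 4) ≤ P ^ (-η + τ / 2) :=
            Real.rpow_le_rpow_of_exponent_le hP1.le (by linarith)
        _ = P ^ (-η) * P ^ (τ / 2) := Real.rpow_add hP0 _ _
        _ ≤ #R * P ^ (-(τ / 2)) * P ^ (τ / 2) := by gcongr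
        _ = #R := by
            rw [mul_assoc, ← Real.rpow_add hP0]
            simp

/-- Power saving for trilinear forms of positive measures. -/
theorem exists_tri_le (τ : ℝ) (hτ : 0 < τ) :
    ∃ γ : ℝ, 0 < γ ∧ ∃ p0 : ℕ, ∀ (p : ℕ) [Fact p.Prime], p0 ≤ p →
      ∀ μ ν χ : ZMod p → ℝ, IsPos μ → IsPos ν → IsPos χ → μ 0 ≤ (p : ℝ) ^ (-τ) →
      ν 0 ≤ (p : ℝ) ^ (-τ) → χ 0 ≤ (p : ℝ) ^ (-τ) →
      p * (μ 0 * ν 0 * χ 0) ≤ (p : ℝ) ^ (-τ) → tri μ ν χ ≤ (p : ℝ) ^ (-γ) := by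
  obtain ⟨η, hη0, p1, hp1⟩ := exists_increment τ hτ
  obtain ⟨K, hK⟩ := exists_nat_gt (1 / η)
  set γ : ℝ := η / 4 / 3 ^ K with hγ
  have hγ0 : 0 < γ := by positivity
  obtain ⟨p2, hp2⟩ := exists_le_rpow 8 hγ0
  refine ⟨γ, hγ0, p1 + p2, ?_⟩
  intro p _ hp μ ν χ hμ hν hχ hμ0 hν0 hχ0 hprod
  have hP1 : (1 : ℝ) < p := by exact_mod_cast (Fact.out : p.Prime).one_lt
  have hP0 : (0 : ℝ) < p := by linarith
  specialize hp1 p (by omega)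
  specialize hp2 p (by omega)
  by_contra! hT
  have hle : (p : ℝ) ^ (-τ) ≤ (p : ℝ) ^ (-(τ / 2)) :=
    Real.rpow_le_rpow_of_exponent_le hP1.le (by linarith)
  have key : ∀ j ≤ K, ∃ μ' ν' : ZMod p → ℝ, IsPos μ' ∧ IsPos ν' ∧
      μ' 0 ≤ (p : ℝ) ^ (-(τ / 2)) ∧ ν' 0 ≤ (p : ℝ) ^ (-(τ / 2)) ∧
      p * (μ' 0 * ν' 0 * χ 0) ≤ (p : ℝ) ^ (-τ) ∧
      (p : ℝ) ^ (-(3 ^ j * γ)) ≤ tri μ' ν' χ ∧ (p : ℝ) ^ (η * j - 1) ≤ ν' 0 := by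
    intro j
    induction j with
    | zero =>
      intro _
      refine ⟨μ, ν, hμ, hν, hμ0.trans hle, hν0.trans hle, hprod, by simpa using hT.le, ?_⟩
      have := hν.one_le_mul_apply_zero
      rw [Nat.cast_zero, mul_zero, zero_sub, Real.rpow_neg_one]
      exact (inv_le_iff_one_le_mul₀' hP0).2 this
    | succ j ih =>
      intro hj
      obtain ⟨μ', ν', a1, a2, a3, a4, a5, a6, a7⟩ := ih (by omega)
      have hjK : 3 ^ j * γ ≤ η / 4 := by
        rw [hγ, mul_div_assoc', div_le_iff₀ (by positivity), mul_comm]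
        gcongr
        · norm_num
        · omega
      obtain ⟨μ₁, ν₁, b1, b2, b3, b4, b5, b6, b7⟩ := hp1 μ' ν' χ a1 a2 hχ a3 a4 hχ0 a5
        ((Real.rpow_le_rpow_of_exponent_le hP1.le (by linarith)).trans a6)
      refine ⟨μ₁, ν₁, b1, b2, b3, b4, b5, le_trans ?_ b6, le_trans ?_ b7⟩
      · have h1 : ((p : ℝ) ^ (-(3 ^ j * γ))) ^ 2 ≤ tri μ' ν' χ ^ 2 := by gcongr
        rw [← Real.rpow_mul_natCast hP0.le] at h1
        have h2 : 8 * (p : ℝ) ^ (-(3 ^ (j + 1) * γ)) ≤ (p : ℝ) ^ (-(3 ^ j * γ) * (2 : ℕ)) := by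
          refine mul_rpow_le hP1.le hp2 ?_
          have : (1 : ℝ) ≤ 3 ^ j := one_le_pow₀ (by norm_num)
          rw [pow_succ]
          push_cast
          nlinarith
        linarith
      · calc (p : ℝ) ^ (η * (j + 1 : ℕ) - 1) = (p : ℝ) ^ η * (p : ℝ) ^ (η * j - 1) := by
              rw [← Real.rpow_add hP0]
              congr 1
              push_cast
              ring
          _ ≤ _ := by gcongr
  obtain ⟨μ', ν', a1, a2, a3, a4, a5, a6, a7⟩ := key K le_rfl
  have h1 : (1 : ℝ) < (p : ℝ) ^ (η * K - 1) := by
    refine Real.one_lt_rpow hP1 ?_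
    rw [div_lt_iff₀ hη0] at hK
    linarith
  have := a2.apply_zero_le_one
  linarith

end TrilinearBound

section Multilinear

variable {p : ℕ} [Fact p.Prime]

/-- The multilinear form `∑ ∏ ν i (x i) g (t ∏ x i)`. -/
noncomputable def mform {R : Type*} [CommSemiring R] {n : ℕ} (ν : Fin n → ZMod p → R)
    (g : ZMod p → R) (t : ZMod p) : R :=
  ∑ x : Fin n → ZMod p, (∏ i, ν i (x i)) * g (t * ∏ i, x i)

section CommSemiring

variable {R : Type*} [CommSemiring R] {n : ℕ}

lemma mform_succ (ν : Fin (n + 1) → ZMod p → R) (g : ZMod p → R) (t : ZMod p) :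
    mform ν g t = ∑ y, ν 0 y * mform (fun i => ν i.succ) g (t * y) := by
  rw [mform, ← (Fin.consEquiv fun _ : Fin (n + 1) => ZMod p).sum_comp, Fintype.sum_prod_type]
  refine sum_congr rfl fun y _ => ?_
  rw [mform, mul_sum]
  refine sum_congr rfl fun x _ => ?_
  simp only [Fin.consEquiv_apply, Fin.prod_univ_succ, Fin.cons_zero, Fin.cons_succ, mul_assoc]

lemma mform_zero (ν : Fin 0 → ZMod p → R) (g : ZMod p → R) (t : ZMod p) : mform ν g t = g t := by
  simp [mform]

lemma mform_succ' (ν : Fin (n + 1) → ZMod p → R) (g : ZMod p → R) (t : ZMod p) :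
    mform ν g t = mform (fun i => ν i.succ) (fun s => ∑ y, ν 0 y * g (s * y)) t := by
  rw [mform_succ]
  simp only [mform, mul_sum]
  rw [sum_comm]
  refine sum_congr rfl fun x _ => sum_congr rfl fun y _ => ?_
  rw [mul_right_comm t]
  ring

end CommSemiring

variable {n : ℕ} {ν : Fin n → ZMod p → ℝ}

lemma sum_prod_eq_one (h : ∀ i, ∑ y, ν i y = 1) : ∑ x : Fin n → ZMod p, ∏ i, ν i (x i) = 1 := by
  rw [← Fintype.piFinset_univ, ← prod_univ_sum]
  simp [h]

lemma mform_pow_le (h0 : ∀ i y, 0 ≤ ν i y) (h1 : ∀ i, ∑ y, ν i y = 1) {g : ZMod p → ℝ}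
    (hg : ∀ y, 0 ≤ g y) (r : ℕ) (t : ZMod p) :
    mform ν g t ^ r ≤ mform ν (fun y => g y ^ r) t :=
  Real.pow_arith_mean_le_arith_mean_pow univ (fun x : Fin n → ZMod p => ∏ i, ν i (x i))
    (fun x => g (t * ∏ i, x i)) (fun _ _ => prod_nonneg fun _ _ => h0 _ _)
    (sum_prod_eq_one h1) (fun _ _ => hg _) r

/-- Fourier transforms can be raised to any power `2 ^ k`. -/
lemma IsPos.exists_ft_eq_pow {χ : ZMod p → ℝ} (hχ : IsPos χ) (k : ℕ) :
    ∃ χ' : ZMod p → ℝ, IsPos χ' ∧ ∀ ξ, ft χ' ξ = ft χ ξ ^ 2 ^ k := by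
  induction k with
  | zero => exact ⟨χ, hχ, by simp⟩
  | succ k ih =>
    obtain ⟨χ', h1, h2⟩ := ih
    refine ⟨_, h1.shiftConv h1 1, fun ξ => ?_⟩
    rw [ft_shiftConv h1.even, one_mul, h2, pow_succ, pow_mul, sq]

/-- The set where the Fourier transform of a multiplicative convolution is large. -/
lemma sq_le_tri {μ ν : ZMod p → ℝ} (hμ : IsPos μ) (hν : IsPos ν) {θ : ℝ} (hθ : 0 ≤ θ)
    (hθ1 : θ ≤ 1) : ∃ χ : ZMod p → ℝ, IsPos χ ∧
      χ 0 = 1 / #(univ.filter fun ξ => θ ≤ ft (mulConv ν μ) ξ) ∧ θ ^ 2 ≤ tri μ ν χ := by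
  set κ := mulConv ν μ with hκ
  have hκp : IsPos κ := hν.mulConv hμ
  set Λ : Finset (ZMod p) := univ.filter fun ξ => θ ≤ ft κ ξ with hΛ
  have h0 : (0 : ZMod p) ∈ Λ := mem_filter.2 ⟨mem_univ _, by rw [hκp.ft_zero]; exact hθ1⟩
  have hc : (0 : ℝ) < #Λ := Nat.cast_pos.2 (card_pos.2 ⟨0, h0⟩)
  have hneg : ∀ x, -x ∈ Λ ↔ x ∈ Λ := fun x => by
    simp only [hΛ, mem_filter, mem_univ, true_and, ft_neg]
  set u : ZMod p → ℝ := fun x => if x ∈ Λ then 1 / (#Λ : ℝ) else 0 with hu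
  have hu0 : ∀ x, 0 ≤ u x := fun x => by
    simp only [hu]
    split_ifs <;> positivity
  have hu1 : ∑ x, u x = 1 := by
    simp only [hu, ← sum_filter, filter_mem_eq_inter, univ_inter, sum_const, nsmul_eq_mul]
    field_simp
  have hu2 : ∀ x, u (-x) = u x := fun x => by simp only [hu, hneg]
  have hU := isPos_shiftConv_self hu0 hu1 hu2
  refine ⟨_, hU, ?_, ?_⟩
  · rw [shiftConv_apply_zero hu2]
    simp only [hu, one_mul, mul_ite, mul_zero, ite_mul, zero_mul, ← ite_and, and_self]
    simp only [← sum_filter, filter_mem_eq_inter, univ_inter, sum_const, nsmul_eq_mul]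
    field_simp
  · have h1 : tri μ ν (shiftConv 1 u u) = ∑ x, κ x * ft u x ^ 2 := by
      have h2 := sum_mul_ft_comm κ (shiftConv 1 u u) 1
      simp only [mul_one, ft_shiftConv hu2, one_mul, ← sq] at h2
      rw [h2, tri]
      refine sum_congr rfl fun c _ => ?_
      rw [hκ, ft_mulConv]
    have h3 : θ ≤ ∑ x, κ x * ft u x := by
      have h2 := sum_mul_ft_comm κ u 1
      simp only [mul_one] at h2
      rw [h2, ← one_mul θ, ← hu1, sum_mul]
      refine sum_le_sum fun x _ => ?_
      by_cases hx : x ∈ Λ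
      · exact mul_le_mul_of_nonneg_left (mem_filter.1 hx).2 (hu0 x)
      · simp [hu, hx]
    rw [h1]
    have h4 := sum_sq_le_sum_mul_sum_of_sq_le_mul univ (r := fun x => κ x * ft u x) (f := κ)
      (g := fun x => κ x * ft u x ^ 2) (fun x _ => hκp.nonneg x)
      (fun x _ => mul_nonneg (hκp.nonneg x) (sq_nonneg _)) fun x _ => le_of_eq (by ring)
    rw [hκp.sum_eq, one_mul] at h4
    exact le_trans (by gcongr) h4

lemma exists_smoothing (τ : ℝ) (hτ : 0 < τ) :
    ∃ k : ℕ, ∃ p0 : ℕ, ∀ (p : ℕ) [Fact p.Prime], p0 ≤ p →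
      ∀ μ ν : ZMod p → ℝ, IsPos μ → IsPos ν → μ 0 ≤ (p : ℝ) ^ (-τ) → ν 0 ≤ (p : ℝ) ^ (-τ) →
      ∃ χ : ZMod p → ℝ, IsPos χ ∧ (∀ ξ, ft χ ξ = ft (mulConv ν μ) ξ ^ 2 ^ k) ∧
        χ 0 ≤ 2 * (p : ℝ) ^ τ * max (p : ℝ)⁻¹ (μ 0 * ν 0) := by
  obtain ⟨γ, hγ, p1, hp1⟩ := exists_tri_le τ hτ
  obtain ⟨k, hk⟩ := pow_unbounded_of_one_lt (4 / γ) (one_lt_two : (1 : ℝ) < 2)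
  refine ⟨k, p1, ?_⟩
  intro p _ hp μ ν hμ hν hμ0 hν0
  have hP1 : (1 : ℝ) < p := by exact_mod_cast (Fact.out : p.Prime).one_lt
  have hP0 : (0 : ℝ) < p := by linarith
  have hκ := hν.mulConv hμ
  obtain ⟨χ, hχ, hχft⟩ := hκ.exists_ft_eq_pow k
  refine ⟨χ, hχ, hχft, ?_⟩
  set θ : ℝ := (p : ℝ) ^ (-(γ / 4)) with hθ
  have hθ0 : 0 < θ := Real.rpow_pos_of_pos hP0 _
  have hθ1 : θ ≤ 1 := Real.rpow_le_one_of_one_le_of_nonpos hP1.le (by linarith)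
  obtain ⟨u, hu, hu0, hutri⟩ := sq_le_tri hμ hν hθ0.le hθ1
  set Λ : Finset (ZMod p) := univ.filter fun ξ => θ ≤ ft (mulConv ν μ) ξ with hΛ
  have hΛ0 : (0 : ZMod p) ∈ Λ := mem_filter.2 ⟨mem_univ _, by rw [hκ.ft_zero]; exact hθ1⟩
  have hc : (0 : ℝ) < #Λ := Nat.cast_pos.2 (card_pos.2 ⟨0, hΛ0⟩)
  have hPτ : 0 < (p : ℝ) ^ τ := Real.rpow_pos_of_pos hP0 _
  have hΛle : (#Λ : ℝ) ≤ (p : ℝ) ^ τ * (p * max (p : ℝ)⁻¹ (μ 0 * ν 0)) := by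
    by_contra! hcon
    have h1 : (p : ℝ)⁻¹ ≤ max (p : ℝ)⁻¹ (μ 0 * ν 0) := le_max_left _ _
    have h2 : μ 0 * ν 0 ≤ max (p : ℝ)⁻¹ (μ 0 * ν 0) := le_max_right _ _
    have h3 : (1 : ℝ) ≤ p * max (p : ℝ)⁻¹ (μ 0 * ν 0) := by
      calc (1 : ℝ) = p * (p : ℝ)⁻¹ := (mul_inv_cancel₀ hP0.ne').symm
        _ ≤ _ := by gcongr
    have := hp1 p hp μ ν u hμ hν hu hμ0 hν0 (by
      rw [hu0, Real.rpow_neg hP0.le, ← one_div]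
      refine one_div_le_one_div_of_le hPτ (le_trans ?_ hcon.le)
      exact le_mul_of_one_le_right hPτ.le h3) (by
      rw [hu0, Real.rpow_neg hP0.le, ← one_div, mul_one_div, mul_div_assoc', div_le_div_iff₀ hc hPτ,
        one_mul]
      refine le_trans ?_ hcon.le
      rw [mul_comm]
      gcongr)
    have h4 : θ ^ 2 = (p : ℝ) ^ (-(γ / 2)) := by
      rw [hθ, ← Real.rpow_mul_natCast hP0.le]
      congr 1
      push_cast
      ring
    rw [h4] at hutri
    have := Real.rpow_lt_rpow_of_exponent_lt hP1 (show -γ < -(γ / 2) by linarith)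
    linarith
  have hθr : θ ^ 2 ^ k ≤ (p : ℝ)⁻¹ := by
    rw [hθ, ← Real.rpow_mul_natCast hP0.le, ← Real.rpow_neg_one]
    refine Real.rpow_le_rpow_of_exponent_le hP1.le ?_
    rw [div_lt_iff₀ hγ] at hk
    push_cast
    linarith
  have hsum : p * χ 0 ≤ #Λ + 1 := by
    rw [← sum_ft hχ.even]
    calc ∑ ξ, ft χ ξ ≤ ∑ ξ, ((if ξ ∈ Λ then (1 : ℝ) else 0) + (p : ℝ)⁻¹) := by
          refine sum_le_sum fun ξ _ => ?_
          split_ifs with h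
          · have := hχ.ft_le_one ξ
            have : (0 : ℝ) < (p : ℝ)⁻¹ := by positivity
            linarith
          · rw [zero_add, hχft]
            refine le_trans ?_ hθr
            have h1 := hκ.ft_nonneg ξ
            have h2 : ft (mulConv ν μ) ξ ≤ θ := by
              rw [hΛ, mem_filter, not_and, not_le] at h
              exact (h (mem_univ _)).le
            gcongr
      _ = #Λ + 1 := by
          rw [sum_add_distrib, ← sum_filter, filter_mem_eq_inter, univ_inter]
          simp [ZMod.card, hP0.ne']
  have h1 : (1 : ℝ) ≤ #Λ := by exact_mod_cast card_pos.2 ⟨0, hΛ0⟩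
  refine le_of_mul_le_mul_left ?_ hP0
  linarith

lemma mform_add_two (ν : Fin (n + 2) → ZMod p → ℝ) (t : ZMod p) :
    mform ν cs t = mform (fun i : Fin n => ν i.succ.succ) (ft (mulConv (ν 1) (ν 0))) t := by
  rw [mform_succ', mform_succ']
  congr 1
  funext s
  rw [ft_mulConv]
  refine sum_congr rfl fun y _ => ?_
  simp only [Fin.succ_zero_eq_one, ft]
  congr 1
  refine sum_congr rfl fun x _ => ?_
  rw [show s * y * x = x * (y * s) by ring]

lemma mform_pow_le_mform_cons {ν : Fin (n + 2) → ZMod p → ℝ} (hν : ∀ i, IsPos (ν i))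
    {χ : ZMod p → ℝ} {r : ℕ} (hχ : ∀ ξ, ft χ ξ = ft (mulConv (ν 1) (ν 0)) ξ ^ r) (t : ZMod p) :
    mform ν cs t ^ r ≤
      mform (Fin.cons χ fun i : Fin n => ν i.succ.succ : Fin (n + 1) → ZMod p → ℝ) cs t := by
  have hκ := (hν 1).mulConv (hν 0)
  rw [mform_add_two]
  refine (mform_pow_le (ν := fun i : Fin n => ν i.succ.succ) (fun i y => (hν _).nonneg y)
    (fun i => (hν _).sum_eq) hκ.ft_nonneg r t).trans (le_of_eq ?_)
  rw [mform_succ' (Fin.cons _ _)]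
  simp only [Fin.cons_zero, Fin.cons_succ]
  congr 1
  funext s
  rw [← hχ]
  exact sum_congr rfl fun y _ => by rw [mul_comm s]

/-- Power saving for multilinear forms of positive measures. -/
theorem exists_mform_le (n : ℕ) : ∀ τ : ℝ, 0 < τ →
    ∃ γ : ℝ, 0 < γ ∧ ∃ p0 : ℕ, ∀ (p : ℕ) [Fact p.Prime], p0 ≤ p →
      ∀ ν : Fin (n + 2) → ZMod p → ℝ, (∀ i, IsPos (ν i)) → (∀ i, ν i 0 ≤ (p : ℝ) ^ (-τ)) →
      ∏ i, ν i 0 ≤ (p : ℝ) ^ (-1 - τ) → ∀ t : ZMod p, t ≠ 0 → mform ν cs t ≤ (p : ℝ) ^ (-γ) := by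
  induction n with
  | zero =>
    intro τ hτ
    refine ⟨τ / 2, by positivity, 0, ?_⟩
    intro p _ _ ν hν _ hprod t ht
    have hP1 : (1 : ℝ) < p := by exact_mod_cast (Fact.out : p.Prime).one_lt
    have hP0 : (0 : ℝ) < p := by linarith
    rw [mform_add_two, mform_zero, ft_mulConv]
    refine le_of_sq_le_sq ?_ (Real.rpow_nonneg hP0.le _)
    refine ((hν 1).bilinear_sq_le (hν 0) ht).trans ?_
    rw [Fin.prod_univ_two] at hprod
    rw [← Real.rpow_mul_natCast hP0.le]
    calc (p : ℝ) * (ν 1 0 * ν 0 0) ≤ p * (p : ℝ) ^ (-1 - τ) := by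
          rw [mul_comm (ν 1 0)]
          gcongr
      _ = (p : ℝ) ^ (1 + (-1 - τ)) := by rw [Real.rpow_add hP0, Real.rpow_one]
      _ = _ := by
          congr 1
          push_cast
          ring
  | succ n ih =>
    intro τ hτ
    obtain ⟨γ, hγ, p1, hp1⟩ := ih (τ / 4) (by positivity)
    obtain ⟨k, p2, hp2⟩ := exists_smoothing (τ / 2) (by positivity)
    obtain ⟨p3, hp3⟩ := exists_le_rpow 2 (c := τ / 4) (by positivity)
    refine ⟨γ / 2 ^ k, by positivity, p1 + p2 + p3, ?_⟩
    intro p _ hp ν hν hν0 hprod t ht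
    have hP1 : (1 : ℝ) < p := by exact_mod_cast (Fact.out : p.Prime).one_lt
    have hP0 : (0 : ℝ) < p := by linarith
    specialize hp3 p (by omega)
    have hle : (p : ℝ) ^ (-τ) ≤ (p : ℝ) ^ (-(τ / 2)) :=
      Real.rpow_le_rpow_of_exponent_le hP1.le (by linarith)
    obtain ⟨χ, hχ, hχft, hχ0⟩ := hp2 p (by omega) (ν 0) (ν 1) (hν 0) (hν 1)
      ((hν0 0).trans hle) ((hν0 1).trans hle)
    have hτ1 : τ ≤ 1 := by
      by_contra! h
      have h1 := (hν 0).one_le_mul_apply_zero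
      have h2 : (p : ℝ) * ν 0 0 ≤ p * (p : ℝ) ^ (-τ) := by
        gcongr
        exact hν0 0
      have h3 : (p : ℝ) * (p : ℝ) ^ (-τ) < 1 := by
        rw [← Real.rpow_one_add' hP0.le (by linarith)]
        exact Real.rpow_lt_one_of_one_lt_of_neg hP1 (by linarith)
      linarith
    have hκ := (hν 1).mulConv (hν 0)
    have hpow : mform ν cs t ^ 2 ^ k ≤ (p : ℝ) ^ (-γ) := by
      refine (mform_pow_le_mform_cons hν hχft t).trans ?_
      have hmax : 2 * (p : ℝ) ^ (τ / 2) * max (p : ℝ)⁻¹ (ν 0 0 * ν 1 0) ≤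
          (p : ℝ) ^ (3 * τ / 4) * max (p : ℝ)⁻¹ (ν 0 0 * ν 1 0) := by
        refine mul_le_mul_of_nonneg_right (mul_rpow_le hP1.le hp3 (by linarith)) ?_
        exact le_max_of_le_left (by positivity)
      have hχ1 := hχ0.trans hmax
      have hinv : (p : ℝ)⁻¹ = (p : ℝ) ^ (-1 : ℝ) := (Real.rpow_neg_one _).symm
      refine hp1 p (by omega) _ (fun i => ?_) (fun i => ?_) ?_ t ht
      · refine Fin.cases ?_ (fun i => ?_) i
        · simpa using hχ
        · simpa using hν _
      · refine Fin.cases ?_ (fun i => ?_) i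
        · rw [Fin.cons_zero]
          refine hχ1.trans ?_
          have hm : max (p : ℝ)⁻¹ (ν 0 0 * ν 1 0) ≤ (p : ℝ) ^ (-τ) := by
            refine max_le ?_ ?_
            · rw [hinv]
              exact Real.rpow_le_rpow_of_exponent_le hP1.le (by linarith)
            · exact (mul_le_of_le_one_right (hν 0).apply_zero_pos.le
                (hν 1).apply_zero_le_one).trans (hν0 0)
          calc _ ≤ (p : ℝ) ^ (3 * τ / 4) * (p : ℝ) ^ (-τ) := by gcongr
            _ = _ := by
                rw [← Real.rpow_add hP0]
                congr 1
                ring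
        · rw [Fin.cons_succ]
          exact (hν0 _).trans (Real.rpow_le_rpow_of_exponent_le hP1.le (by linarith))
      · rw [Fin.prod_univ_succ]
        simp only [Fin.cons_zero, Fin.cons_succ]
        set Q := ∏ i : Fin (n + 1), ν i.succ.succ 0 with hQ
        have hQ0 : 0 ≤ Q := prod_nonneg fun i _ => (hν _).apply_zero_pos.le
        have hQ1 : Q ≤ (p : ℝ) ^ (-τ) := by
          rw [hQ, Fin.prod_univ_succ]
          refine (mul_le_of_le_one_right (hν _).apply_zero_pos.le ?_).trans (hν0 _)
          exact prod_le_one (fun i _ => (hν _).apply_zero_pos.le)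
            fun i _ => (hν _).apply_zero_le_one
        have hprod' : ν 0 0 * ν 1 0 * Q ≤ (p : ℝ) ^ (-1 - τ) := by
          rw [Fin.prod_univ_succ, Fin.prod_univ_succ, ← mul_assoc] at hprod
          exact hprod
        have hmQ : max (p : ℝ)⁻¹ (ν 0 0 * ν 1 0) * Q ≤ (p : ℝ) ^ (-1 - τ) := by
          rw [max_mul_of_nonneg _ _ hQ0]
          refine max_le ?_ hprod'
          rw [hinv, sub_eq_add_neg, Real.rpow_add hP0]
          gcongr
        calc χ 0 * Q ≤ (p : ℝ) ^ (3 * τ / 4) * max (p : ℝ)⁻¹ (ν 0 0 * ν 1 0) * Q := by gcongr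
          _ ≤ (p : ℝ) ^ (3 * τ / 4) * (p : ℝ) ^ (-1 - τ) := by
              rw [mul_assoc]
              gcongr
          _ = _ := by
              rw [← Real.rpow_add hP0]
              congr 1
              ring
    refine le_of_pow_le_pow_left₀ (pow_ne_zero k two_ne_zero) (Real.rpow_nonneg hP0.le _) ?_
    refine hpow.trans (le_of_eq ?_)
    rw [← Real.rpow_mul_natCast hP0.le]
    congr 1
    push_cast
    field_simp

end Multilinear

section Amplification

variable {p : ℕ} [Fact p.Prime]

/-- The (complex) Fourier transform of a real function. -/
noncomputable def fc (μ : ZMod p → ℝ) (ξ : ZMod p) : ℂ := ∑ x, (μ x : ℂ) * ZMod.stdAddChar (x * ξ)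

lemma re_fc (μ : ZMod p → ℝ) (ξ : ZMod p) : (fc μ ξ).re = ft μ ξ := by
  rw [fc, Complex.re_sum, ft]
  exact sum_congr rfl fun x _ => by rw [Complex.re_ofReal_mul, cs]

lemma sq_norm_sum (u : ZMod p → ℂ) (s : ZMod p) :
    ((‖∑ y, u y * ZMod.stdAddChar (y * s)‖ ^ 2 : ℝ) : ℂ) =
      ∑ y, ∑ z, u y * (starRingEnd ℂ) (u z) * ZMod.stdAddChar ((y - z) * s) := by
  rw [Complex.ofReal_pow, ← Complex.mul_conj', map_sum, sum_mul_sum]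
  refine sum_congr rfl fun y _ => sum_congr rfl fun z _ => ?_
  rw [map_mul (starRingEnd ℂ), ← stdAddChar_neg, sub_mul, sub_eq_add_neg, AddChar.map_add_eq_mul]
  ring

lemma sq_norm_fc (μ : ZMod p → ℝ) (s : ZMod p) :
    ‖fc μ s‖ ^ 2 = ∑ y, ∑ z, μ y * μ z * cs ((y - z) * s) := by
  have h := congrArg Complex.re (sq_norm_sum (fun y => (μ y : ℂ)) s)
  rw [Complex.ofReal_re] at h
  rw [fc, h, Complex.re_sum]
  refine sum_congr rfl fun y _ => ?_
  rw [Complex.re_sum]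
  refine sum_congr rfl fun z _ => ?_
  rw [Complex.conj_ofReal, ← Complex.ofReal_mul, Complex.re_ofReal_mul, cs]

lemma bilinear_amplify {w₀ w₁ : ZMod p → ℂ} {μ₀ μ₁ ν₀ ν₁ : ZMod p → ℝ}
    (h0 : ∀ y, ‖w₀ y‖ ≤ μ₀ y) (h1 : ∀ y, ‖w₁ y‖ ≤ μ₁ y) (hμ0 : ∑ y, μ₀ y = 1)
    (hμ1 : ∑ y, μ₁ y = 1) (hν0 : IsPos ν₀) (hf0 : ∀ ξ, ft ν₀ ξ = ‖fc μ₀ ξ‖ ^ 6)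
    (hf1 : ∀ ξ, ft ν₁ ξ = ‖fc μ₁ ξ‖ ^ 6) (t : ZMod p) :
    ‖∑ x, w₀ x * ∑ y, w₁ y * ZMod.stdAddChar (y * (t * x))‖ ^ 36 ≤
      ∑ x, ν₀ x * ft ν₁ (x * t) := by
  have m0 : ∀ y, 0 ≤ μ₀ y := fun y => (norm_nonneg _).trans (h0 y)
  have m1 : ∀ y, 0 ≤ μ₁ y := fun y => (norm_nonneg _).trans (h1 y)
  set G : ZMod p → ℂ := fun x => ∑ y, w₁ y * ZMod.stdAddChar (y * (t * x)) with hG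
  have hμμ : ∑ q : ZMod p × ZMod p, μ₁ q.1 * μ₁ q.2 = 1 := by
    rw [Fintype.sum_prod_type]
    simp only
    rw [← sum_mul_sum, hμ1, one_mul]
  set B := ∑ q : ZMod p × ZMod p, μ₁ q.1 * μ₁ q.2 * ‖fc μ₀ ((q.1 - q.2) * t)‖ with hB
  have e1 : ‖∑ x, w₀ x * G x‖ ^ 2 ≤ ∑ x, μ₀ x * ‖G x‖ ^ 2 := by
    refine le_trans ?_ (Real.pow_arith_mean_le_arith_mean_pow univ μ₀ (fun x => ‖G x‖)
      (fun x _ => m0 x) hμ0 (fun x _ => norm_nonneg _) 2)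
    gcongr
    refine (norm_sum_le _ _).trans (sum_le_sum fun x _ => ?_)
    rw [norm_mul]
    exact mul_le_mul_of_nonneg_right (h0 x) (norm_nonneg _)
  have e2 : ∑ x, μ₀ x * ‖G x‖ ^ 2 ≤ B := by
    have e3 : ((∑ x, μ₀ x * ‖G x‖ ^ 2 : ℝ) : ℂ) = ∑ q : ZMod p × ZMod p,
        w₁ q.1 * (starRingEnd ℂ) (w₁ q.2) * fc μ₀ ((q.1 - q.2) * t) := by
      rw [Complex.ofReal_sum, Fintype.sum_prod_type]
      simp only [Complex.ofReal_mul, hG, sq_norm_sum, fc, mul_sum]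
      rw [sum_comm]
      refine sum_congr rfl fun y _ => ?_
      rw [sum_comm]
      refine sum_congr rfl fun z _ => sum_congr rfl fun x _ => ?_
      rw [show (y - z) * (t * x) = x * ((y - z) * t) by ring]
      ring
    have e4 : ∑ x, μ₀ x * ‖G x‖ ^ 2 = ‖((∑ x, μ₀ x * ‖G x‖ ^ 2 : ℝ) : ℂ)‖ := by
      rw [Complex.norm_real, Real.norm_of_nonneg]
      exact sum_nonneg fun x _ => mul_nonneg (m0 x) (by positivity)
    rw [e4, e3]
    refine (norm_sum_le _ _).trans (sum_le_sum fun q _ => ?_)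
    rw [norm_mul, norm_mul, RCLike.norm_conj]
    exact mul_le_mul_of_nonneg_right
      (mul_le_mul (h1 _) (h1 _) (norm_nonneg _) (m1 _)) (norm_nonneg _)
  have hB0 : 0 ≤ B := sum_nonneg fun q _ => mul_nonneg (mul_nonneg (m1 _) (m1 _)) (norm_nonneg _)
  have e5 : B ^ 6 ≤ ∑ x, ν₀ x * ‖fc μ₁ (x * t)‖ ^ 2 := by
    refine (Real.pow_arith_mean_le_arith_mean_pow univ
      (fun q : ZMod p × ZMod p => μ₁ q.1 * μ₁ q.2) (fun q => ‖fc μ₀ ((q.1 - q.2) * t)‖)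
      (fun q _ => mul_nonneg (m1 _) (m1 _)) hμμ (fun x _ => norm_nonneg _) 6).trans (le_of_eq ?_)
    simp only [← hf0]
    rw [Fintype.sum_prod_type]
    simp only [sq_norm_fc, ft, mul_sum]
    rw [sum_comm (s := univ (α := ZMod p)) (t := univ) (f := fun x y =>
      ∑ z, ν₀ x * (μ₁ y * μ₁ z * cs ((y - z) * (x * t))))]
    refine sum_congr rfl fun y _ => ?_
    rw [sum_comm]
    refine sum_congr rfl fun x _ => sum_congr rfl fun z _ => ?_
    rw [show (y - z) * (x * t) = x * ((y - z) * t) by ring]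
    ring
  have e6 : (∑ x, ν₀ x * ‖fc μ₁ (x * t)‖ ^ 2) ^ 3 ≤ ∑ x, ν₀ x * ft ν₁ (x * t) := by
    refine (Real.pow_arith_mean_le_arith_mean_pow univ ν₀ (fun x => ‖fc μ₁ (x * t)‖ ^ 2)
      (fun x _ => hν0.nonneg x) hν0.sum_eq (fun x _ => by positivity) 3).trans (le_of_eq ?_)
    refine sum_congr rfl fun x _ => ?_
    rw [hf1, ← pow_mul]
  calc ‖∑ x, w₀ x * G x‖ ^ 36 = ((‖∑ x, w₀ x * G x‖ ^ 2) ^ 6) ^ 3 := by ring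
    _ ≤ (B ^ 6) ^ 3 := by
        have := e1.trans e2
        gcongr
    _ ≤ (∑ x, ν₀ x * ‖fc μ₁ (x * t)‖ ^ 2) ^ 3 := by gcongr
    _ ≤ _ := e6

/-- A multilinear sum with arbitrary coefficients is controlled by a multilinear form of positive
measures. -/
theorem mform_amplify (n : ℕ) : ∀ (w : Fin (n + 2) → ZMod p → ℂ) (μ ν : Fin (n + 2) → ZMod p → ℝ),
    (∀ i y, ‖w i y‖ ≤ μ i y) → (∀ i, ∑ y, μ i y = 1) → (∀ i, IsPos (ν i)) →
    (∀ i ξ, ft (ν i) ξ = ‖fc (μ i) ξ‖ ^ 6) → ∀ t : ZMod p,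
    ‖mform w ZMod.stdAddChar t‖ ^ 6 ^ (n + 2) ≤ mform ν cs t := by
  induction n with
  | zero =>
    intro w μ ν hw hμ hν hf t
    have h := bilinear_amplify (hw 0) (hw 1) (hμ 0) (hμ 1) (hν 0) (hf 0) (hf 1) t
    have e1 : ∀ x : ZMod p, ∑ y, w 1 y * ZMod.stdAddChar (t * x * y) =
        ∑ y, w 1 y * ZMod.stdAddChar (y * (t * x)) := fun x =>
      sum_congr rfl fun y _ => by rw [mul_comm y]
    have e2 : ∀ x : ZMod p, ∑ y, ν 1 y * cs (t * x * y) = ft (ν 1) (x * t) := fun x =>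
      sum_congr rfl fun y _ => by rw [mul_comm y, mul_comm t]
    simp only [mform_succ, mform_zero, Fin.succ_zero_eq_one, e1, e2]
    norm_num
    exact h
  | succ n ih =>
    intro w μ ν hw hμ hν hf t
    have m0 : ∀ i y, 0 ≤ μ i y := fun i y => (norm_nonneg _).trans (hw i y)
    set r := 6 ^ (n + 2) with hr
    set w' : Fin (n + 2) → ZMod p → ℂ := fun i => w i.succ with hw'
    set ν' : Fin (n + 2) → ZMod p → ℝ := fun i => ν i.succ with hν'
    have ih' := fun y => ih w' (fun i => μ i.succ) ν' (fun i => hw _) (fun i => hμ _)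
      (fun i => hν _)
      (fun i => hf _) (t * y)
    have h1 : ‖mform w ZMod.stdAddChar t‖ ^ r ≤ ∑ y, μ 0 y * mform ν' cs (t * y) := by
      calc ‖mform w ZMod.stdAddChar t‖ ^ r
          ≤ (∑ y, μ 0 y * ‖mform w' ZMod.stdAddChar (t * y)‖) ^ r := by
            rw [mform_succ]
            gcongr
            refine (norm_sum_le _ _).trans (sum_le_sum fun y _ => ?_)
            rw [norm_mul]
            exact mul_le_mul_of_nonneg_right (hw 0 y) (norm_nonneg _)
        _ ≤ ∑ y, μ 0 y * ‖mform w' ZMod.stdAddChar (t * y)‖ ^ r :=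
            Real.pow_arith_mean_le_arith_mean_pow univ _ _ (fun y _ => m0 0 y) (hμ 0)
              (fun _ _ => norm_nonneg _) r
        _ ≤ _ := sum_le_sum fun y _ => mul_le_mul_of_nonneg_left (ih' y) (m0 0 y)
    have h2 : ∑ y, μ 0 y * mform ν' cs (t * y) = mform ν' (ft (μ 0)) t := by
      simp only [mform, mul_sum, ft]
      rw [sum_comm]
      refine sum_congr rfl fun x _ => sum_congr rfl fun y _ => ?_
      rw [show t * y * ∏ i, x i = y * (t * ∏ i, x i) by ring]
      ring
    have h3 : mform ν' (ft (μ 0)) t ^ 6 ≤ mform ν cs t := by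
      have h4 := Real.pow_arith_mean_le_arith_mean_pow_of_even univ
        (fun x : Fin (n + 2) → ZMod p => ∏ i, ν' i (x i)) (fun x => ft (μ 0) (t * ∏ i, x i))
        (fun x _ => prod_nonneg fun i _ => (hν _).nonneg _)
        (sum_prod_eq_one fun i => (hν _).sum_eq) (show Even 6 by decide)
      refine h4.trans ?_
      rw [mform_succ']
      refine sum_le_sum fun x _ => mul_le_mul_of_nonneg_left ?_
        (prod_nonneg fun i _ => (hν _).nonneg _)
      have h5 : ∑ y, ν 0 y * cs (t * (∏ i, x i) * y) = ft (ν 0) (t * ∏ i, x i) :=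
        sum_congr rfl fun y _ => by rw [mul_comm y]
      simp only
      rw [h5, hf, ← re_fc, ← Even.pow_abs (show Even 6 by decide)]
      have := Complex.abs_re_le_norm (fc (μ 0) (t * ∏ i, x i))
      gcongr
    rw [h2] at h1
    calc ‖mform w ZMod.stdAddChar t‖ ^ 6 ^ (n + 1 + 2)
        = (‖mform w ZMod.stdAddChar t‖ ^ r) ^ 6 := by rw [← pow_mul, hr, ← pow_succ]
      _ ≤ mform ν' (ft (μ 0)) t ^ 6 := by gcongr
      _ ≤ _ := h3

end Amplification

section Inverses

variable {p : ℕ} [Fact p.Prime]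

/-- The number of `v ≤ M` with `(a + v)⁻¹ = y`. -/
noncomputable def cnt (a : ZMod p) (M : ℕ) (y : ZMod p) : ℝ :=
  ∑ v ∈ Icc 1 M, if (a + (v : ZMod p))⁻¹ = y then 1 else 0

lemma cnt_nonneg (a : ZMod p) (M : ℕ) (y : ZMod p) : 0 ≤ cnt a M y :=
  sum_nonneg fun _ _ => by split_ifs <;> norm_num

lemma sum_cnt (a : ZMod p) (M : ℕ) : ∑ y, cnt a M y = M := by
  simp only [cnt]
  rw [sum_comm]
  simp

lemma fc_cnt_div (a : ZMod p) (M : ℕ) (ξ : ZMod p) :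
    fc (fun y => cnt a M y / M) ξ =
      (∑ v ∈ Icc 1 M, ZMod.stdAddChar ((a + (v : ZMod p))⁻¹ * ξ)) / M := by
  simp only [fc, cnt]
  rw [sum_div]
  push_cast
  simp only [sum_div, sum_mul]
  rw [sum_comm]
  refine sum_congr rfl fun v _ => ?_
  rw [sum_eq_single (a + (v : ZMod p))⁻¹]
  · simp [div_eq_mul_inv, mul_comm]
  · intro y _ hy
    simp [hy.symm]
  · simp

/-- The law of a signed sum of six independent elements of `{(a + v)⁻¹ : v ≤ M}`. -/
noncomputable def sixLaw (a : ZMod p) (M : ℕ) (z : ZMod p) : ℝ :=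
  ∑ x ∈ Fintype.piFinset fun _ : Fin 6 => Icc 1 M,
    if ∑ i, (signs i : ZMod p) * (a + (x i : ZMod p))⁻¹ = z then ((M : ℝ) ^ 6)⁻¹ else 0

lemma sixLaw_zero (a : ZMod p) (M : ℕ) : sixLaw a M 0 = #(sixfold p a M) / (M : ℝ) ^ 6 := by
  rw [sixLaw, ← sum_filter, sum_const, nsmul_eq_mul, sixfold, div_eq_mul_inv]

lemma fc_sixLaw (a : ZMod p) (M : ℕ) (ξ : ZMod p) :
    fc (sixLaw a M) ξ = (‖fc (fun y => cnt a M y / M) ξ‖ ^ 6 : ℝ) := by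
  set S : ℂ := ∑ v ∈ Icc 1 M, ZMod.stdAddChar ((a + (v : ZMod p))⁻¹ * ξ) with hS
  have h1 : fc (sixLaw a M) ξ = (∑ x ∈ Fintype.piFinset fun _ : Fin 6 => Icc 1 M,
      ∏ i, ZMod.stdAddChar ((signs i : ZMod p) * (a + (x i : ZMod p))⁻¹ * ξ)) / (M : ℂ) ^ 6 := by
    simp only [fc, sixLaw]
    push_cast
    simp only [sum_div, sum_mul]
    rw [sum_comm]
    refine sum_congr rfl fun x _ => ?_
    rw [sum_eq_single (∑ i, (signs i : ZMod p) * (a + (x i : ZMod p))⁻¹)]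
    · rw [if_pos rfl, sum_mul]
      simp only [Fin.sum_univ_six, Fin.prod_univ_six, AddChar.map_add_eq_mul]
      push_cast
      ring
    · intro y _ hy
      simp [hy.symm]
    · simp
  have h2 : ∑ x ∈ Fintype.piFinset fun _ : Fin 6 => Icc 1 M,
      ∏ i, ZMod.stdAddChar ((signs i : ZMod p) * (a + (x i : ZMod p))⁻¹ * ξ) =
      S ^ 3 * (starRingEnd ℂ) S ^ 3 := by
    have hc : (starRingEnd ℂ) S =
        ∑ v ∈ Icc 1 M, ZMod.stdAddChar (-(a + (v : ZMod p))⁻¹ * ξ) := by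
      rw [hS, map_sum]
      exact sum_congr rfl fun v _ => by rw [neg_mul, stdAddChar_neg]
    rw [← prod_univ_sum (fun _ : Fin 6 => Icc 1 M) fun i v =>
      ZMod.stdAddChar ((signs i : ZMod p) * (a + (v : ZMod p))⁻¹ * ξ), hc]
    simp [Fin.prod_univ_six, signs]
    ring
  rw [h1, h2, fc_cnt_div, ← hS, norm_div, div_pow]
  push_cast
  have h3 : (‖S‖ : ℂ) ^ 6 = S ^ 3 * (starRingEnd ℂ) S ^ 3 := by
    rw [show (‖S‖ : ℂ) ^ 6 = ((‖S‖ : ℂ) ^ 2) ^ 3 by ring, ← Complex.mul_conj', mul_pow]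
  rw [h3]
  simp

lemma ft_sixLaw (a : ZMod p) (M : ℕ) (ξ : ZMod p) :
    ft (sixLaw a M) ξ = ‖fc (fun y => cnt a M y / M) ξ‖ ^ 6 := by
  rw [← re_fc, fc_sixLaw, Complex.ofReal_re]

lemma sixLaw_neg (a : ZMod p) (M : ℕ) (z : ZMod p) : sixLaw a M (-z) = sixLaw a M z := by
  have hs : ∀ i, signs (i + 3) = -signs i := by decide
  refine sum_nbij' (fun x i => x (i + 3)) (fun x i => x (i + 3)) ?_ ?_ ?_ ?_ ?_
  · intro x hx
    rw [Fintype.mem_piFinset] at hx ⊢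
    exact fun i => hx _
  · intro x hx
    rw [Fintype.mem_piFinset] at hx ⊢
    exact fun i => hx _
  · intro x _
    funext i
    change x (i + 3 + 3) = x i
    rw [add_assoc]
    simp [show (3 + 3 : Fin 6) = 0 from rfl]
  · intro x _
    funext i
    change x (i + 3 + 3) = x i
    rw [add_assoc]
    simp [show (3 + 3 : Fin 6) = 0 from rfl]
  · intro x _
    have h : ∑ i, (signs i : ZMod p) * (a + (x (i + 3) : ZMod p))⁻¹ =
        -∑ i, (signs i : ZMod p) * (a + (x i : ZMod p))⁻¹ := by
      rw [← Equiv.sum_comp (Equiv.addRight (3 : Fin 6))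
        fun i => (signs i : ZMod p) * (a + (x i : ZMod p))⁻¹, ← sum_neg_distrib]
      refine sum_congr rfl fun i _ => ?_
      rw [Equiv.coe_addRight, hs]
      push_cast
      ring
    rw [h]
    simp only [neg_eq_iff_eq_neg]

lemma isPos_sixLaw (a : ZMod p) {M : ℕ} (hM : 0 < M) : IsPos (sixLaw a M) := by
  have hM0 : (M : ℝ) ≠ 0 := by positivity
  refine .of_ft (fun z => sum_nonneg fun _ _ => ?_) ?_ (sixLaw_neg a M) fun ξ => ?_
  · split_ifs <;> positivity
  · rw [ft_sixLaw, fc_cnt_div]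
    simp [hM0]
  · rw [ft_sixLaw]
    positivity

end Inverses

/-- Power saving for sums over short intervals of suitable lengths. -/
theorem exists_mform_norm_le (n : ℕ) (hn : 7 ≤ n + 2) (ε : ℝ) (hε : 0 < ε) (hε1 : ε ≤ 1 / 100) :
    ∃ γ : ℝ, 0 < γ ∧ ∃ p0 : ℕ, ∀ (p : ℕ) [Fact p.Prime], p0 ≤ p →
      ∀ (a : Fin (n + 2) → ZMod p) (M : ℕ), (p : ℝ) ^ ((1 / 3 + ε) / (n + 2)) ≤ M →
      (M : ℝ) ≤ 2 * (p : ℝ) ^ ((1 / 3 + ε) / (n + 2)) →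
      (∀ i, ∀ v ∈ Icc 1 M, a i + (v : ZMod p) ≠ 0) →
      ∀ w : Fin (n + 2) → ZMod p → ℂ, (∀ i y, ‖w i y‖ ≤ cnt (a i) M y) →
      ∀ t : ZMod p, t ≠ 0 →
      ‖mform w ZMod.stdAddChar t‖ ≤ (p : ℝ) ^ (-γ) * (M : ℝ) ^ (n + 2) := by
  obtain ⟨C, hC1, hC⟩ := exists_card_sixfold_le ε hε
  set θ : ℝ := (1 / 3 + ε) / (n + 2) with hθ
  have hn2 : (7 : ℝ) ≤ n + 2 := by exact_mod_cast hn
  have hθ0 : 0 < θ := by positivity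
  have hθn : θ * (n + 2) = 1 / 3 + ε := by
    rw [hθ]
    field_simp
  set τ : ℝ := min θ ε with hτ
  have hτ0 : 0 < τ := lt_min hθ0 hε
  obtain ⟨γ, hγ, p1, hp1⟩ := exists_mform_le n τ hτ0
  obtain ⟨p2, hp2⟩ := exists_le_rpow C hθ0
  obtain ⟨p3, hp3⟩ := exists_le_rpow (C ^ (n + 2)) (c := ε / 2) (by positivity)
  obtain ⟨p4, hp4⟩ := exists_le_rpow (10 ^ 40 * 2 ^ 20 + 1) (c := 1 / 100) (by positivity)
  refine ⟨γ / 6 ^ (n + 2), by positivity, p1 + p2 + p3 + p4, ?_⟩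
  intro p _ hp a M hM1 hM2 ha w hw t ht
  have hP1 : (1 : ℝ) < p := by exact_mod_cast (Fact.out : p.Prime).one_lt
  have hP0 : (0 : ℝ) < p := by linarith
  specialize hp2 p (by omega)
  specialize hp3 p (by omega)
  specialize hp4 p (by omega)
  have hPθ : 0 < (p : ℝ) ^ θ := Real.rpow_pos_of_pos hP0 _
  have hM0 : (0 : ℝ) < M := hPθ.trans_le hM1
  have hMpos : 0 < M := Nat.cast_pos.1 hM0
  have hMp : 10 ^ 40 * M ^ 20 < p := by
    have h1 : (10 : ℝ) ^ 40 * (M : ℝ) ^ 20 < p := by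
      calc (10 : ℝ) ^ 40 * (M : ℝ) ^ 20 ≤ 10 ^ 40 * (2 * (p : ℝ) ^ θ) ^ 20 := by gcongr
        _ = 10 ^ 40 * 2 ^ 20 * (p : ℝ) ^ (θ * (20 : ℕ)) := by
            rw [Real.rpow_mul_natCast hP0.le]
            ring
        _ < (10 ^ 40 * 2 ^ 20 + 1) * (p : ℝ) ^ (θ * (20 : ℕ)) := by
            have := Real.rpow_pos_of_pos hP0 (θ * (20 : ℕ))
            linarith
        _ ≤ (p : ℝ) ^ (1 : ℝ) := by
            refine mul_rpow_le hP1.le hp4 ?_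
            push_cast
            nlinarith
        _ = p := Real.rpow_one _
    exact_mod_cast h1
  set ν : Fin (n + 2) → ZMod p → ℝ := fun i => sixLaw (a i) M with hν
  have hν0 : ∀ i, ν i 0 ≤ C * (p : ℝ) ^ (θ * (ε - 3)) := by
    intro i
    rw [hν]
    simp only
    rw [sixLaw_zero, div_le_iff₀ (by positivity)]
    refine (hC p (a i) M hMpos (ha i) hMp).trans ?_
    rw [mul_assoc]
    gcongr
    calc (M : ℝ) ^ (3 + ε) = (M : ℝ) ^ (ε - 3) * (M : ℝ) ^ 6 := by
          rw [← Real.rpow_natCast, ← Real.rpow_add hM0]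
          congr 1
          push_cast
          ring
      _ ≤ (p : ℝ) ^ (θ * (ε - 3)) * (M : ℝ) ^ 6 := by
          gcongr
          rw [Real.rpow_mul hP0.le]
          exact Real.rpow_le_rpow_of_nonpos hPθ hM1 (by linarith)
  have hνpos : ∀ i, IsPos (ν i) := fun i => isPos_sixLaw (a i) hMpos
  have hmain := hp1 p (by omega) ν hνpos (fun i => (hν0 i).trans ?_) ?_ t ht
  · have h := mform_amplify n (fun i y => w i y / M) (fun i y => cnt (a i) M y / M) ν
      (fun i y => by
        rw [norm_div, Complex.norm_natCast]
        exact div_le_div_of_nonneg_right (hw i y) hM0.le)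
      (fun i => by rw [← sum_div, sum_cnt, div_self hM0.ne']) hνpos
      (fun i ξ => ft_sixLaw (a i) M ξ) t
    have h2 : mform (fun i y => w i y / M) ZMod.stdAddChar t =
        mform w ZMod.stdAddChar t / (M : ℂ) ^ (n + 2) := by
      simp only [mform, prod_div_distrib, prod_const, card_univ, Fintype.card_fin, sum_div]
      exact sum_congr rfl fun x _ => by ring
    rw [h2, norm_div, norm_pow, Complex.norm_natCast] at h
    rw [← div_le_iff₀ (by positivity)]
    refine le_of_pow_le_pow_left₀ (pow_ne_zero (n + 2) (by norm_num : (6 : ℕ) ≠ 0))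
      (Real.rpow_nonneg hP0.le _) ?_
    refine (h.trans hmain).trans (le_of_eq ?_)
    rw [← Real.rpow_mul_natCast hP0.le]
    congr 1
    push_cast
    field_simp
  · refine mul_rpow_le hP1.le hp2 ?_
    have : τ ≤ θ := min_le_left _ _
    nlinarith
  · calc ∏ i, ν i 0 ≤ ∏ _i : Fin (n + 2), C * (p : ℝ) ^ (θ * (ε - 3)) :=
          prod_le_prod (fun i _ => (hνpos i).apply_zero_pos.le) fun i _ => hν0 i
      _ = C ^ (n + 2) * (p : ℝ) ^ (θ * (ε - 3) * (n + 2 : ℕ)) := by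
          rw [prod_const, card_univ, Fintype.card_fin, mul_pow, Real.rpow_mul_natCast hP0.le]
      _ ≤ _ := by
          refine mul_rpow_le hP1.le hp3 ?_
          have : τ ≤ ε := min_le_right _ _
          have h2 : θ * (ε - 3) * (n + 2 : ℕ) = (1 / 3 + ε) * (ε - 3) := by
            rw [← hθn]
            push_cast
            ring
          rw [h2]
          nlinarith

section Assembly

variable {p : ℕ} [Fact p.Prime]

lemma mform_sum {R κ : Type*} [CommSemiring R] [Fintype κ] {n : ℕ}
    (w : Fin n → κ → ZMod p → R) (g : ZMod p → R) (t : ZMod p) :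
    mform (fun i y => ∑ k, w i k y) g t = ∑ k : Fin n → κ, mform (fun i => w i (k i)) g t := by
  classical
  simp only [mform]
  rw [sum_comm]
  refine sum_congr rfl fun x _ => ?_
  rw [prod_univ_sum, Fintype.piFinset_univ, sum_mul]

lemma ep_eq_stdAddChar (z : ZMod p) : ep p z = ZMod.stdAddChar z := by
  rw [ZMod.stdAddChar_apply, ZMod.toCircle_apply, ep]

lemma sum_eq_mform {n : ℕ} (s : Fin n → Finset (ZMod p)) (α : Fin n → ZMod p → ℂ) (b : ZMod p) :
    ∑ x ∈ Fintype.piFinset s, (∏ i, α i (x i)) * ep p (b * ∏ i, (x i)⁻¹) =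
      mform (fun i y => if y⁻¹ ∈ s i then α i y⁻¹ else 0) ZMod.stdAddChar b := by
  classical
  rw [mform, ← (Equiv.piCongrRight fun _ : Fin n => Equiv.inv (ZMod p)).sum_comp]
  simp only [Equiv.piCongrRight_apply, Pi.map_apply, Equiv.inv_apply, inv_inv]
  rw [← sum_subset (subset_univ (Fintype.piFinset s))]
  · refine sum_congr rfl fun x hx => ?_
    rw [ep_eq_stdAddChar]
    congr 1
    exact prod_congr rfl fun i _ => (if_pos (Fintype.mem_piFinset.1 hx i)).symm
  · intro x _ hx
    rw [Fintype.mem_piFinset] at hx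
    obtain ⟨i, hi⟩ := not_forall.1 hx
    rw [prod_eq_zero (mem_univ i) (if_neg hi), zero_mul]

lemma exists_window {M N v : ℕ} (hM : 1 ≤ M) (hMN : M ≤ N) (hv : v ∈ Icc 1 N) :
    ∃ k < N / M + 1, ∃ u ∈ Icc 1 M, v = min (k * M) (N - M) + u := by
  rw [mem_Icc] at hv
  refine ⟨(v - 1) / M, Nat.lt_succ_of_le (Nat.div_le_div_right (by omega)), ?_⟩
  have h1 : (v - 1) / M * M ≤ v - 1 := Nat.div_mul_le_self _ _
  have h2 : v - 1 < (v - 1) / M * M + M := Nat.lt_div_mul_add (by omega)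
  refine ⟨v - min ((v - 1) / M * M) (N - M), ?_, by omega⟩
  rw [mem_Icc]
  omega

lemma exists_windows {M N : ℕ} (hM : 1 ≤ M) (hMN : M ≤ N) (a : ZMod p) (W : ZMod p → ℂ)
    (hW : ∀ y, y⁻¹ ∈ interval p a N → ‖W y‖ ≤ 1) (hW0 : ∀ y, y⁻¹ ∉ interval p a N → W y = 0) :
    ∃ (s : Fin (N / M + 1) → ℕ) (w : Fin (N / M + 1) → ZMod p → ℂ), (∀ k, s k + M ≤ N) ∧
      (∀ y, ∑ k, w k y = W y) ∧ ∀ k y, ‖w k y‖ ≤ cnt (a + (s k : ZMod p)) M y := by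
  classical
  have h : ∀ y, ∃ k : Fin (N / M + 1), y⁻¹ ∈ interval p a N →
      ∃ u ∈ Icc 1 M, y⁻¹ = a + (min (k * M) (N - M) : ℕ) + (u : ZMod p) := by
    intro y
    by_cases hy : y⁻¹ ∈ interval p a N
    · obtain ⟨v, hv, hvy⟩ := mem_image.1 hy
      obtain ⟨k, hk, u, hu, rfl⟩ := exists_window hM hMN hv
      refine ⟨⟨k, hk⟩, fun _ => ⟨u, hu, ?_⟩⟩
      rw [← hvy, Nat.cast_add, add_assoc]
    · exact ⟨0, fun h => absurd h hy⟩
  choose κ hκ using h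
  refine ⟨fun k => min (k * M) (N - M), fun k y => if κ y = k then W y else 0,
    fun k => ?_, fun y => by simp, fun k y => ?_⟩
  · have := min_le_right ((k : ℕ) * M) (N - M)
    simp only
    omega
  simp only
  by_cases hk : κ y = k
  · rw [if_pos hk]
    by_cases hy : y⁻¹ ∈ interval p a N
    · obtain ⟨u, hu, huy⟩ := hκ y hy
      rw [hk] at huy
      refine (hW y hy).trans ?_
      refine le_trans (le_of_eq ?_) (single_le_sum (f := fun v : ℕ =>
        if (a + ((min (k * M) (N - M) : ℕ) : ZMod p) + (v : ZMod p))⁻¹ = y then (1 : ℝ) else 0)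
        (fun v _ => by split_ifs <;> norm_num) hu)
      rw [if_pos (by rw [← huy, inv_inv])]
    · rw [hW0 y hy, norm_zero]
      exact cnt_nonneg _ _ _
  · rw [if_neg hk, norm_zero]
    exact cnt_nonneg _ _ _

/-- A bound for sums over intervals of length `M`, uniform in the weights, passes to intervals of
length `N ≥ M` up to a constant factor. -/
lemma norm_sum_le_of_window {n M N : ℕ} (hM : 1 ≤ M) (hMN : M ≤ N) (a : Fin n → ZMod p)
    (ha : ∀ i, (0 : ZMod p) ∉ interval p (a i) N) (α : Fin n → ZMod p → ℂ)
    (hα : ∀ i, ∀ x ∈ interval p (a i) N, ‖α i x‖ ≤ 1) (b : ZMod p) {C : ℝ}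
    (hC : ∀ c : Fin n → ZMod p, (∀ i, ∀ v ∈ Icc 1 M, c i + (v : ZMod p) ≠ 0) →
      ∀ w : Fin n → ZMod p → ℂ, (∀ i y, ‖w i y‖ ≤ cnt (c i) M y) →
      ‖mform w ZMod.stdAddChar b‖ ≤ C * (M : ℝ) ^ n) (hC0 : 0 ≤ C) :
    ‖∑ x ∈ Fintype.piFinset (fun i => interval p (a i) N),
      (∏ i, α i (x i)) * ep p (b * ∏ i, (x i)⁻¹)‖ ≤ 2 ^ n * C * (N : ℝ) ^ n := by
  choose s w hs hw hwc using fun i => exists_windows hM hMN (a i)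
    (fun y => if y⁻¹ ∈ interval p (a i) N then α i y⁻¹ else 0)
    (fun y hy => by rw [if_pos hy]; exact hα i _ hy) (fun y hy => if_neg hy)
  rw [sum_eq_mform]
  simp only [← hw]
  rw [mform_sum]
  refine (norm_sum_le _ _).trans ((sum_le_card_nsmul _ _ (C * (M : ℝ) ^ n) fun k _ => ?_).trans ?_)
  · refine hC (fun i => a i + (s i (k i) : ZMod p)) ?_ _ fun i y => hwc i (k i) y
    intro i v hv h0
    refine ha i (mem_image.2 ⟨s i (k i) + v, ?_, ?_⟩)
    · have := hs i (k i)
      rw [mem_Icc] at hv ⊢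
      omega
    · rw [← h0, Nat.cast_add, add_assoc]
  · have h1 : ((N / M + 1 : ℕ) : ℝ) * M ≤ 2 * N := by
      have : (N / M + 1) * M ≤ 2 * N := by
        have := Nat.div_mul_le_self N M
        rw [add_mul]
        omega
      exact_mod_cast this
    rw [card_univ, Fintype.card_fun, Fintype.card_fin, Fintype.card_fin, nsmul_eq_mul,
      Nat.cast_pow]
    calc ((N / M + 1 : ℕ) : ℝ) ^ n * (C * (M : ℝ) ^ n)
        = C * (((N / M + 1 : ℕ) : ℝ) * M) ^ n := by rw [mul_pow]; ring
      _ ≤ C * (2 * N) ^ n := by gcongr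
      _ = 2 ^ n * C * (N : ℝ) ^ n := by rw [mul_pow]; ring

end Assembly

end MultilinearKloosterman

/-- multilinear Kloosterman sums in `n ≥ 7` variables over intervals of
length `N` with `N^n > p^{1/3+ε}`. -/
theorem stmt_12 (n : ℕ) (hn : 7 ≤ n) (ε : ℝ) (hε : 0 < ε) :
    ∃ δ : ℝ, 0 < δ ∧ ∃ p0 : ℕ, ∀ p : ℕ, p.Prime → p0 ≤ p →
      ∀ N : ℕ, 0 < N → (p : ℝ) ^ ((1 : ℝ) / 3 + ε) < (N : ℝ) ^ n →
        ∀ a : Fin n → ZMod p,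
          (∀ i, (0 : ZMod p) ∉ interval p (a i) N) →
          ∀ α : Fin n → ZMod p → ℂ,
            (∀ i, ∀ x ∈ interval p (a i) N, ‖α i x‖ ≤ 1) →
            ∀ b : ZMod p, b ≠ 0 →
              ‖∑ x ∈ Fintype.piFinset (fun i => interval p (a i) N),
                  (∏ i, α i (x i)) * ep p (b * ∏ i, (x i)⁻¹)‖ <
                (p : ℝ) ^ (-δ) * (N : ℝ) ^ n := by
  obtain ⟨m, rfl⟩ := Nat.exists_eq_add_of_le' (show 2 ≤ n by omega)
  set η := min ε (1 / 100) with hη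
  have hη0 : 0 < η := lt_min hε (by norm_num)
  obtain ⟨γ, hγ, p1, h1⟩ := MultilinearKloosterman.exists_mform_norm_le m hn η hη0
    (min_le_right _ _)
  obtain ⟨p2, h2⟩ := MultilinearKloosterman.exists_le_rpow (2 ^ (m + 2))
    (show 0 < γ / 3 by positivity)
  refine ⟨γ / 3, by positivity, max p1 p2, ?_⟩
  intro p hp hpp N hN hNn a ha α hα b hb
  have : Fact p.Prime := ⟨hp⟩
  have hP1 : (1 : ℝ) < p := by exact_mod_cast hp.one_lt
  have hP0 : (0 : ℝ) < p := by linarith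
  set θ : ℝ := (1 / 3 + η) / (m + 2) with hθ
  have hθ0 : 0 < θ := by positivity
  have hT1 : 1 ≤ (p : ℝ) ^ θ := Real.one_le_rpow hP1.le hθ0.le
  have hTN : (p : ℝ) ^ θ < N := by
    refine lt_of_pow_lt_pow_left₀ (m + 2) (Nat.cast_nonneg N) (lt_of_le_of_lt ?_ hNn)
    rw [← Real.rpow_mul_natCast hP0.le]
    refine Real.rpow_le_rpow_of_exponent_le hP1.le ?_
    rw [hθ]
    push_cast
    rw [div_mul_cancel₀ _ (by positivity)]
    linarith [min_le_left ε (1 / 100)]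
  have hM : 1 ≤ ⌈(p : ℝ) ^ θ⌉₊ := Nat.one_le_ceil_iff.2 (by linarith)
  have hMN : ⌈(p : ℝ) ^ θ⌉₊ ≤ N := Nat.ceil_le.2 hTN.le
  refine (MultilinearKloosterman.norm_sum_le_of_window hM hMN a ha α hα b
    (C := (p : ℝ) ^ (-γ)) ?_ (by positivity)).trans_lt ?_
  · intro c hc w hw
    refine h1 p ((le_max_left _ _).trans hpp) c _ (Nat.le_ceil _) ?_ hc w hw b hb
    linarith [(Nat.ceil_lt_add_one (show 0 ≤ (p : ℝ) ^ θ by linarith)).le]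
  · have hNpos : (0 : ℝ) < (N : ℝ) ^ (m + 2) := by positivity
    refine mul_lt_mul_of_pos_right ?_ hNpos
    calc (2 : ℝ) ^ (m + 2) * (p : ℝ) ^ (-γ) ≤ (p : ℝ) ^ (γ / 3) * (p : ℝ) ^ (-γ) := by
          gcongr
          exact h2 p ((le_max_right _ _).trans hpp)
      _ = (p : ℝ) ^ (γ / 3 + -γ) := (Real.rpow_add hP0 _ _).symm
      _ < (p : ℝ) ^ (-(γ / 3)) := Real.rpow_lt_rpow_of_exponent_lt hP1 (by linarith)
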